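/- arXiv:1308.2998 — 5 statements merged into one kernel-verified Lean document; each statement's English description precedes it below -/
import Mathlib

section
/- Let I be the index set consisting of the vertex labels v ∈ ℤ³ with 0 ≤ v₁+v₂+v₃ ≤ 2 together with the face labels (v,x), (v,y), (v,z) for v ∈ ℤ³ with v₁+v₂+v₃ = 0, and let K be the fraction field of the multivariate polynomial ring over ℚ in variables indexed by I. Suppose h, h⁽ˣ⁾, h⁽ʸ⁾, h⁽ᶻ⁾ : ℤ³ → K take nonzero values, satisfy the hexahedron recurrence at every v with v₁+v₂+v₃ ≥ 0, and agree with the corresponding variables on the initial set (h(v) is the variable indexed by v whenever 0 ≤ v₁+v₂+v₃ ≤ 2, and h⁽ˣ⁾(v), h⁽ʸ⁾(v), h⁽ᶻ⁾(v) are the variables indexed by (v,x), (v,y), (v,z) whenever v₁+v₂+v₃ = 0). Then for every v with v₁+v₂+v₃ ≥ 0, each of h(v), h⁽ˣ⁾(v), h⁽ʸ⁾(v), h⁽ᶻ⁾(v) lies in the subring of K generated by the images of the variables indexed by I together with their multiplicative inverses (i.e., each is a Laurent polynomial in the initial variables). -/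
/-- The hexahedron recurrence for functions `h, hx, hy, hz : ℤ³ → K` at the point `(i,j,k)`. -/
def HexRec {K : Type*} [CommRing K] (h hx hy hz : ℤ × ℤ × ℤ → K) : ℤ × ℤ × ℤ → Prop
  | (i, j, k) =>
    hx (i + 1, j, k) * hx (i, j, k) * h (i, j, k)
        = hx (i, j, k) * hy (i, j, k) * hz (i, j, k)
          + h (i + 1, j, k) * h (i, j + 1, k) * h (i, j, k + 1)
          + h (i, j, k) * h (i + 1, j, k) * h (i, j + 1, k + 1)
    ∧ hy (i, j + 1, k) * hy (i, j, k) * h (i, j, k)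
        = hx (i, j, k) * hy (i, j, k) * hz (i, j, k)
          + h (i + 1, j, k) * h (i, j + 1, k) * h (i, j, k + 1)
          + h (i, j, k) * h (i, j + 1, k) * h (i + 1, j, k + 1)
    ∧ hz (i, j, k + 1) * hz (i, j, k) * h (i, j, k)
        = hx (i, j, k) * hy (i, j, k) * hz (i, j, k)
          + h (i + 1, j, k) * h (i, j + 1, k) * h (i, j, k + 1)
          + h (i, j, k) * h (i, j, k + 1) * h (i + 1, j + 1, k)
    ∧ h (i + 1, j + 1, k + 1) * h (i, j, k) ^ 2 *
          (hx (i, j, k) * hy (i, j, k) * hz (i, j, k))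
        = (hx (i, j, k) * hy (i, j, k) * hz (i, j, k)) ^ 2
          + hx (i, j, k) * hy (i, j, k) * hz (i, j, k) *
            (2 * (h (i + 1, j, k) * h (i, j + 1, k) * h (i, j, k + 1))
              + h (i, j, k) * h (i + 1, j, k) * h (i, j + 1, k + 1)
              + h (i, j, k) * h (i, j + 1, k) * h (i + 1, j, k + 1)
              + h (i, j, k) * h (i, j, k + 1) * h (i + 1, j + 1, k))
          + (h (i + 1, j, k) * h (i, j + 1, k) + h (i, j, k) * h (i + 1, j + 1, k)) *
            (h (i + 1, j, k) * h (i, j, k + 1) + h (i, j, k) * h (i + 1, j, k + 1)) *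
            (h (i, j + 1, k) * h (i, j, k + 1) + h (i, j, k) * h (i, j + 1, k + 1))

/-- Initial labels: vertex labels `v ∈ ℤ³` with `0 ≤ v₁+v₂+v₃ ≤ 2`, and face labels
`(v, x)`, `(v, y)`, `(v, z)` (the three directions encoded by `Fin 3`) with
`v₁+v₂+v₃ = 0`. -/
def IsInitLabel : (ℤ × ℤ × ℤ) ⊕ ((ℤ × ℤ × ℤ) × Fin 3) → Prop
  | Sum.inl v => 0 ≤ v.1 + v.2.1 + v.2.2 ∧ v.1 + v.2.1 + v.2.2 ≤ 2
  | Sum.inr (v, _) => v.1 + v.2.1 + v.2.2 = 0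

/-- The index set `I` of initial variables. -/
abbrev HexIdx := {p : (ℤ × ℤ × ℤ) ⊕ ((ℤ × ℤ × ℤ) × Fin 3) // IsInitLabel p}

/-- The fraction field of the polynomial ring over `ℚ` in the initial variables. -/
abbrev HexField := FractionRing (MvPolynomial HexIdx ℚ)

/-- The image in the fraction field of the variable indexed by `i`. -/
noncomputable def hexVar (i : HexIdx) : HexField :=
  algebraMap (MvPolynomial HexIdx ℚ) HexField (MvPolynomial.X i)

/-- A vertex function `h` on the cubic lattice, together with two families `f`, `g` of
functions on the faces of the lattice. -/
structure HexData (R : Type*) where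
  h : ℤ → ℤ → ℤ → R
  fx : ℤ → ℤ → ℤ → R
  fy : ℤ → ℤ → ℤ → R
  fz : ℤ → ℤ → ℤ → R
  gx : ℤ → ℤ → ℤ → R
  gy : ℤ → ℤ → ℤ → R
  gz : ℤ → ℤ → ℤ → R

namespace HexData

section Basic

variable {R : Type*}

/-- Exchanging the two families of face variables. -/
def swap (D : HexData R) : HexData R := ⟨D.h, D.gx, D.gy, D.gz, D.fx, D.fy, D.fz⟩

/-- Rotating the coordinate axes. -/
def rot (D : HexData R) : HexData R where
  h i j k := D.h k i j
  fx i j k := D.fy k i j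
  fy i j k := D.fz k i j
  fz i j k := D.fx k i j
  gx i j k := D.gy k i j
  gy i j k := D.gz k i j
  gz i j k := D.gx k i j

/-- Translating the lattice. -/
def shift (D : HexData R) (a b c : ℤ) : HexData R where
  h i j k := D.h (i + a) (j + b) (k + c)
  fx i j k := D.fx (i + a) (j + b) (k + c)
  fy i j k := D.fy (i + a) (j + b) (k + c)
  fz i j k := D.fz (i + a) (j + b) (k + c)
  gx i j k := D.gx (i + a) (j + b) (k + c)
  gy i j k := D.gy (i + a) (j + b) (k + c)
  gz i j k := D.gz (i + a) (j + b) (k + c)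

/-- The vertex variables up to level `N + 2` and the face variables up to level `N` satisfy a
predicate `P`. -/
structure UpTo (D : HexData R) (N : ℤ) (P : R → Prop) : Prop where
  h : ∀ i j k, 0 ≤ i + j + k → i + j + k ≤ N + 2 → P (D.h i j k)
  fx : ∀ i j k, 0 ≤ i + j + k → i + j + k ≤ N → P (D.fx i j k)
  fy : ∀ i j k, 0 ≤ i + j + k → i + j + k ≤ N → P (D.fy i j k)
  fz : ∀ i j k, 0 ≤ i + j + k → i + j + k ≤ N → P (D.fz i j k)
  gx : ∀ i j k, 0 ≤ i + j + k → i + j + k ≤ N → P (D.gx i j k)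
  gy : ∀ i j k, 0 ≤ i + j + k → i + j + k ≤ N → P (D.gy i j k)
  gz : ∀ i j k, 0 ≤ i + j + k → i + j + k ≤ N → P (D.gz i j k)

theorem UpTo.swap {D : HexData R} {N : ℤ} {P : R → Prop} (H : D.UpTo N P) : D.swap.UpTo N P :=
  ⟨H.h, H.gx, H.gy, H.gz, H.fx, H.fy, H.fz⟩

theorem UpTo.rot {D : HexData R} {N : ℤ} {P : R → Prop} (H : D.UpTo N P) : D.rot.UpTo N P where
  h i j k h0 h1 := H.h k i j (by omega) (by omega)
  fx i j k h0 h1 := H.fy k i j (by omega) (by omega)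
  fy i j k h0 h1 := H.fz k i j (by omega) (by omega)
  fz i j k h0 h1 := H.fx k i j (by omega) (by omega)
  gx i j k h0 h1 := H.gy k i j (by omega) (by omega)
  gy i j k h0 h1 := H.gz k i j (by omega) (by omega)
  gz i j k h0 h1 := H.gx k i j (by omega) (by omega)

theorem UpTo.imp {D : HexData R} {N : ℤ} {P Q : R → Prop} (H : D.UpTo N P)
    (hPQ : ∀ x, P x → Q x) : D.UpTo N Q where
  h i j k h0 h1 := hPQ _ (H.h i j k h0 h1)
  fx i j k h0 h1 := hPQ _ (H.fx i j k h0 h1)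
  fy i j k h0 h1 := hPQ _ (H.fy i j k h0 h1)
  fz i j k h0 h1 := hPQ _ (H.fz i j k h0 h1)
  gx i j k h0 h1 := hPQ _ (H.gx i j k h0 h1)
  gy i j k h0 h1 := hPQ _ (H.gy i j k h0 h1)
  gz i j k h0 h1 := hPQ _ (H.gz i j k h0 h1)

theorem UpTo.mono {D : HexData R} {M N : ℤ} {P : R → Prop} (H : D.UpTo N P) (hMN : M ≤ N) :
    D.UpTo M P where
  h i j k h0 h1 := H.h i j k h0 (by omega)
  fx i j k h0 h1 := H.fx i j k h0 (by omega)
  fy i j k h0 h1 := H.fy i j k h0 (by omega)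
  fz i j k h0 h1 := H.fz i j k h0 (by omega)
  gx i j k h0 h1 := H.gx i j k h0 (by omega)
  gy i j k h0 h1 := H.gy i j k h0 (by omega)
  gz i j k h0 h1 := H.gz i j k h0 (by omega)

end Basic

section Ring

variable {R S : Type*} [CommRing R] [CommRing S]

/-- The polynomial form of the hexahedron recurrence, in which `g` is the complementary face
variable: it holds for `h` in levels at most `N + 2` and for `f`, `g` in levels at most `N`. -/
structure IsSol (D : HexData R) (N : ℤ) : Prop where
  relx : ∀ i j k, 0 ≤ i + j + k → i + j + k ≤ N → D.fx i j k * D.gx i j k =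
    D.h i (j + 1) k * D.h i j (k + 1) + D.h i j k * D.h i (j + 1) (k + 1)
  rely : ∀ i j k, 0 ≤ i + j + k → i + j + k ≤ N → D.fy i j k * D.gy i j k =
    D.h i j (k + 1) * D.h (i + 1) j k + D.h i j k * D.h (i + 1) j (k + 1)
  relz : ∀ i j k, 0 ≤ i + j + k → i + j + k ≤ N → D.fz i j k * D.gz i j k =
    D.h (i + 1) j k * D.h i (j + 1) k + D.h i j k * D.h (i + 1) (j + 1) k
  stepfx : ∀ i j k, 0 ≤ i + j + k → i + j + k < N → D.fx (i + 1) j k * D.h i j k =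
    D.fy i j k * D.fz i j k + D.h (i + 1) j k * D.gx i j k
  stepfy : ∀ i j k, 0 ≤ i + j + k → i + j + k < N → D.fy i (j + 1) k * D.h i j k =
    D.fz i j k * D.fx i j k + D.h i (j + 1) k * D.gy i j k
  stepfz : ∀ i j k, 0 ≤ i + j + k → i + j + k < N → D.fz i j (k + 1) * D.h i j k =
    D.fx i j k * D.fy i j k + D.h i j (k + 1) * D.gz i j k
  stepgx : ∀ i j k, 0 ≤ i + j + k → i + j + k < N → D.gx (i + 1) j k * D.h i j k =
    D.gy i j k * D.gz i j k + D.h (i + 1) j k * D.fx i j k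
  stepgy : ∀ i j k, 0 ≤ i + j + k → i + j + k < N → D.gy i (j + 1) k * D.h i j k =
    D.gz i j k * D.gx i j k + D.h i (j + 1) k * D.fy i j k
  stepgz : ∀ i j k, 0 ≤ i + j + k → i + j + k < N → D.gz i j (k + 1) * D.h i j k =
    D.gx i j k * D.gy i j k + D.h i j (k + 1) * D.fz i j k
  steph : ∀ i j k, 0 ≤ i + j + k → i + j + k < N →
    D.h (i + 1) (j + 1) (k + 1) * D.h i j k ^ 2 =
      D.fx i j k * D.fy i j k * D.fz i j k + D.gx i j k * D.gy i j k * D.gz i j k +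
      2 * (D.h (i + 1) j k * D.h i (j + 1) k * D.h i j (k + 1)) +
      D.h i j k * (D.h (i + 1) j k * D.h i (j + 1) (k + 1) +
        D.h i (j + 1) k * D.h (i + 1) j (k + 1) + D.h i j (k + 1) * D.h (i + 1) (j + 1) k)

/-- The image of the data under a ring homomorphism. -/
def map (D : HexData R) (φ : R →+* S) : HexData S where
  h i j k := φ (D.h i j k)
  fx i j k := φ (D.fx i j k)
  fy i j k := φ (D.fy i j k)
  fz i j k := φ (D.fz i j k)
  gx i j k := φ (D.gx i j k)
  gy i j k := φ (D.gy i j k)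
  gz i j k := φ (D.gz i j k)

theorem IsSol.mono {D : HexData R} {M N : ℤ} (H : D.IsSol N) (hMN : M ≤ N) : D.IsSol M where
  relx i j k h0 h1 := H.relx i j k h0 (by omega)
  rely i j k h0 h1 := H.rely i j k h0 (by omega)
  relz i j k h0 h1 := H.relz i j k h0 (by omega)
  stepfx i j k h0 h1 := H.stepfx i j k h0 (by omega)
  stepfy i j k h0 h1 := H.stepfy i j k h0 (by omega)
  stepfz i j k h0 h1 := H.stepfz i j k h0 (by omega)
  stepgx i j k h0 h1 := H.stepgx i j k h0 (by omega)
  stepgy i j k h0 h1 := H.stepgy i j k h0 (by omega)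
  stepgz i j k h0 h1 := H.stepgz i j k h0 (by omega)
  steph i j k h0 h1 := H.steph i j k h0 (by omega)

theorem IsSol.swap {D : HexData R} {N : ℤ} (H : D.IsSol N) : D.swap.IsSol N where
  relx i j k h0 h1 := (mul_comm _ _).trans (H.relx i j k h0 h1)
  rely i j k h0 h1 := (mul_comm _ _).trans (H.rely i j k h0 h1)
  relz i j k h0 h1 := (mul_comm _ _).trans (H.relz i j k h0 h1)
  stepfx := H.stepgx
  stepfy := H.stepgy
  stepfz := H.stepgz
  stepgx := H.stepfx
  stepgy := H.stepfy
  stepgz := H.stepfz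
  steph i j k h0 h1 := by
    dsimp only [HexData.swap]
    linear_combination H.steph i j k h0 h1

theorem IsSol.rot {D : HexData R} {N : ℤ} (H : D.IsSol N) : D.rot.IsSol N where
  relx i j k h0 h1 := H.rely k i j (by omega) (by omega)
  rely i j k h0 h1 := H.relz k i j (by omega) (by omega)
  relz i j k h0 h1 := H.relx k i j (by omega) (by omega)
  stepfx i j k h0 h1 := H.stepfy k i j (by omega) (by omega)
  stepfy i j k h0 h1 := H.stepfz k i j (by omega) (by omega)
  stepfz i j k h0 h1 := H.stepfx k i j (by omega) (by omega)
  stepgx i j k h0 h1 := H.stepgy k i j (by omega) (by omega)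
  stepgy i j k h0 h1 := H.stepgz k i j (by omega) (by omega)
  stepgz i j k h0 h1 := H.stepgx k i j (by omega) (by omega)
  steph i j k h0 h1 := by
    dsimp only [HexData.rot]
    linear_combination H.steph k i j (by omega) (by omega)

theorem IsSol.shift {D : HexData R} {M N a b c : ℤ} (H : D.IsSol N) (h0 : 0 ≤ a + b + c)
    (hM : M + (a + b + c) ≤ N) : (D.shift a b c).IsSol M := by
  constructor <;> intro i j k hl hu <;> dsimp only [HexData.shift] <;>
    simp only [add_right_comm _ (1 : ℤ)]
  · exact H.relx _ _ _ (by omega) (by omega)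
  · exact H.rely _ _ _ (by omega) (by omega)
  · exact H.relz _ _ _ (by omega) (by omega)
  · exact H.stepfx _ _ _ (by omega) (by omega)
  · exact H.stepfy _ _ _ (by omega) (by omega)
  · exact H.stepfz _ _ _ (by omega) (by omega)
  · exact H.stepgx _ _ _ (by omega) (by omega)
  · exact H.stepgy _ _ _ (by omega) (by omega)
  · exact H.stepgz _ _ _ (by omega) (by omega)
  · exact H.steph _ _ _ (by omega) (by omega)

theorem IsSol.map {D : HexData R} {N : ℤ} (H : D.IsSol N) (φ : R →+* S) : (D.map φ).IsSol N := by
  constructor <;> intro i j k hl hu <;> dsimp only [HexData.map]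
  · simpa using congrArg φ (H.relx i j k hl hu)
  · simpa using congrArg φ (H.rely i j k hl hu)
  · simpa using congrArg φ (H.relz i j k hl hu)
  · simpa using congrArg φ (H.stepfx i j k hl hu)
  · simpa using congrArg φ (H.stepfy i j k hl hu)
  · simpa using congrArg φ (H.stepfz i j k hl hu)
  · simpa using congrArg φ (H.stepgx i j k hl hu)
  · simpa using congrArg φ (H.stepgy i j k hl hu)
  · simpa using congrArg φ (H.stepgz i j k hl hu)
  · simpa [two_mul] using congrArg φ (H.steph i j k hl hu)

open Classical in
/-- The data with values outside a subring replaced by zero. -/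
noncomputable def lift (D : HexData R) (T : Subring R) : HexData T where
  h i j k := if H : D.h i j k ∈ T then ⟨_, H⟩ else 0
  fx i j k := if H : D.fx i j k ∈ T then ⟨_, H⟩ else 0
  fy i j k := if H : D.fy i j k ∈ T then ⟨_, H⟩ else 0
  fz i j k := if H : D.fz i j k ∈ T then ⟨_, H⟩ else 0
  gx i j k := if H : D.gx i j k ∈ T then ⟨_, H⟩ else 0
  gy i j k := if H : D.gy i j k ∈ T then ⟨_, H⟩ else 0
  gz i j k := if H : D.gz i j k ∈ T then ⟨_, H⟩ else 0

theorem IsSol.lift {D : HexData R} {N : ℤ} (H : D.IsSol N) {T : Subring R}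
    (hT : D.UpTo N (· ∈ T)) : (D.lift T).IsSol N := by
  obtain ⟨mh, mfx, mfy, mfz, mgx, mgy, mgz⟩ := hT
  constructor <;> intro i j k hl hu <;> dsimp only [HexData.lift] <;>
    simp (discharger := omega) only [mh, mfx, mfy, mfz, mgx, mgy, mgz] <;>
    apply Subtype.ext
  · simpa using H.relx i j k hl hu
  · simpa using H.rely i j k hl hu
  · simpa using H.relz i j k hl hu
  · simpa using H.stepfx i j k hl hu
  · simpa using H.stepfy i j k hl hu
  · simpa using H.stepfz i j k hl hu
  · simpa using H.stepgx i j k hl hu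
  · simpa using H.stepgy i j k hl hu
  · simpa using H.stepgz i j k hl hu
  · simpa [two_mul] using H.steph i j k hl hu

end Ring

end HexData

namespace HexData

section Closure

variable {R : Type*} [CommRing R]

/-- A subring containing the initial data and closed under division by the initial `f` and by
the values of `h` contains the whole solution. -/
theorem IsSol.upTo_mem {D : HexData R} {N : ℕ} (H : D.IsSol N) (T : Subring R)
    (h0 : ∀ i j k, 0 ≤ i + j + k → i + j + k ≤ 2 → D.h i j k ∈ T)
    (fx0 : ∀ i j k, i + j + k = 0 → D.fx i j k ∈ T)
    (fy0 : ∀ i j k, i + j + k = 0 → D.fy i j k ∈ T)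
    (fz0 : ∀ i j k, i + j + k = 0 → D.fz i j k ∈ T)
    (dx : ∀ i j k, i + j + k = 0 → ∀ y, D.fx i j k * y ∈ T → y ∈ T)
    (dy : ∀ i j k, i + j + k = 0 → ∀ y, D.fy i j k * y ∈ T → y ∈ T)
    (dz : ∀ i j k, i + j + k = 0 → ∀ y, D.fz i j k * y ∈ T → y ∈ T)
    (dh : ∀ i j k : ℤ, 0 ≤ i + j + k → i + j + k < N → ∀ y, y * D.h i j k ∈ T → y ∈ T) :
    D.UpTo N (· ∈ T) := by
  suffices ∀ m : ℕ, m ≤ N → D.UpTo m (· ∈ T) from this N le_rfl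
  intro m
  induction m with
  | zero =>
    intro _
    refine ⟨fun i j k l u => h0 i j k l (by simpa using u), ?_, ?_, ?_, ?_, ?_, ?_⟩ <;>
      intro i j k l u <;> norm_num at u <;> have e := le_antisymm u l
    · exact fx0 i j k e
    · exact fy0 i j k e
    · exact fz0 i j k e
    · refine dx i j k e _ ?_
      rw [H.relx i j k l (by omega)]
      exact add_mem (mul_mem (h0 _ _ _ (by omega) (by omega)) (h0 _ _ _ (by omega) (by omega)))
        (mul_mem (h0 _ _ _ (by omega) (by omega)) (h0 _ _ _ (by omega) (by omega)))
    · refine dy i j k e _ ?_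
      rw [H.rely i j k l (by omega)]
      exact add_mem (mul_mem (h0 _ _ _ (by omega) (by omega)) (h0 _ _ _ (by omega) (by omega)))
        (mul_mem (h0 _ _ _ (by omega) (by omega)) (h0 _ _ _ (by omega) (by omega)))
    · refine dz i j k e _ ?_
      rw [H.relz i j k l (by omega)]
      exact add_mem (mul_mem (h0 _ _ _ (by omega) (by omega)) (h0 _ _ _ (by omega) (by omega)))
        (mul_mem (h0 _ _ _ (by omega) (by omega)) (h0 _ _ _ (by omega) (by omega)))
  | succ m ih =>
    intro hm
    have P := ih (by omega)
    have two : (2 : R) ∈ T := natCast_mem T 2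
    refine ⟨?_, ?_, ?_, ?_, ?_, ?_, ?_⟩ <;> intro i j k l u <;> push_cast at u
    · by_cases hu : i + j + k ≤ m + 2
      · exact P.h i j k l hu
      have key := H.steph (i - 1) (j - 1) (k - 1) (by omega) (by omega)
      simp only [sub_add_cancel] at key
      refine dh (i - 1) (j - 1) (k - 1) (by omega) (by omega) _
        (dh (i - 1) (j - 1) (k - 1) (by omega) (by omega) _ ?_)
      rw [mul_assoc, ← sq, key]
      have q : ∀ {a b c : R}, a ∈ T → b ∈ T → c ∈ T → a * b * c ∈ T :=
        fun ha hb hc => mul_mem (mul_mem ha hb) hc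
      refine add_mem (add_mem (add_mem
        (q (P.fx _ _ _ ?_ ?_) (P.fy _ _ _ ?_ ?_) (P.fz _ _ _ ?_ ?_))
        (q (P.gx _ _ _ ?_ ?_) (P.gy _ _ _ ?_ ?_) (P.gz _ _ _ ?_ ?_)))
        (mul_mem two (q (P.h _ _ _ ?_ ?_) (P.h _ _ _ ?_ ?_) (P.h _ _ _ ?_ ?_))))
        (mul_mem (P.h _ _ _ ?_ ?_) (add_mem (add_mem
          (mul_mem (P.h _ _ _ ?_ ?_) (P.h _ _ _ ?_ ?_))
          (mul_mem (P.h _ _ _ ?_ ?_) (P.h _ _ _ ?_ ?_)))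
          (mul_mem (P.h _ _ _ ?_ ?_) (P.h _ _ _ ?_ ?_)))) <;> omega
    · by_cases hu : i + j + k ≤ m
      · exact P.fx i j k l hu
      have key := H.stepfx (i - 1) j k (by omega) (by omega)
      simp only [sub_add_cancel] at key
      refine dh (i - 1) j k (by omega) (by omega) _ ?_
      rw [key]
      refine add_mem (mul_mem (P.fy _ _ _ ?_ ?_) (P.fz _ _ _ ?_ ?_))
        (mul_mem (P.h _ _ _ ?_ ?_) (P.gx _ _ _ ?_ ?_)) <;> omega
    · by_cases hu : i + j + k ≤ m
      · exact P.fy i j k l hu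
      have key := H.stepfy i (j - 1) k (by omega) (by omega)
      simp only [sub_add_cancel] at key
      refine dh i (j - 1) k (by omega) (by omega) _ ?_
      rw [key]
      refine add_mem (mul_mem (P.fz _ _ _ ?_ ?_) (P.fx _ _ _ ?_ ?_))
        (mul_mem (P.h _ _ _ ?_ ?_) (P.gy _ _ _ ?_ ?_)) <;> omega
    · by_cases hu : i + j + k ≤ m
      · exact P.fz i j k l hu
      have key := H.stepfz i j (k - 1) (by omega) (by omega)
      simp only [sub_add_cancel] at key
      refine dh i j (k - 1) (by omega) (by omega) _ ?_
      rw [key]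
      refine add_mem (mul_mem (P.fx _ _ _ ?_ ?_) (P.fy _ _ _ ?_ ?_))
        (mul_mem (P.h _ _ _ ?_ ?_) (P.gz _ _ _ ?_ ?_)) <;> omega
    · by_cases hu : i + j + k ≤ m
      · exact P.gx i j k l hu
      have key := H.stepgx (i - 1) j k (by omega) (by omega)
      simp only [sub_add_cancel] at key
      refine dh (i - 1) j k (by omega) (by omega) _ ?_
      rw [key]
      refine add_mem (mul_mem (P.gy _ _ _ ?_ ?_) (P.gz _ _ _ ?_ ?_))
        (mul_mem (P.h _ _ _ ?_ ?_) (P.fx _ _ _ ?_ ?_)) <;> omega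
    · by_cases hu : i + j + k ≤ m
      · exact P.gy i j k l hu
      have key := H.stepgy i (j - 1) k (by omega) (by omega)
      simp only [sub_add_cancel] at key
      refine dh i (j - 1) k (by omega) (by omega) _ ?_
      rw [key]
      refine add_mem (mul_mem (P.gz _ _ _ ?_ ?_) (P.gx _ _ _ ?_ ?_))
        (mul_mem (P.h _ _ _ ?_ ?_) (P.fy _ _ _ ?_ ?_)) <;> omega
    · by_cases hu : i + j + k ≤ m
      · exact P.gz i j k l hu
      have key := H.stepgz i j (k - 1) (by omega) (by omega)
      simp only [sub_add_cancel] at key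
      refine dh i j (k - 1) (by omega) (by omega) _ ?_
      rw [key]
      refine add_mem (mul_mem (P.gx _ _ _ ?_ ?_) (P.gy _ _ _ ?_ ?_))
        (mul_mem (P.h _ _ _ ?_ ?_) (P.fz _ _ _ ?_ ?_)) <;> omega

/-- A pair of data, as data with values in the product ring. -/
def pair {S : Type*} (D : HexData R) (E : HexData S) : HexData (R × S) where
  h i j k := (D.h i j k, E.h i j k)
  fx i j k := (D.fx i j k, E.fx i j k)
  fy i j k := (D.fy i j k, E.fy i j k)
  fz i j k := (D.fz i j k, E.fz i j k)
  gx i j k := (D.gx i j k, E.gx i j k)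
  gy i j k := (D.gy i j k, E.gy i j k)
  gz i j k := (D.gz i j k, E.gz i j k)

theorem IsSol.pair {S : Type*} [CommRing S] {D : HexData R} {E : HexData S} {N : ℤ}
    (H : D.IsSol N) (H' : E.IsSol N) : (D.pair E).IsSol N where
  relx i j k l u := Prod.ext (H.relx i j k l u) (H'.relx i j k l u)
  rely i j k l u := Prod.ext (H.rely i j k l u) (H'.rely i j k l u)
  relz i j k l u := Prod.ext (H.relz i j k l u) (H'.relz i j k l u)
  stepfx i j k l u := Prod.ext (H.stepfx i j k l u) (H'.stepfx i j k l u)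
  stepfy i j k l u := Prod.ext (H.stepfy i j k l u) (H'.stepfy i j k l u)
  stepfz i j k l u := Prod.ext (H.stepfz i j k l u) (H'.stepfz i j k l u)
  stepgx i j k l u := Prod.ext (H.stepgx i j k l u) (H'.stepgx i j k l u)
  stepgy i j k l u := Prod.ext (H.stepgy i j k l u) (H'.stepgy i j k l u)
  stepgz i j k l u := Prod.ext (H.stepgz i j k l u) (H'.stepgz i j k l u)
  steph i j k l u := Prod.ext (H.steph i j k l u) (H'.steph i j k l u)

end Closure

section Field

variable {K : Type*} [Field K]

/-- Two solutions in a field with the same initial data agree, as long as it is legitimate to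
divide by the data of the second one. -/
theorem IsSol.eq_of_init {D E : HexData K} {N : ℕ} (H : D.IsSol N) (H' : E.IsSol N)
    (hne : ∀ i j k : ℤ, 0 ≤ i + j + k → i + j + k ≤ N + 2 → E.h i j k ≠ 0)
    (nx : ∀ i j k, i + j + k = 0 → E.fx i j k ≠ 0)
    (ny : ∀ i j k, i + j + k = 0 → E.fy i j k ≠ 0)
    (nz : ∀ i j k, i + j + k = 0 → E.fz i j k ≠ 0)
    (h0 : ∀ i j k, 0 ≤ i + j + k → i + j + k ≤ 2 → D.h i j k = E.h i j k)
    (fx0 : ∀ i j k, i + j + k = 0 → D.fx i j k = E.fx i j k)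
    (fy0 : ∀ i j k, i + j + k = 0 → D.fy i j k = E.fy i j k)
    (fz0 : ∀ i j k, i + j + k = 0 → D.fz i j k = E.fz i j k) :
    (D.pair E).UpTo N (fun z => z.1 = z.2) := by
  let T : Subring (K × K) := RingHom.eqLocus (RingHom.fst K K) (RingHom.snd K K)
  have hT : ∀ z : K × K, z ∈ T ↔ z.1 = z.2 := fun z => Iff.rfl
  suffices ∀ m : ℕ, m ≤ N → (D.pair E).UpTo m (· ∈ T) from this N le_rfl
  intro m
  induction m with
  | zero =>
    intro _
    refine IsSol.upTo_mem ((H.pair H').mono (by simp)) T h0 fx0 fy0 fz0 ?_ ?_ ?_ ?_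
    · intro i j k e y hy
      refine mul_left_cancel₀ (nx i j k e) ?_
      simpa [hT, HexData.pair, fx0 i j k e] using hy
    · intro i j k e y hy
      refine mul_left_cancel₀ (ny i j k e) ?_
      simpa [hT, HexData.pair, fy0 i j k e, ny i j k e] using hy
    · intro i j k e y hy
      refine mul_left_cancel₀ (nz i j k e) ?_
      simpa [hT, HexData.pair, fz0 i j k e, nz i j k e] using hy
    · intro i j k l u
      simp at u
      omega
  | succ m ih =>
    intro hm
    have P := ih (by omega)
    refine IsSol.upTo_mem ((H.pair H').mono (by exact_mod_cast hm)) T h0 fx0 fy0 fz0 ?_ ?_ ?_ ?_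
    · intro i j k e y hy
      refine mul_left_cancel₀ (nx i j k e) ?_
      simpa [hT, HexData.pair, fx0 i j k e] using hy
    · intro i j k e y hy
      refine mul_left_cancel₀ (ny i j k e) ?_
      simpa [hT, HexData.pair, fy0 i j k e, ny i j k e] using hy
    · intro i j k e y hy
      refine mul_left_cancel₀ (nz i j k e) ?_
      simpa [hT, HexData.pair, fz0 i j k e, nz i j k e] using hy
    · intro i j k l u y hy
      refine mul_right_cancel₀ (hne i j k l (by omega)) ?_
      have q : D.h i j k = E.h i j k := P.h i j k l (by omega)
      simpa [hT, HexData.pair, q] using hy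

/-- The solution of the polynomial system attached to a solution of the hexahedron recurrence. -/
noncomputable def ofHex (h hx hy hz : ℤ × ℤ × ℤ → K) : HexData K where
  h i j k := h (i, j, k)
  fx i j k := hx (i, j, k)
  fy i j k := hy (i, j, k)
  fz i j k := hz (i, j, k)
  gx i j k := (h (i, j + 1, k) * h (i, j, k + 1) + h (i, j, k) * h (i, j + 1, k + 1)) / hx (i, j, k)
  gy i j k := (h (i, j, k + 1) * h (i + 1, j, k) + h (i, j, k) * h (i + 1, j, k + 1)) / hy (i, j, k)
  gz i j k := (h (i + 1, j, k) * h (i, j + 1, k) + h (i, j, k) * h (i + 1, j + 1, k)) / hz (i, j, k)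

theorem step_complement {a B C h h' f f' g g' p q : K} (hh : h ≠ 0) (hf' : f' ≠ 0)
    (hg' : f' * g' = B * C + a * h') (hf : f' * h = p + a * g)
    (key : (q + a * f) * (p + a * g) = h ^ 2 * (B * C + a * h')) :
    g' * h = q + a * f := by
  refine mul_left_cancel₀ (mul_ne_zero hh hf') ?_
  linear_combination h ^ 2 * hg' - key - (q + a * f) * hf

theorem isSol_ofHex {h hx hy hz : ℤ × ℤ × ℤ → K}
    (hne : ∀ v, h v ≠ 0 ∧ hx v ≠ 0 ∧ hy v ≠ 0 ∧ hz v ≠ 0)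
    (hrec : ∀ v : ℤ × ℤ × ℤ, 0 ≤ v.1 + v.2.1 + v.2.2 → HexRec h hx hy hz v) (N : ℤ) :
    (ofHex h hx hy hz).IsSol N := by
  set D := ofHex h hx hy hz with hD
  have relx : ∀ i j k, D.fx i j k * D.gx i j k =
      D.h i (j + 1) k * D.h i j (k + 1) + D.h i j k * D.h i (j + 1) (k + 1) :=
    fun i j k => mul_div_cancel₀ _ (hne _).2.1
  have rely : ∀ i j k, D.fy i j k * D.gy i j k =
      D.h i j (k + 1) * D.h (i + 1) j k + D.h i j k * D.h (i + 1) j (k + 1) :=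
    fun i j k => mul_div_cancel₀ _ (hne _).2.2.1
  have relz : ∀ i j k, D.fz i j k * D.gz i j k =
      D.h (i + 1) j k * D.h i (j + 1) k + D.h i j k * D.h (i + 1) (j + 1) k :=
    fun i j k => mul_div_cancel₀ _ (hne _).2.2.2
  have nh : ∀ i j k, D.h i j k ≠ 0 := fun i j k => (hne _).1
  have nx : ∀ i j k, D.fx i j k ≠ 0 := fun i j k => (hne _).2.1
  have ny : ∀ i j k, D.fy i j k ≠ 0 := fun i j k => (hne _).2.2.1
  have nz : ∀ i j k, D.fz i j k ≠ 0 := fun i j k => (hne _).2.2.2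
  have stepfx : ∀ i j k, 0 ≤ i + j + k → D.fx (i + 1) j k * D.h i j k =
      D.fy i j k * D.fz i j k + D.h (i + 1) j k * D.gx i j k := by
    intro i j k l
    refine mul_left_cancel₀ (nx i j k) ?_
    have := (hrec (i, j, k) l).1
    have r := relx i j k
    simp only [hD, ofHex] at r ⊢
    linear_combination this - h (i + 1, j, k) * r
  have stepfy : ∀ i j k, 0 ≤ i + j + k → D.fy i (j + 1) k * D.h i j k =
      D.fz i j k * D.fx i j k + D.h i (j + 1) k * D.gy i j k := by
    intro i j k l
    refine mul_left_cancel₀ (ny i j k) ?_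
    have := (hrec (i, j, k) l).2.1
    have r := rely i j k
    simp only [hD, ofHex] at r ⊢
    linear_combination this - h (i, j + 1, k) * r
  have stepfz : ∀ i j k, 0 ≤ i + j + k → D.fz i j (k + 1) * D.h i j k =
      D.fx i j k * D.fy i j k + D.h i j (k + 1) * D.gz i j k := by
    intro i j k l
    refine mul_left_cancel₀ (nz i j k) ?_
    have := (hrec (i, j, k) l).2.2.1
    have r := relz i j k
    simp only [hD, ofHex] at r ⊢
    linear_combination this - h (i, j, k + 1) * r
  have steph : ∀ i j k, 0 ≤ i + j + k → D.h (i + 1) (j + 1) (k + 1) * D.h i j k ^ 2 =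
      D.fx i j k * D.fy i j k * D.fz i j k + D.gx i j k * D.gy i j k * D.gz i j k +
      2 * (D.h (i + 1) j k * D.h i (j + 1) k * D.h i j (k + 1)) +
      D.h i j k * (D.h (i + 1) j k * D.h i (j + 1) (k + 1) +
        D.h i (j + 1) k * D.h (i + 1) j (k + 1) + D.h i j (k + 1) * D.h (i + 1) (j + 1) k) := by
    intro i j k l
    refine mul_left_cancel₀ (mul_ne_zero (mul_ne_zero (nx i j k) (ny i j k)) (nz i j k)) ?_
    have := (hrec (i, j, k) l).2.2.2
    change D.h (i + 1) (j + 1) (k + 1) * D.h i j k ^ 2 *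
          (D.fx i j k * D.fy i j k * D.fz i j k)
        = (D.fx i j k * D.fy i j k * D.fz i j k) ^ 2
          + D.fx i j k * D.fy i j k * D.fz i j k *
            (2 * (D.h (i + 1) j k * D.h i (j + 1) k * D.h i j (k + 1))
              + D.h i j k * D.h (i + 1) j k * D.h i (j + 1) (k + 1)
              + D.h i j k * D.h i (j + 1) k * D.h (i + 1) j (k + 1)
              + D.h i j k * D.h i j (k + 1) * D.h (i + 1) (j + 1) k)
          + (D.h (i + 1) j k * D.h i (j + 1) k + D.h i j k * D.h (i + 1) (j + 1) k) *
            (D.h (i + 1) j k * D.h i j (k + 1) + D.h i j k * D.h (i + 1) j (k + 1)) *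
            (D.h i (j + 1) k * D.h i j (k + 1) + D.h i j k * D.h i (j + 1) (k + 1)) at this
    rw [show D.h (i + 1) j k * D.h i j (k + 1) = D.h i j (k + 1) * D.h (i + 1) j k from
      mul_comm _ _, ← relx, ← rely, ← relz] at this
    linear_combination this
  refine ⟨fun i j k _ _ => relx i j k, fun i j k _ _ => rely i j k, fun i j k _ _ => relz i j k,
    fun i j k l _ => stepfx i j k l, fun i j k l _ => stepfy i j k l,
    fun i j k l _ => stepfz i j k l, fun i j k l _ => ?_, fun i j k l _ => ?_,
    fun i j k l _ => ?_, fun i j k l _ => steph i j k l⟩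
  · refine step_complement (nh i j k) (nx _ _ _) (relx _ _ _) (stepfx i j k l) ?_
    have rx := relx i j k
    have ry := rely i j k
    have rz := relz i j k
    linear_combination (-D.h (i + 1) j k) * steph i j k l +
      D.fy i j k * D.gy i j k * rz + D.h (i + 1) j k ^ 2 * rx + (D.h (i + 1) j k *
      D.h i (j + 1) k + D.h i j k * D.h (i + 1) (j + 1) k) * ry
  · refine step_complement (nh i j k) (ny _ _ _) (rely _ _ _) (stepfy i j k l) ?_
    have rx := relx i j k
    have ry := rely i j k
    have rz := relz i j k
    linear_combination (-D.h i (j + 1) k) * steph i j k l +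
      D.fz i j k * D.gz i j k * rx + D.h i (j + 1) k ^ 2 * ry + (D.h i (j + 1) k *
      D.h i j (k + 1) + D.h i j k * D.h i (j + 1) (k + 1)) * rz
  · refine step_complement (nh i j k) (nz _ _ _) (relz _ _ _) (stepfz i j k l) ?_
    have rx := relx i j k
    have ry := rely i j k
    have rz := relz i j k
    linear_combination (-D.h i j (k + 1)) * steph i j k l +
      D.fx i j k * D.gx i j k * ry + D.h i j (k + 1) ^ 2 * rz + (D.h i j (k + 1) *
      D.h (i + 1) j k + D.h i j k * D.h (i + 1) j (k + 1)) * rx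

end Field

end HexData

section Laurent

open MvPolynomial

variable {ι K : Type*} [Field K] [Algebra (MvPolynomial ι ℤ) K]
  [IsFractionRing (MvPolynomial ι ℤ) K]

/-- The multiplicative monoid generated by the variables of `ℤ[ι]`. -/
noncomputable def varMonoid (ι : Type*) : Submonoid (MvPolynomial ι ℤ) :=
  Submonoid.closure (Set.range fun i => X i)

theorem varMonoid_le (ι : Type*) : varMonoid ι ≤ nonZeroDivisors (MvPolynomial ι ℤ) := by
  rw [varMonoid, Submonoid.closure_le]
  rintro _ ⟨i, rfl⟩
  exact mem_nonZeroDivisors_of_ne_zero (X_ne_zero i)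

variable (ι K) in
/-- The ring of integral Laurent polynomials, inside a fraction field of `ℤ[ι]`. -/
noncomputable def laurentRing : Subring K :=
  (Localization.subalgebra.ofField K (varMonoid ι) (varMonoid_le ι)).toSubring

/-- The subring of fractions whose denominator is not divisible by the prime `p`. -/
noncomputable def localRing (K : Type*) [Field K] [Algebra (MvPolynomial ι ℤ) K]
    [IsFractionRing (MvPolynomial ι ℤ) K] {p : MvPolynomial ι ℤ} (hp : Prime p) : Subring K :=
  haveI := (Ideal.span_singleton_prime hp.ne_zero).2 hp
  (Localization.subalgebra.ofField K (Ideal.span {p}).primeCompl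
    (Ideal.primeCompl_le_nonZeroDivisors _)).toSubring

theorem mem_laurentRing {x : K} : x ∈ laurentRing ι K ↔
    ∃ a m, m ∈ varMonoid ι ∧ x * algebraMap (MvPolynomial ι ℤ) K m =
      algebraMap (MvPolynomial ι ℤ) K a := by
  refine exists_congr fun a => exists_congr fun m => ?_
  rw [exists_prop]
  refine and_congr_right fun hm => ?_
  rw [eq_mul_inv_iff_mul_eq₀]
  exact IsFractionRing.to_map_ne_zero_of_mem_nonZeroDivisors (varMonoid_le ι hm)

theorem mem_localRing {p : MvPolynomial ι ℤ} {hp : Prime p} {x : K} : x ∈ localRing K hp ↔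
    ∃ a b, ¬ p ∣ b ∧ x * algebraMap (MvPolynomial ι ℤ) K b =
      algebraMap (MvPolynomial ι ℤ) K a := by
  have := (Ideal.span_singleton_prime hp.ne_zero).2 hp
  refine exists_congr fun a => exists_congr fun m => ?_
  rw [exists_prop]
  have e : m ∈ (Ideal.span {p}).primeCompl ↔ ¬ p ∣ m := by
    rw [← Ideal.mem_span_singleton]; rfl
  rw [e]
  refine and_congr_right fun hm => ?_
  rw [eq_mul_inv_iff_mul_eq₀]
  refine (map_ne_zero_iff _ (IsFractionRing.injective (MvPolynomial ι ℤ) K)).2 ?_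
  rintro rfl
  exact hm (dvd_zero p)

theorem algebraMap_mem_laurentRing (q : MvPolynomial ι ℤ) :
    algebraMap (MvPolynomial ι ℤ) K q ∈ laurentRing ι K :=
  mem_laurentRing.2 ⟨q, 1, one_mem _, by simp⟩

theorem not_dvd_of_mem_varMonoid {p : MvPolynomial ι ℤ} (hp : Prime p) (hX : ∀ i, ¬ p ∣ X i)
    {m : MvPolynomial ι ℤ} (hm : m ∈ varMonoid ι) : ¬ p ∣ m := by
  induction hm using Submonoid.closure_induction with
  | mem x hx => obtain ⟨i, rfl⟩ := hx; exact hX i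
  | one => exact fun h => hp.not_isUnit (isUnit_of_dvd_one h)
  | mul x y _ _ hx hy => exact fun h => (hp.dvd_or_dvd h).elim hx hy

theorem laurentRing_le_localRing {p : MvPolynomial ι ℤ} (hp : Prime p) (hX : ∀ i, ¬ p ∣ X i) :
    laurentRing ι K ≤ localRing K hp := by
  intro x hx
  obtain ⟨a, m, hm, e⟩ := mem_laurentRing.1 hx
  exact mem_localRing.2 ⟨a, m, not_dvd_of_mem_varMonoid hp hX hm, e⟩

/-- A fraction which is integral at all primes other than the variables is a Laurent
polynomial. -/
theorem mem_laurentRing_of_forall_prime {x : K}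
    (hx : ∀ p : MvPolynomial ι ℤ, ∀ hp : Prime p, (∀ i, ¬ p ∣ X i) → x ∈ localRing K hp) :
    x ∈ laurentRing ι K := by
  set P := MvPolynomial ι ℤ
  have inj := IsFractionRing.injective P K
  have hxe : x * algebraMap P K (IsFractionRing.den P x) =
      algebraMap P K (IsFractionRing.num P x) := by
    refine (eq_div_iff ?_).1 (IsFractionRing.mk'_num_den' P x).symm
    exact IsFractionRing.to_map_ne_zero_of_mem_nonZeroDivisors (IsFractionRing.den P x).2
  have key : ∀ d : P, d ∣ (IsFractionRing.den P x : P) → d ≠ 0 → ∃ m ∈ varMonoid ι, d ∣ m := by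
    intro d
    induction d using UniqueFactorizationMonoid.induction_on_prime with
    | h₁ => exact fun _ h => absurd rfl h
    | h₂ d hd => exact fun _ _ => ⟨1, one_mem _, hd.dvd⟩
    | h₃ d p hd hp ih =>
      intro hdvd _
      obtain ⟨m, hm, hdm⟩ := ih (dvd_trans (dvd_mul_left d p) hdvd) hd
      by_cases hX : ∀ i, ¬ p ∣ X i
      · exfalso
        have hpd := dvd_trans (dvd_mul_right p d) hdvd
        obtain ⟨a, b, hb, e⟩ := mem_localRing.1 (hx p hp hX)
        have e' : IsFractionRing.num P x * b = a * (IsFractionRing.den P x : P) := by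
          apply inj
          rw [map_mul, map_mul, ← hxe, ← e]
          ring
        have hpn : p ∣ IsFractionRing.num P x := by
          refine (hp.dvd_or_dvd ?_).resolve_right hb
          rw [e']
          exact hpd.mul_left a
        exact hp.not_isUnit (IsFractionRing.num_den_reduced P x hpn hpd)
      · push Not at hX
        obtain ⟨i, hi⟩ := hX
        exact ⟨X i * m, mul_mem (Submonoid.subset_closure ⟨i, rfl⟩) hm, mul_dvd_mul hi hdm⟩
  obtain ⟨m, hm, c, hc⟩ := key _ dvd_rfl (nonZeroDivisors.ne_zero (IsFractionRing.den P x).2)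
  refine mem_laurentRing.2 ⟨IsFractionRing.num P x * c, m, hm, ?_⟩
  rw [hc, map_mul, map_mul, ← mul_assoc, hxe]

/-- A nonzero point defines a homomorphism on Laurent polynomials. -/
theorem exists_laurentHom {E : Type*} [Field E] (y : ι → E) (hy : ∀ i, y i ≠ 0) :
    ∃ φ : laurentRing ι K →+* E, ∀ q, φ ⟨algebraMap _ K q, algebraMap_mem_laurentRing q⟩ =
      eval₂Hom (Int.castRingHom E) y q := by
  have hu : ∀ m : varMonoid ι, IsUnit (eval₂Hom (Int.castRingHom E) y (m : MvPolynomial ι ℤ)) := by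
    rintro ⟨m, hm⟩
    induction hm using Submonoid.closure_induction with
    | mem x hx => obtain ⟨i, rfl⟩ := hx; simpa using hy i
    | one => simp
    | mul x z _ _ hx hz => simpa using ⟨by simpa using hx, by simpa using hz⟩
  have : IsLocalization (varMonoid ι)
      (Localization.subalgebra.ofField K (varMonoid ι) (varMonoid_le ι)) :=
    Localization.subalgebra.isLocalization_ofField K (varMonoid ι) (varMonoid_le ι)
  refine ⟨(IsLocalization.lift hu : Localization.subalgebra.ofField K (varMonoid ι)
    (varMonoid_le ι) →+* E), fun q => ?_⟩
  exact IsLocalization.lift_eq (S := Localization.subalgebra.ofField K (varMonoid ι)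
    (varMonoid_le ι)) hu q

theorem exists_hom_eq {E : Type*} [Field E] (φ : laurentRing ι K →+* E) (x : laurentRing ι K) :
    ∃ a m, m ∈ varMonoid ι ∧ (x : K) * algebraMap _ K m = algebraMap _ K a ∧
      φ x * φ ⟨algebraMap _ K m, algebraMap_mem_laurentRing m⟩ =
        φ ⟨algebraMap _ K a, algebraMap_mem_laurentRing a⟩ := by
  obtain ⟨a, m, hm, e⟩ := mem_laurentRing.1 x.2
  exact ⟨a, m, hm, e, by rw [← map_mul]; exact congrArg φ (Subtype.ext e)⟩

theorem hom_var_ne_zero {E : Type*} [Field E] (φ : laurentRing ι K →+* E) (i : ι) :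
    φ ⟨algebraMap _ K (X i), algebraMap_mem_laurentRing _⟩ ≠ 0 := by
  have inv : (algebraMap (MvPolynomial ι ℤ) K (X i))⁻¹ ∈ laurentRing ι K :=
    mem_laurentRing.2 ⟨1, X i, Submonoid.subset_closure ⟨i, rfl⟩, by
      rw [inv_mul_cancel₀, map_one]
      exact (map_ne_zero_iff _ (IsFractionRing.injective (MvPolynomial ι ℤ) K)).2 (X_ne_zero i)⟩
  have : φ ⟨algebraMap _ K (X i), algebraMap_mem_laurentRing _⟩ * φ ⟨_, inv⟩ = 1 := by
    rw [← map_mul, ← map_one φ]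
    exact congrArg φ (Subtype.ext (mul_inv_cancel₀
      ((map_ne_zero_iff _ (IsFractionRing.injective (MvPolynomial ι ℤ) K)).2 (X_ne_zero i))))
  exact left_ne_zero_of_mul_eq_one this

theorem hom_varMonoid_ne_zero {E : Type*} [Field E] (φ : laurentRing ι K →+* E)
    {m : MvPolynomial ι ℤ} (hm : m ∈ varMonoid ι) :
    φ ⟨algebraMap _ K m, algebraMap_mem_laurentRing _⟩ ≠ 0 := by
  induction hm using Submonoid.closure_induction with
  | mem x hx => obtain ⟨i, rfl⟩ := hx; exact hom_var_ne_zero φ i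
  | one =>
    have : (⟨algebraMap _ K 1, algebraMap_mem_laurentRing _⟩ : laurentRing ι K) = 1 :=
      Subtype.ext (map_one _)
    rw [this, map_one]
    exact one_ne_zero
  | mul x z _ _ hx hz =>
    have : (⟨algebraMap _ K (x * z), algebraMap_mem_laurentRing _⟩ : laurentRing ι K) =
      ⟨algebraMap _ K x, algebraMap_mem_laurentRing _⟩ *
      ⟨algebraMap _ K z, algebraMap_mem_laurentRing _⟩ := Subtype.ext (map_mul _ _ _)
    rw [this, map_mul]
    exact mul_ne_zero hx hz

/-- A Laurent polynomial which is not invertible at `p` vanishes wherever `p` does. -/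
theorem hom_eq_zero_of_inv_notMem {E : Type*} [Field E] (φ : laurentRing ι K →+* E)
    {p : MvPolynomial ι ℤ} (hp : Prime p)
    (hφ : φ ⟨algebraMap _ K p, algebraMap_mem_laurentRing p⟩ = 0) (x : laurentRing ι K)
    (hx : (x : K)⁻¹ ∉ localRing K hp) : φ x = 0 := by
  obtain ⟨a, m, hm, e, e'⟩ := exists_hom_eq φ x
  by_cases ha : p ∣ a
  · obtain ⟨c, rfl⟩ := ha
    have : (⟨algebraMap _ K (p * c), algebraMap_mem_laurentRing _⟩ : laurentRing ι K) =
      ⟨algebraMap _ K p, algebraMap_mem_laurentRing _⟩ *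
      ⟨algebraMap _ K c, algebraMap_mem_laurentRing _⟩ := Subtype.ext (map_mul _ _ _)
    rw [this, map_mul, hφ, zero_mul] at e'
    exact (mul_eq_zero.1 e').resolve_right (hom_varMonoid_ne_zero φ hm)
  · refine absurd (mem_localRing.2 ⟨m, a, ha, ?_⟩) hx
    have hx0 : (x : K) ≠ 0 := by
      intro h0
      rw [h0, inv_zero] at hx
      exact hx (zero_mem _)
    rw [← e, inv_mul_cancel_left₀ hx0]

theorem dvd_of_inv_notMem {p : MvPolynomial ι ℤ} (hp : Prime p) {x : K}
    (hx : x⁻¹ ∉ localRing K hp) {a m : MvPolynomial ι ℤ}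
    (e : x * algebraMap _ K m = algebraMap _ K a) : p ∣ a := by
  by_contra ha
  refine hx (mem_localRing.2 ⟨m, a, ha, ?_⟩)
  have hx0 : x ≠ 0 := by
    intro h0
    rw [h0, inv_zero] at hx
    exact hx (zero_mem _)
  rw [← e, inv_mul_cancel_left₀ hx0]

theorem hom_mem {E : Type*} [Field E] (φ : laurentRing ι K →+* E) (T : Subring E)
    (h1 : ∀ i, φ ⟨algebraMap _ K (X i), algebraMap_mem_laurentRing _⟩ ∈ T)
    (h2 : ∀ i, (φ ⟨algebraMap _ K (X i), algebraMap_mem_laurentRing _⟩)⁻¹ ∈ T)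
    (x : laurentRing ι K) : φ x ∈ T := by
  let ψ : MvPolynomial ι ℤ →+* E := φ.comp
    ((algebraMap (MvPolynomial ι ℤ) K).codRestrict (laurentRing ι K) algebraMap_mem_laurentRing)
  have hψ : ∀ q, φ ⟨algebraMap _ K q, algebraMap_mem_laurentRing _⟩ = ψ q := fun q => rfl
  have ha : ∀ a, ψ a ∈ T := by
    intro a
    induction a using MvPolynomial.induction_on with
    | C n =>
      rw [show ψ (C n) = n from map_intCast (ψ.comp C) n]
      exact intCast_mem T n
    | add a b iha ihb => rw [map_add]; exact add_mem iha ihb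
    | mul_X a i ih => rw [map_mul]; exact mul_mem ih (h1 i)
  have hm : ∀ m ∈ varMonoid ι, (ψ m)⁻¹ ∈ T := by
    intro m hm
    induction hm using Submonoid.closure_induction with
    | mem x hx => obtain ⟨i, rfl⟩ := hx; exact h2 i
    | one => simp
    | mul x z _ _ hx hz => rw [map_mul, mul_inv]; exact mul_mem hx hz
  obtain ⟨a, m, hmm, -, e⟩ := exists_hom_eq φ x
  rw [(eq_mul_inv_iff_mul_eq₀ (hom_varMonoid_ne_zero φ hmm)).2 e]
  exact mul_mem (ha a) (hm m hmm)

end Laurent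

section Point

open MvPolynomial

universe u

variable {ι : Type u}

theorem mem_supported_of_dvd {p q : MvPolynomial ι ℤ} {s : Set ι} (hq : q ∈ supported ℤ s)
    (hq0 : q ≠ 0) (hpq : p ∣ q) : p ∈ supported ℤ s := by
  classical
  obtain ⟨r, rfl⟩ := hpq
  rw [mem_supported] at hq ⊢
  intro i hi
  apply hq
  have hp0 := left_ne_zero_of_mul hq0
  have hr0 := right_ne_zero_of_mul hq0
  rw [Finset.mem_coe, mem_vars_iff_degreeOf_ne_zero] at *
  rw [degreeOf_mul_eq hp0 hr0]
  omega

open scoped WithZero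

/-- A prime involving only the variables in `s` vanishes at a point of a valued field, at which
the variables outside `s` have prescribed valuation. -/
theorem exists_valued_point (K : Type*) [Field K] [Algebra (MvPolynomial ι ℤ) K]
    [IsFractionRing (MvPolynomial ι ℤ) K] {p : MvPolynomial ι ℤ} (hp : Prime p)
    (hX : ∀ i, ¬ p ∣ X i) {s : Set ι} (hps : p ∈ supported ℤ s) (ω : ι → ℤ)
    (hω : ∀ i ∈ s, ω i = 0) :
    ∃ (E : Type u) (_ : Field E) (v : Valuation E ℤᵐ⁰) (φ : laurentRing ι K →+* E),
      φ ⟨algebraMap _ K p, algebraMap_mem_laurentRing p⟩ = 0 ∧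
      (∀ i, v (φ ⟨algebraMap _ K (X i), algebraMap_mem_laurentRing _⟩) = WithZero.exp (ω i)) ∧
      ∀ q ∈ supported ℤ s, φ ⟨algebraMap _ K q, algebraMap_mem_laurentRing q⟩ = 0 ∨
        v (φ ⟨algebraMap _ K q, algebraMap_mem_laurentRing q⟩) = 1 := by
  classical
  have hprime := (Ideal.span_singleton_prime hp.ne_zero).2 hp
  let A := MvPolynomial ι ℤ ⧸ Ideal.span {p}
  let κ := FractionRing A
  let ρ : MvPolynomial ι ℤ →+* κ := (algebraMap A κ).comp (Ideal.Quotient.mk (Ideal.span {p}))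
  have hρ : ∀ q, ρ q = 0 ↔ p ∣ q := by
    intro q
    rw [← Ideal.mem_span_singleton, ← Ideal.Quotient.eq_zero_iff_mem]
    exact map_eq_zero_iff _ (IsFractionRing.injective A κ)
  let v := RatFunc.inftyValuation κ
  let y : ι → RatFunc κ := fun i => RatFunc.C (ρ (X i)) * RatFunc.X ^ ω i
  have hy : ∀ i, v (y i) = WithZero.exp (ω i) := by
    intro i
    rw [map_mul, show v (RatFunc.C (ρ (X i))) = 1 from
      RatFunc.inftyValuation.C _ (mt (hρ _).1 (hX i)), one_mul]
    exact RatFunc.inftyValuation.X_zpow κ _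
  obtain ⟨φ, hφ⟩ := exists_laurentHom (K := K) y fun i h0 => by
    have := hy i
    rw [h0, map_zero] at this
    exact WithZero.exp_ne_zero this.symm
  have hs : ∀ q ∈ supported ℤ s, eval₂Hom (Int.castRingHom _) y q = RatFunc.C (ρ q) := by
    intro q hq
    induction hq using Algebra.adjoin_induction with
    | mem x hx =>
      obtain ⟨i, hi, rfl⟩ := hx
      simp [y, hω i hi]
    | algebraMap r => simp
    | add a b _ _ ha hb => rw [map_add, map_add, map_add, ha, hb]
    | mul a b _ _ ha hb => rw [map_mul, map_mul, map_mul, ha, hb]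
  refine ⟨RatFunc κ, inferInstance, v, φ, ?_, fun i => ?_, fun q hq => ?_⟩
  · rw [hφ, hs p hps, (hρ p).2 dvd_rfl, map_zero]
  · rw [hφ, eval₂Hom_X', hy]
  · rw [hφ, hs q hq]
    by_cases h0 : ρ q = 0
    · left
      rw [h0, map_zero]
    · right
      exact RatFunc.inftyValuation.C _ h0

end Point

section Bounds

open WithZero

open scoped WithZero

variable {E : Type*} [Field E] (v : Valuation E ℤᵐ⁰)

/-- The valuation of `x` is at most `exp u`. -/
def ValLE (x : E) (u : ℤ) : Prop := v x ≤ exp u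

/-- The valuation of `x` lies between `exp l` and `exp u`. -/
def ValIn (x : E) (l u : ℤ) : Prop := exp l ≤ v x ∧ v x ≤ exp u

variable {v} {x y z : E} {l u l' u' m n : ℤ}

theorem ValIn.le (hx : ValIn v x l u) : ValLE v x u := hx.2

theorem ValIn.ne_zero (hx : ValIn v x l u) : x ≠ 0 := by
  rintro rfl
  have := hx.1
  rw [map_zero, le_zero_iff] at this
  exact exp_ne_zero this

theorem valIn_of_eq (hx : v x = exp n) : ValIn v x n n := ⟨hx.ge, hx.le⟩

theorem valLE_zero : ValLE v 0 n := by simp [ValLE]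

theorem valLE_two : ValLE v 2 0 := by
  rw [← one_add_one_eq_two]
  exact (v.map_add 1 1).trans (by simp)

theorem ValLE.mono (hx : ValLE v x m) (h : m ≤ n) : ValLE v x n := hx.trans (exp_le_exp.2 h)

theorem ValIn.mono (hx : ValIn v x l u) (hl : l' ≤ l) (hu : u ≤ u') : ValIn v x l' u' :=
  ⟨(exp_le_exp.2 hl).trans hx.1, hx.2.trans (exp_le_exp.2 hu)⟩

theorem ValLE.mul (hx : ValLE v x m) (hy : ValLE v y n) : ValLE v (x * y) (m + n) := by
  rw [ValLE, map_mul, exp_add]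
  exact mul_le_mul' hx hy

theorem ValIn.mul (hx : ValIn v x l u) (hy : ValIn v y l' u') :
    ValIn v (x * y) (l + l') (u + u') := by
  rw [ValIn, map_mul, exp_add, exp_add]
  exact ⟨mul_le_mul' hx.1 hy.1, mul_le_mul' hx.2 hy.2⟩

theorem ValLE.add (hx : ValLE v x n) (hy : ValLE v y n) : ValLE v (x + y) n :=
  (v.map_add x y).trans (max_le hx hy)

theorem ValLE.sub (hx : ValLE v x n) (hy : ValLE v y n) : ValLE v (x - y) n :=
  (v.map_sub x y).trans (max_le hx hy)

theorem ValIn.add (hx : ValIn v x l u) (hy : ValLE v y n) (h : n < l) : ValIn v (x + y) l u := by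
  have : v (x + y) = v x :=
    v.map_add_eq_of_lt_left (hy.trans_lt ((exp_lt_exp.2 h).trans_le hx.1))
  rwa [ValIn, this]

theorem ValLE.of_mul (hy : ValIn v y l u) (hxy : ValLE v (x * y) n) (h : n ≤ m + l) :
    ValLE v x m := by
  have h1 : v x * v y ≤ exp m * exp l := by
    rw [← map_mul, ← exp_add]
    exact hxy.trans (exp_le_exp.2 h)
  by_contra hlt
  rw [ValLE, not_le] at hlt
  have h2 : exp m * exp l < v x * exp l :=
    mul_lt_mul_of_pos_right hlt (zero_lt_iff.2 exp_ne_zero)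
  exact absurd (h2.trans_le (mul_le_mul' le_rfl hy.1)) (not_lt.2 h1)

theorem ValIn.of_mul (hy : ValIn v y l u) (hxy : ValIn v (x * y) l' u') (hm : m + u ≤ l')
    (hn : u' ≤ n + l) : ValIn v x m n := by
  refine ⟨?_, ValLE.of_mul hy hxy.le hn⟩
  by_contra hlt
  rw [not_le] at hlt
  have h1 : v x * exp u < exp m * exp u :=
    mul_lt_mul_of_pos_right hlt (zero_lt_iff.2 exp_ne_zero)
  have h2 : v (x * y) < exp (m + u) := by
    rw [map_mul, exp_add]
    exact (mul_le_mul' le_rfl hy.2).trans_lt h1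
  exact absurd (h2.trans_le (exp_le_exp.2 hm)) (not_lt.2 hxy.1)

end Bounds

namespace HexData

open scoped WithZero

section Bounds

variable {E : Type*} [Field E] {v : Valuation E ℤᵐ⁰}

theorem valIn_step {f' h fy fz a g : E} {hl hu yl yu zl zu au gu l u : ℤ}
    (e : f' * h = fy * fz + a * g) (vh : ValIn v h hl hu) (vy : ValIn v fy yl yu)
    (vz : ValIn v fz zl zu) (va : ValLE v a au) (vg : ValLE v g gu)
    (dom : au + gu < yl + zl) (lo : l + hu ≤ yl + zl) (hi : yu + zu ≤ u + hl) :
    ValIn v f' l u :=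
  ValIn.of_mul vh (e ▸ (vy.mul vz).add (va.mul vg) dom) lo hi

theorem valLE_step {g' h gy gz a f : E} {hl hu yu zu au fu u : ℤ}
    (e : g' * h = gy * gz + a * f) (vh : ValIn v h hl hu) (vy : ValLE v gy yu)
    (vz : ValLE v gz zu) (va : ValLE v a au) (vf : ValLE v f fu)
    (h1 : yu + zu ≤ u + hl) (h2 : au + fu ≤ u + hl) : ValLE v g' u :=
  ValLE.of_mul vh (e ▸ ((vy.mul vz).mono h1).add ((va.mul vf).mono h2)) le_rfl

theorem valIn_vertex {h' h a b c A B C fx fy fz gx gy gz : E}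
    {hl hu xl xu yl yu zl zu ux uy uz ua ub uc uA uB uC l u : ℤ}
    (e : h' * h ^ 2 = fx * fy * fz + gx * gy * gz + 2 * (a * b * c) +
      h * (a * A + b * B + c * C))
    (vh : ValIn v h hl hu) (vx : ValIn v fx xl xu) (vy : ValIn v fy yl yu)
    (vz : ValIn v fz zl zu) (wx : ValLE v gx ux) (wy : ValLE v gy uy) (wz : ValLE v gz uz)
    (va : ValLE v a ua) (vb : ValLE v b ub) (vc : ValLE v c uc) (vA : ValLE v A uA)
    (vB : ValLE v B uB) (vC : ValLE v C uC)
    (d1 : ux + uy + uz < xl + yl + zl) (d2 : ua + ub + uc < xl + yl + zl)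
    (d3 : hu + (ua + uA) < xl + yl + zl) (d4 : hu + (ub + uB) < xl + yl + zl)
    (d5 : hu + (uc + uC) < xl + yl + zl) (lo : l + 2 * hu ≤ xl + yl + zl)
    (hi : xu + yu + zu ≤ u + 2 * hl) : ValIn v h' l u := by
  have hle := vh.le
  rw [mul_add h, mul_add h, ← add_assoc, ← add_assoc, sq, ← mul_assoc] at e
  refine ValIn.of_mul vh (ValIn.of_mul vh (e ▸ ?_ : ValIn v _ (xl + yl + zl) (xu + yu + zu))
    (m := l + hu) (n := u + hl) (by omega) (by omega)) le_rfl le_rfl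
  have two : ValLE v (2 * (a * b * c)) (ua + ub + uc) :=
    (valLE_two.mul ((va.mul vb).mul vc)).mono (by omega)
  exact (((((vx.mul vy).mul vz).add ((wx.mul wy).mul wz) d1).add two d2).add
    (hle.mul (va.mul vA)) d3 |>.add (hle.mul (vb.mul vB)) d4).add (hle.mul (vc.mul vC)) d5

end Bounds

end HexData

namespace HexData

open scoped WithZero

section Tables

variable {E : Type*} [Field E] {v : Valuation E ℤᵐ⁰}

/-- Bounds for the face variables of level `n`, written in coordinates which are rotated along
with the direction of the face; the first argument of the bounds for `f` is a parameter
distinguishing the three directions. -/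
structure Faces (v : Valuation E ℤᵐ⁰) (D : HexData E) (n : ℤ) (lo hi : ℤ → ℤ → ℤ → ℤ → ℤ)
    (gu : ℤ → ℤ → ℤ → ℤ) : Prop where
  fx : ∀ i j k, i + j + k = n → ValIn v (D.fx i j k) (lo 3 i j k) (hi 3 i j k)
  fy : ∀ i j k, i + j + k = n → ValIn v (D.fy i j k) (lo 2 j k i) (hi 2 j k i)
  fz : ∀ i j k, i + j + k = n → ValIn v (D.fz i j k) (lo 1 k i j) (hi 1 k i j)
  gx : ∀ i j k, i + j + k = n → ValLE v (D.gx i j k) (gu i j k)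
  gy : ∀ i j k, i + j + k = n → ValLE v (D.gy i j k) (gu j k i)
  gz : ∀ i j k, i + j + k = n → ValLE v (D.gz i j k) (gu k i j)

/-- A valued point at which all initial variables have prescribed valuations and at which the
vertex variable at `(1, 1, 1)` vanishes. -/
structure Seed (v : Valuation E ℤᵐ⁰) (D : HexData E) : Prop where
  fx : ∀ i j k, i + j + k = 0 → v (D.fx i j k) = WithZero.exp (if i = 0 ∧ j = 0 then 0 else 100)
  fy : ∀ i j k, i + j + k = 0 → v (D.fy i j k) = WithZero.exp (if i = 0 ∧ j = 0 then 0 else 100)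
  fz : ∀ i j k, i + j + k = 0 → v (D.fz i j k) = WithZero.exp (if i = 0 ∧ j = 0 then 0 else 100)
  h0 : ∀ i j k, i + j + k = 0 → v (D.h i j k) = WithZero.exp 0
  h1 : ∀ i j k, i + j + k = 1 → v (D.h i j k) = WithZero.exp (if i = -1 ∧ j = 1 then -3 else
    if i = 1 ∧ j = -1 then -2 else if i = 1 ∧ j = 1 then -1 else 0)
  h2 : ∀ i j k, i + j + k = 2 → v (D.h i j k) = WithZero.exp 0
  hu : D.h 1 1 1 = 0

variable {D : HexData E} {N : ℤ}

theorem Seed.h1_valIn (S : Seed v D) (i j k : ℤ) (e : i + j + k = 1) :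
    ValIn v (D.h i j k) (-3) 0 :=
  (valIn_of_eq (S.h1 i j k e)).mono (by omega) (by omega)

theorem Seed.faces_zero (S : Seed v D) (H : D.IsSol N) (hN : 0 ≤ N) :
    D.Faces v 0 (fun _ i j _ => if i = 0 ∧ j = 0 then 0 else 100)
      (fun _ i j _ => if i = 0 ∧ j = 0 then 0 else 100)
      (fun i j _ => if i = 0 ∧ j = 0 then 0 else -100) := by
  have F := fun i j k e => valIn_of_eq (S.fx i j k e)
  have F' := fun i j k e => valIn_of_eq (S.fy i j k e)
  have F'' := fun i j k e => valIn_of_eq (S.fz i j k e)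
  have h0 := fun i j k e => (valIn_of_eq (S.h0 i j k e)).le
  have h1 := fun i j k e => (S.h1_valIn i j k e).le
  have h2 := fun i j k e => (valIn_of_eq (S.h2 i j k e)).le
  have key : ∀ {f g a b c d : E} {w : ℤ}, f * g = a * b + c * d → ValIn v f w w →
      ValLE v a 0 → ValLE v b 0 → ValLE v c 0 → ValLE v d 0 → ValLE v g (-w) := by
    intro f g a b c d w e hf ha hb hc hd
    refine ValLE.of_mul (x := g) (n := 0) hf ?_ (by omega)
    rw [mul_comm, e]
    exact ((ha.mul hb).mono (by omega)).add ((hc.mul hd).mono (by omega))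
  refine ⟨F, fun i j k e => (F' i j k e).mono (by omega) (by omega),
    fun i j k e => (F'' i j k e).mono (by omega) (by omega), fun i j k e => ?_,
    fun i j k e => ?_, fun i j k e => ?_⟩
  · exact (key (H.relx i j k e.ge (e.trans_le hN)) (F i j k e) (h1 _ _ _ (by omega))
      (h1 _ _ _ (by omega)) (h0 _ _ _ e) (h2 _ _ _ (by omega))).mono (by omega)
  · exact (key (H.rely i j k e.ge (e.trans_le hN)) (F' i j k e) (h1 _ _ _ (by omega))
      (h1 _ _ _ (by omega)) (h0 _ _ _ e) (h2 _ _ _ (by omega))).mono (by omega)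
  · exact (key (H.relz i j k e.ge (e.trans_le hN)) (F'' i j k e) (h1 _ _ _ (by omega))
      (h1 _ _ _ (by omega)) (h0 _ _ _ e) (h2 _ _ _ (by omega))).mono (by omega)

theorem Seed.h3 (S : Seed v D) (H : D.IsSol N) (hN : 1 ≤ N) (i j k : ℤ) (e : i + j + k = 3)
    (hne : ¬ (i = 1 ∧ j = 1)) : ValIn v (D.h i j k) 300 300 := by
  have F := S.faces_zero H (by omega)
  have h1 := fun i j k e => (S.h1_valIn i j k e).le
  have h2 := fun i j k e => (valIn_of_eq (S.h2 i j k e)).le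
  have key := H.steph (i - 1) (j - 1) (k - 1) (by omega) (by omega)
  refine valIn_vertex (by simpa only [sub_add_cancel] using key)
    (valIn_of_eq (S.h0 _ _ _ ?_)) (F.fx _ _ _ ?_) (F.fy _ _ _ ?_) (F.fz _ _ _ ?_)
    (F.gx _ _ _ ?_) (F.gy _ _ _ ?_) (F.gz _ _ _ ?_) (h1 _ _ _ ?_) (h1 _ _ _ ?_) (h1 _ _ _ ?_)
    (h2 _ _ _ ?_) (h2 _ _ _ ?_) (h2 _ _ _ ?_) ?_ ?_ ?_ ?_ ?_ ?_ ?_ <;> omega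

theorem Seed.h3_le (S : Seed v D) (H : D.IsSol N) (hN : 1 ≤ N) (i j k : ℤ) (e : i + j + k = 3) :
    ValLE v (D.h i j k) (if i = 1 ∧ j = 1 then 0 else 300) := by
  by_cases hne : i = 1 ∧ j = 1
  · obtain ⟨rfl, rfl⟩ := hne
    obtain rfl : k = 1 := by omega
    rw [S.hu]
    exact valLE_zero
  · exact (S.h3 H hN i j k e hne).le.mono (by omega)

theorem Seed.faces_one (S : Seed v D) (H : D.IsSol N) (hN : 1 ≤ N) :
    D.Faces v 1 (fun _ i j _ => if i = 1 ∧ j = 0 then 0 else 200)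
      (fun _ i j _ => if i = 1 ∧ j = 0 then 0 else 200)
      (fun i j _ => if i = 1 ∧ j = 0 then 0 else 100) := by
  have F := S.faces_zero H (by omega)
  have h0 := fun i j k e => valIn_of_eq (S.h0 i j k e)
  have h1 := fun i j k e => (S.h1_valIn i j k e).le
  have h2 := fun i j k e => valIn_of_eq (S.h2 i j k e)
  have gx : ∀ i j k, i + j + k = 1 →
      ValLE v (D.gx i j k) (if i = 1 ∧ j = 0 then 0 else 100) := by
    intro i j k e
    have key := H.stepgx (i - 1) j k (by omega) (by omega)
    simp only [sub_add_cancel] at key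
    refine valLE_step key (h0 _ _ _ ?_) (F.gy _ _ _ ?_) (F.gz _ _ _ ?_) (h1 _ _ _ ?_)
      (F.fx _ _ _ ?_).le ?_ ?_ <;> omega
  have gy : ∀ i j k, i + j + k = 1 →
      ValLE v (D.gy i j k) (if j = 1 ∧ k = 0 then 0 else 100) := by
    intro i j k e
    have key := H.stepgy i (j - 1) k (by omega) (by omega)
    simp only [sub_add_cancel] at key
    refine valLE_step key (h0 _ _ _ ?_) (F.gz _ _ _ ?_) (F.gx _ _ _ ?_) (h1 _ _ _ ?_)
      (F.fy _ _ _ ?_).le ?_ ?_ <;> omega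
  have gz : ∀ i j k, i + j + k = 1 →
      ValLE v (D.gz i j k) (if k = 1 ∧ i = 0 then 0 else 100) := by
    intro i j k e
    have key := H.stepgz i j (k - 1) (by omega) (by omega)
    simp only [sub_add_cancel] at key
    refine valLE_step key (h0 _ _ _ ?_) (F.gx _ _ _ ?_) (F.gy _ _ _ ?_) (h1 _ _ _ ?_)
      (F.fz _ _ _ ?_).le ?_ ?_ <;> omega
  have special : ∀ {f g a b c d : E}, f * g = a * b + c * d → v a = WithZero.exp 0 →
      v b = WithZero.exp 0 → d = 0 → ValLE v f 0 → ValLE v g 0 → ValIn v f 0 0 := by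
    rintro f g a b c d e ha hb rfl hf hg
    refine ⟨?_, hf⟩
    have := ValIn.mul (valIn_of_eq ha) (valIn_of_eq hb)
    rw [mul_zero, add_zero] at e
    rw [← e] at this
    by_contra hlt
    rw [not_le] at hlt
    have h3 := this.1.trans ((v.map_mul f g).trans_le (mul_le_mul' le_rfl hg))
    simp only [add_zero, WithZero.exp_zero, mul_one] at h3 hlt
    exact absurd hlt (not_lt.2 h3)
  refine ⟨?_, ?_, ?_, gx, gy, gz⟩ <;> intro i j k e
  · by_cases hs : i = 1 ∧ j = 0
    · obtain ⟨rfl, rfl⟩ := hs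
      obtain rfl : k = 0 := by omega
      refine (special (H.relx 1 0 0 (by omega) (by omega)) (S.h2 _ _ _ (by omega))
        (S.h2 _ _ _ (by omega)) S.hu ?_ ((gx 1 0 0 rfl).mono (by omega))).mono
        (by omega) (by omega)
      refine valLE_step (H.stepfx 0 0 0 (by omega) (by omega)) (h0 _ _ _ ?_) (F.fy _ _ _ ?_).le
        (F.fz _ _ _ ?_).le (h1 _ _ _ ?_) (F.gx _ _ _ ?_) ?_ ?_ <;> omega
    · have key := H.stepfx (i - 1) j k (by omega) (by omega)
      simp only [sub_add_cancel] at key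
      refine valIn_step key (h0 _ _ _ ?_) (F.fy _ _ _ ?_) (F.fz _ _ _ ?_) (h1 _ _ _ ?_)
        (F.gx _ _ _ ?_) ?_ ?_ ?_ <;> omega
  · by_cases hs : j = 1 ∧ k = 0
    · obtain ⟨rfl, rfl⟩ := hs
      obtain rfl : i = 0 := by omega
      refine (special (H.rely 0 1 0 (by omega) (by omega)) (S.h2 _ _ _ (by omega))
        (S.h2 _ _ _ (by omega)) S.hu ?_ ((gy 0 1 0 rfl).mono (by omega))).mono
        (by omega) (by omega)
      refine valLE_step (H.stepfy 0 0 0 (by omega) (by omega)) (h0 _ _ _ ?_) (F.fz _ _ _ ?_).le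
        (F.fx _ _ _ ?_).le (h1 _ _ _ ?_) (F.gy _ _ _ ?_) ?_ ?_ <;> omega
    · have key := H.stepfy i (j - 1) k (by omega) (by omega)
      simp only [sub_add_cancel] at key
      refine valIn_step key (h0 _ _ _ ?_) (F.fz _ _ _ ?_) (F.fx _ _ _ ?_) (h1 _ _ _ ?_)
        (F.gy _ _ _ ?_) ?_ ?_ ?_ <;> omega
  · by_cases hs : k = 1 ∧ i = 0
    · obtain ⟨rfl, rfl⟩ := hs
      obtain rfl : j = 0 := by omega
      refine (special (H.relz 0 0 1 (by omega) (by omega)) (S.h2 _ _ _ (by omega))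
        (S.h2 _ _ _ (by omega)) S.hu ?_ ((gz 0 0 1 rfl).mono (by omega))).mono
        (by omega) (by omega)
      refine valLE_step (H.stepfz 0 0 0 (by omega) (by omega)) (h0 _ _ _ ?_) (F.fx _ _ _ ?_).le
        (F.fy _ _ _ ?_).le (h1 _ _ _ ?_) (F.gz _ _ _ ?_) ?_ ?_ <;> omega
    · have key := H.stepfz i j (k - 1) (by omega) (by omega)
      simp only [sub_add_cancel] at key
      refine valIn_step key (h0 _ _ _ ?_) (F.fx _ _ _ ?_) (F.fy _ _ _ ?_) (h1 _ _ _ ?_)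
        (F.gz _ _ _ ?_) ?_ ?_ ?_ <;> omega

/-- Propagation of bounds for the face variables from one level to the next. -/
theorem Faces.step {n : ℤ} {lo hi lo' hi' : ℤ → ℤ → ℤ → ℤ → ℤ}
    {gu gu' hl hu au : ℤ → ℤ → ℤ → ℤ} (H : D.IsSol N) (hn : 0 ≤ n) (hN : n < N)
    (F : D.Faces v n lo hi gu)
    (vh : ∀ i j k, i + j + k = n → ValIn v (D.h i j k) (hl i j k) (hu i j k))
    (va : ∀ i j k, i + j + k = n + 1 → ValLE v (D.h i j k) (au i j k))
    (bx : ∀ i j k, i + j + k = n → au (i + 1) j k + gu i j k < lo 2 j k i + lo 1 k i j ∧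
      lo' 3 (i + 1) j k + hu i j k ≤ lo 2 j k i + lo 1 k i j ∧
      hi 2 j k i + hi 1 k i j ≤ hi' 3 (i + 1) j k + hl i j k ∧
      gu j k i + gu k i j ≤ gu' (i + 1) j k + hl i j k ∧
      au (i + 1) j k + hi 3 i j k ≤ gu' (i + 1) j k + hl i j k)
    (bY : ∀ i j k, i + j + k = n → au i (j + 1) k + gu j k i < lo 1 k i j + lo 3 i j k ∧
      lo' 2 (j + 1) k i + hu i j k ≤ lo 1 k i j + lo 3 i j k ∧
      hi 1 k i j + hi 3 i j k ≤ hi' 2 (j + 1) k i + hl i j k ∧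
      gu k i j + gu i j k ≤ gu' (j + 1) k i + hl i j k ∧
      au i (j + 1) k + hi 2 j k i ≤ gu' (j + 1) k i + hl i j k)
    (bz : ∀ i j k, i + j + k = n → au i j (k + 1) + gu k i j < lo 3 i j k + lo 2 j k i ∧
      lo' 1 (k + 1) i j + hu i j k ≤ lo 3 i j k + lo 2 j k i ∧
      hi 3 i j k + hi 2 j k i ≤ hi' 1 (k + 1) i j + hl i j k ∧
      gu i j k + gu j k i ≤ gu' (k + 1) i j + hl i j k ∧
      au i j (k + 1) + hi 1 k i j ≤ gu' (k + 1) i j + hl i j k) :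
    D.Faces v (n + 1) lo' hi' gu' := by
  refine ⟨fun i j k e => ?_, fun i j k e => ?_, fun i j k e => ?_, fun i j k e => ?_,
    fun i j k e => ?_, fun i j k e => ?_⟩
  · obtain ⟨b1, b2, b3, b4, b5⟩ := bx (i - 1) j k (by omega)
    have key := H.stepfx (i - 1) j k (by omega) (by omega)
    simp only [sub_add_cancel] at b1 b2 b3 key
    exact valIn_step key (vh _ _ _ (by omega)) (F.fy _ _ _ (by omega)) (F.fz _ _ _ (by omega))
      (va _ _ _ e) (F.gx _ _ _ (by omega)) b1 b2 b3
  · obtain ⟨b1, b2, b3, b4, b5⟩ := bY i (j - 1) k (by omega)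
    have key := H.stepfy i (j - 1) k (by omega) (by omega)
    simp only [sub_add_cancel] at b1 b2 b3 key
    exact valIn_step key (vh _ _ _ (by omega)) (F.fz _ _ _ (by omega)) (F.fx _ _ _ (by omega))
      (va _ _ _ e) (F.gy _ _ _ (by omega)) b1 b2 b3
  · obtain ⟨b1, b2, b3, b4, b5⟩ := bz i j (k - 1) (by omega)
    have key := H.stepfz i j (k - 1) (by omega) (by omega)
    simp only [sub_add_cancel] at b1 b2 b3 key
    exact valIn_step key (vh _ _ _ (by omega)) (F.fx _ _ _ (by omega)) (F.fy _ _ _ (by omega))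
      (va _ _ _ e) (F.gz _ _ _ (by omega)) b1 b2 b3
  · obtain ⟨b1, b2, b3, b4, b5⟩ := bx (i - 1) j k (by omega)
    have key := H.stepgx (i - 1) j k (by omega) (by omega)
    simp only [sub_add_cancel] at b4 b5 key
    exact valLE_step key (vh _ _ _ (by omega)) (F.gy _ _ _ (by omega)) (F.gz _ _ _ (by omega))
      (va _ _ _ e) (F.fx _ _ _ (by omega)).le b4 b5
  · obtain ⟨b1, b2, b3, b4, b5⟩ := bY i (j - 1) k (by omega)
    have key := H.stepgy i (j - 1) k (by omega) (by omega)
    simp only [sub_add_cancel] at b4 b5 key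
    exact valLE_step key (vh _ _ _ (by omega)) (F.gz _ _ _ (by omega)) (F.gx _ _ _ (by omega))
      (va _ _ _ e) (F.fy _ _ _ (by omega)).le b4 b5
  · obtain ⟨b1, b2, b3, b4, b5⟩ := bz i j (k - 1) (by omega)
    have key := H.stepgz i j (k - 1) (by omega) (by omega)
    simp only [sub_add_cancel] at b4 b5 key
    exact valLE_step key (vh _ _ _ (by omega)) (F.gx _ _ _ (by omega)) (F.gy _ _ _ (by omega))
      (va _ _ _ e) (F.fz _ _ _ (by omega)).le b4 b5

end Tables

end HexData

namespace HexData

open scoped WithZero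

section Tables

variable {E : Type*} [Field E] {v : Valuation E ℤᵐ⁰} {D : HexData E} {N : ℤ}

set_option maxHeartbeats 1000000 in
theorem Seed.faces_two (S : Seed v D) (H : D.IsSol N) (hN : 2 ≤ N) :
    D.Faces v 2
      (fun d i j _ => if i = 1 ∧ (j = 1 ∨ j = 0) then 200 else if i = 0 ∧ j = 1 then 400 + d
        else 400)
      (fun d i j _ => if i = 1 ∧ (j = 1 ∨ j = 0) then 200 else if i = 0 ∧ j = 1 then 400 + d
        else 403)
      (fun _ _ _ => 203) := by
  refine Faces.step (n := 1) H (by omega) (by omega) (S.faces_one H (by omega))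
    (fun i j k e => valIn_of_eq (S.h1 i j k e)) (fun i j k e => (valIn_of_eq (S.h2 i j k e)).le)
    ?_ ?_ ?_ <;> intro i j k e <;> refine ⟨?_, ?_, ?_, ?_, ?_⟩ <;> omega

theorem Seed.h4 (S : Seed v D) (H : D.IsSol N) (hN : 2 ≤ N) (i j k : ℤ) (e : i + j + k = 4) :
    ValIn v (D.h i j k)
      (if (i = 2 ∧ j = 1) ∨ (i = 1 ∧ j = 2) ∨ (i = 1 ∧ j = 1) then 400 else 600)
      (if (i = 2 ∧ j = 1) ∨ (i = 1 ∧ j = 2) ∨ (i = 1 ∧ j = 1) then 400 else 606) := by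
  have F := S.faces_one H (by omega)
  have h2 := fun i j k e => (valIn_of_eq (S.h2 i j k e)).le
  have h3 : ∀ i j k, i + j + k = 3 → ValLE v (D.h i j k) 300 := fun i j k e =>
    (S.h3_le H (by omega) i j k e).mono (by omega)
  obtain ⟨i, rfl⟩ : ∃ i', i = i' + 1 := ⟨i - 1, by omega⟩
  obtain ⟨j, rfl⟩ : ∃ j', j = j' + 1 := ⟨j - 1, by omega⟩
  obtain ⟨k, rfl⟩ : ∃ k', k = k' + 1 := ⟨k - 1, by omega⟩
  have e' : i + j + k = 1 := by omega
  have vA := h3 i (j + 1) (k + 1) (by omega)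
  have vB := h3 (i + 1) j (k + 1) (by omega)
  have vC := h3 (i + 1) (j + 1) k (by omega)
  have va := h2 (i + 1) j k (by omega)
  have vb := h2 i (j + 1) k (by omega)
  have vc := h2 i j (k + 1) (by omega)
  have key := H.steph i j k (by omega) (by omega)
  have main : ∀ {hl xl yl zl ux uy uz : ℤ}, ValIn v (D.h i j k) hl 0 →
      ValIn v (D.fx i j k) xl xl → ValIn v (D.fy i j k) yl yl → ValIn v (D.fz i j k) zl zl →
      ValLE v (D.gx i j k) ux → ValLE v (D.gy i j k) uy → ValLE v (D.gz i j k) uz →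
      ux + uy + uz < xl + yl + zl → 300 < xl + yl + zl →
      ValIn v (D.h (i + 1) (j + 1) (k + 1)) (xl + yl + zl) (xl + yl + zl - 2 * hl) := by
    intro hl xl yl zl ux uy uz vh vx vy vz wx wy wz d1 d2
    refine valIn_vertex key vh vx vy vz wx wy wz va vb vc vA vB vC ?_ ?_ ?_ ?_ ?_ ?_ ?_ <;> omega
  have vh := S.h1 i j k e'
  have vx := F.fx i j k e'
  have vy := F.fy i j k e'
  have vz := F.fz i j k e'
  have wx := F.gx i j k e'
  have wy := F.gy i j k e'
  have wz := F.gz i j k e'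
  by_cases hx : i = 1 ∧ j = 0
  · refine (main (hl := 0) (valIn_of_eq (vh.trans ?_)) (vx.mono (l' := 0) ?_ ?_)
      (vy.mono (l' := 200) ?_ ?_) (vz.mono (l' := 200) ?_ ?_) (wx.mono (n := 0) ?_)
      (wy.mono (n := 100) ?_) (wz.mono (n := 100) ?_) ?_ ?_).mono ?_ ?_ <;>
    first | omega | (congr 1; omega)
  by_cases hy : j = 1 ∧ k = 0
  · refine (main (hl := 0) (valIn_of_eq (vh.trans ?_)) (vx.mono (l' := 200) ?_ ?_)
      (vy.mono (l' := 0) ?_ ?_) (vz.mono (l' := 200) ?_ ?_) (wx.mono (n := 100) ?_)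
      (wy.mono (n := 0) ?_) (wz.mono (n := 100) ?_) ?_ ?_).mono ?_ ?_ <;>
    first | omega | (congr 1; omega)
  by_cases hz : k = 1 ∧ i = 0
  · refine (main (hl := 0) (valIn_of_eq (vh.trans ?_)) (vx.mono (l' := 200) ?_ ?_)
      (vy.mono (l' := 200) ?_ ?_) (vz.mono (l' := 0) ?_ ?_) (wx.mono (n := 100) ?_)
      (wy.mono (n := 100) ?_) (wz.mono (n := 0) ?_) ?_ ?_).mono ?_ ?_ <;>
    first | omega | (congr 1; omega)
  refine (main (hl := -3) ((valIn_of_eq vh).mono ?_ ?_) (vx.mono (l' := 200) ?_ ?_)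
    (vy.mono (l' := 200) ?_ ?_) (vz.mono (l' := 200) ?_ ?_) (wx.mono (n := 100) ?_)
    (wy.mono (n := 100) ?_) (wz.mono (n := 100) ?_) ?_ ?_).mono ?_ ?_ <;> omega

end Tables

end HexData

namespace HexData

open scoped WithZero

section Tables

variable {E : Type*} [Field E] {v : Valuation E ℤᵐ⁰} {D : HexData E} {N : ℤ}

set_option maxHeartbeats 2000000 in
theorem Seed.faces_three (S : Seed v D) (H : D.IsSol N) (hN : 3 ≤ N) :
    D.Faces v 3
      (fun _ i j _ => if i = 1 ∧ j = 1 then 400 else if i = 2 ∧ (j = 1 ∨ j = 0) then 600 else 800)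
      (fun _ i j _ => if i = 1 ∧ j = 1 then 400 else if i = 2 ∧ (j = 1 ∨ j = 0) then 603 else 806)
      (fun i j _ => if i = 1 ∧ j = 1 then 406 else if i = 2 ∧ (j = 1 ∨ j = 0) then 500
        else 703) := by
  refine Faces.step (n := 2) H (by omega) (by omega) (S.faces_two H (by omega))
    (fun i j k e => valIn_of_eq (S.h2 i j k e)) (S.h3_le H (by omega))
    ?_ ?_ ?_ <;> intro i j k e <;> refine ⟨?_, ?_, ?_, ?_, ?_⟩ <;> omega

theorem Seed.h5 (S : Seed v D) (H : D.IsSol N) (hN : 3 ≤ N) (i j k : ℤ) (e : i + j + k = 5) :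
    ValIn v (D.h i j k)
      (if i = 1 ∧ j = 2 then 803 else if i = 2 ∧ j = 1 then 802 else if i = 2 ∧ j = 2 then 801
        else 1200)
      (if i = 1 ∧ j = 2 then 803 else if i = 2 ∧ j = 1 then 802 else if i = 2 ∧ j = 2 then 801
        else 1209) := by
  have F := S.faces_two H (by omega)
  have h3 := S.h3_le H (by omega)
  have h4 := fun i j k e => (S.h4 H (by omega) i j k e).le
  obtain ⟨i, rfl⟩ : ∃ i', i = i' + 1 := ⟨i - 1, by omega⟩
  obtain ⟨j, rfl⟩ : ∃ j', j = j' + 1 := ⟨j - 1, by omega⟩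
  obtain ⟨k, rfl⟩ : ∃ k', k = k' + 1 := ⟨k - 1, by omega⟩
  have e' : i + j + k = 2 := by omega
  have key := H.steph i j k (by omega) (by omega)
  have vh := valIn_of_eq (S.h2 i j k e')
  have vx := F.fx i j k e'
  have vy := F.fy i j k e'
  have vz := F.fz i j k e'
  have wx := F.gx i j k e'
  have wy := F.gy i j k e'
  have wz := F.gz i j k e'
  have vA := h4 i (j + 1) (k + 1) (by omega)
  have vB := h4 (i + 1) j (k + 1) (by omega)
  have vC := h4 (i + 1) (j + 1) k (by omega)
  have va := h3 (i + 1) j k (by omega)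
  have vb := h3 i (j + 1) k (by omega)
  have vc := h3 i j (k + 1) (by omega)
  have main : ∀ {xl xu yl yu zl zu ua ub uc uA uB uC : ℤ},
      ValIn v (D.fx i j k) xl xu → ValIn v (D.fy i j k) yl yu → ValIn v (D.fz i j k) zl zu →
      ValLE v (D.h (i + 1) j k) ua → ValLE v (D.h i (j + 1) k) ub →
      ValLE v (D.h i j (k + 1)) uc → ValLE v (D.h i (j + 1) (k + 1)) uA →
      ValLE v (D.h (i + 1) j (k + 1)) uB → ValLE v (D.h (i + 1) (j + 1) k) uC →
      609 < xl + yl + zl → ua + ub + uc < xl + yl + zl → ua + uA < xl + yl + zl →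
      ub + uB < xl + yl + zl → uc + uC < xl + yl + zl →
      ValIn v (D.h (i + 1) (j + 1) (k + 1)) (xl + yl + zl) (xu + yu + zu) := by
    intro xl xu yl yu zl zu ua ub uc uA uB uC vx vy vz va vb vc vA vB vC d1 d2 d3 d4 d5
    refine valIn_vertex key vh vx vy vz wx wy wz va vb vc vA vB vC ?_ ?_ ?_ ?_ ?_ ?_ ?_ <;> omega
  by_cases hx : i = 0 ∧ j = 1
  · refine (main (vx.mono (l' := 403) (u' := 403) ?_ ?_) (vy.mono (l' := 200) (u' := 200) ?_ ?_)
      (vz.mono (l' := 200) (u' := 200) ?_ ?_) (va.mono (n := 0) ?_) (vb.mono (n := 300) ?_)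
      (vc.mono (n := 300) ?_) (vA.mono (n := 606) ?_) (vB.mono (n := 400) ?_)
      (vC.mono (n := 400) ?_) ?_ ?_ ?_ ?_ ?_).mono ?_ ?_ <;> omega
  by_cases hy : j = 0 ∧ k = 1
  · refine (main (vx.mono (l' := 200) (u' := 200) ?_ ?_) (vy.mono (l' := 402) (u' := 402) ?_ ?_)
      (vz.mono (l' := 200) (u' := 200) ?_ ?_) (va.mono (n := 300) ?_) (vb.mono (n := 0) ?_)
      (vc.mono (n := 300) ?_) (vA.mono (n := 400) ?_) (vB.mono (n := 606) ?_)
      (vC.mono (n := 400) ?_) ?_ ?_ ?_ ?_ ?_).mono ?_ ?_ <;> omega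
  by_cases hz : k = 0 ∧ i = 1
  · refine (main (vx.mono (l' := 200) (u' := 200) ?_ ?_) (vy.mono (l' := 200) (u' := 200) ?_ ?_)
      (vz.mono (l' := 401) (u' := 401) ?_ ?_) (va.mono (n := 300) ?_) (vb.mono (n := 300) ?_)
      (vc.mono (n := 0) ?_) (vA.mono (n := 400) ?_) (vB.mono (n := 400) ?_)
      (vC.mono (n := 606) ?_) ?_ ?_ ?_ ?_ ?_).mono ?_ ?_ <;> omega
  refine (main (vx.mono (l' := 400) (u' := 403) ?_ ?_) (vy.mono (l' := 400) (u' := 403) ?_ ?_)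
    (vz.mono (l' := 400) (u' := 403) ?_ ?_) (va.mono (n := 300) ?_) (vb.mono (n := 300) ?_)
    (vc.mono (n := 300) ?_) (vA.mono (n := 606) ?_) (vB.mono (n := 606) ?_)
    (vC.mono (n := 606) ?_) ?_ ?_ ?_ ?_ ?_).mono ?_ ?_ <;> omega

theorem Seed.fx4 (S : Seed v D) (H : D.IsSol N) (hN : 4 ≤ N) (i j k : ℤ) (e : i + j + k = 3)
    (hne : ¬ (i = 1 ∧ j = 1)) : D.fx (i + 1) j k ≠ 0 := by
  have F := S.faces_three H (by omega)
  refine (valIn_step (l := 1400 - 300) (u := 2000) (H.stepfx i j k (by omega) (by omega))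
    (S.h3 H (by omega) i j k e hne) (F.fy _ _ _ e) (F.fz _ _ _ e)
    (S.h4 H (by omega) _ _ _ ?_).le (F.gx _ _ _ e) ?_ ?_ ?_).ne_zero <;> omega

theorem Seed.fy4 (S : Seed v D) (H : D.IsSol N) (hN : 4 ≤ N) (i j k : ℤ) (e : i + j + k = 3)
    (hne : ¬ (i = 1 ∧ j = 1)) : D.fy i (j + 1) k ≠ 0 := by
  have F := S.faces_three H (by omega)
  refine (valIn_step (l := 1400 - 300) (u := 2000) (H.stepfy i j k (by omega) (by omega))
    (S.h3 H (by omega) i j k e hne) (F.fz _ _ _ e) (F.fx _ _ _ e)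
    (S.h4 H (by omega) _ _ _ ?_).le (F.gy _ _ _ e) ?_ ?_ ?_).ne_zero <;> omega

theorem Seed.fz4 (S : Seed v D) (H : D.IsSol N) (hN : 4 ≤ N) (i j k : ℤ) (e : i + j + k = 3)
    (hne : ¬ (i = 1 ∧ j = 1)) : D.fz i j (k + 1) ≠ 0 := by
  have F := S.faces_three H (by omega)
  refine (valIn_step (l := 1400 - 300) (u := 2000) (H.stepfz i j k (by omega) (by omega))
    (S.h3 H (by omega) i j k e hne) (F.fx _ _ _ e) (F.fy _ _ _ e)
    (S.h4 H (by omega) _ _ _ ?_).le (F.gz _ _ _ e) ?_ ?_ ?_).ne_zero <;> omega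

theorem Seed.h6 (S : Seed v D) (H : D.IsSol N) (hN : 4 ≤ N) (i j k : ℤ) (e : i + j + k = 3)
    (hne : ¬ (i = 1 ∧ j = 1)) : D.h (i + 1) (j + 1) (k + 1) ≠ 0 := by
  have F := S.faces_three H (by omega)
  have h4 : ∀ i j k, i + j + k = 4 → ValLE v (D.h i j k) 606 := fun i j k e =>
    (S.h4 H (by omega) i j k e).le.mono (by omega)
  have h5 : ∀ i j k, i + j + k = 5 → ValLE v (D.h i j k) 1209 := fun i j k e =>
    (S.h5 H (by omega) i j k e).le.mono (by omega)
  have vx := F.fx i j k e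
  have vy := F.fy i j k e
  have vz := F.fz i j k e
  have wx := F.gx i j k e
  have wy := F.gy i j k e
  have wz := F.gz i j k e
  have main : ∀ {xl yl zl ux uy uz : ℤ},
      ValIn v (D.fx i j k) xl 806 → ValIn v (D.fy i j k) yl 806 → ValIn v (D.fz i j k) zl 806 →
      ValLE v (D.gx i j k) ux → ValLE v (D.gy i j k) uy → ValLE v (D.gz i j k) uz →
      ux + uy + uz < xl + yl + zl → 2200 ≤ xl + yl + zl →
      D.h (i + 1) (j + 1) (k + 1) ≠ 0 := by
    intro xl yl zl ux uy uz vx vy vz wx wy wz d1 d2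
    refine (valIn_vertex (l := 1600) (u := 3000) (H.steph i j k (by omega) (by omega))
      (S.h3 H (by omega) i j k e hne) vx vy vz wx wy wz (h4 _ _ _ ?_) (h4 _ _ _ ?_) (h4 _ _ _ ?_)
      (h5 _ _ _ ?_) (h5 _ _ _ ?_) (h5 _ _ _ ?_) ?_ ?_ ?_ ?_ ?_ ?_ ?_).ne_zero <;> omega
  by_cases hx : i = 2 ∧ (j = 1 ∨ j = 0)
  · refine main (vx.mono (l' := 600) ?_ ?_) (vy.mono (l' := 800) ?_ ?_)
      (vz.mono (l' := 800) ?_ ?_) (wx.mono (n := 500) ?_) (wy.mono (n := 703) ?_)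
      (wz.mono (n := 703) ?_) ?_ ?_ <;> omega
  by_cases hy : j = 2 ∧ (k = 1 ∨ k = 0)
  · refine main (vx.mono (l' := 800) ?_ ?_) (vy.mono (l' := 600) ?_ ?_)
      (vz.mono (l' := 800) ?_ ?_) (wx.mono (n := 703) ?_) (wy.mono (n := 500) ?_)
      (wz.mono (n := 703) ?_) ?_ ?_ <;> omega
  by_cases hz : k = 2 ∧ (i = 1 ∨ i = 0)
  · refine main (vx.mono (l' := 800) ?_ ?_) (vy.mono (l' := 800) ?_ ?_)
      (vz.mono (l' := 600) ?_ ?_) (wx.mono (n := 703) ?_) (wy.mono (n := 703) ?_)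
      (wz.mono (n := 500) ?_) ?_ ?_ <;> omega
  refine main (vx.mono (l' := 800) ?_ ?_) (vy.mono (l' := 800) ?_ ?_)
    (vz.mono (l' := 800) ?_ ?_) (wx.mono (n := 703) ?_) (wy.mono (n := 703) ?_)
    (wz.mono (n := 703) ?_) ?_ ?_ <;> omega

end Tables

end HexData

namespace HexData

open scoped WithZero

section Theta

variable {R : Type*} [CommRing R]

section Domain

variable [IsDomain R] {D : HexData R} {N : ℤ}

theorem IsSol.backx (H : D.IsSol N) {i j k : ℤ} (h0 : 0 ≤ i + j + k) (h1 : i + j + k < N)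
    (hh : D.h i j k ≠ 0) : D.fx i j k * D.h (i + 1) (j + 1) (k + 1) =
      D.fy i (j + 1) k * D.fz i j (k + 1) + D.h i (j + 1) (k + 1) * D.gx (i + 1) j k := by
  refine mul_left_cancel₀ (pow_ne_zero 2 hh) ?_
  linear_combination D.fx i j k * H.steph i j k h0 h1 -
    D.fz i j (k + 1) * D.h i j k * H.stepfy i j k h0 h1 -
    (D.fz i j k * D.fx i j k + D.h i (j + 1) k * D.gy i j k) * H.stepfz i j k h0 h1 -
    D.h i (j + 1) (k + 1) * D.h i j k * H.stepgx i j k h0 h1 +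
    D.gy i j k * D.gz i j k * H.relx i j k h0 h1.le -
    D.fx i j k * D.h i j (k + 1) * H.relz i j k h0 h1.le -
    D.fx i j k * D.h i (j + 1) k * H.rely i j k h0 h1.le

theorem IsSol.backy (H : D.IsSol N) {i j k : ℤ} (h0 : 0 ≤ i + j + k) (h1 : i + j + k < N)
    (hh : D.h i j k ≠ 0) : D.fy i j k * D.h (i + 1) (j + 1) (k + 1) =
      D.fz i j (k + 1) * D.fx (i + 1) j k + D.h (i + 1) j (k + 1) * D.gy i (j + 1) k :=
  H.rot.backx (i := j) (j := k) (k := i) (by omega) (by omega) hh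

theorem IsSol.backz (H : D.IsSol N) {i j k : ℤ} (h0 : 0 ≤ i + j + k) (h1 : i + j + k < N)
    (hh : D.h i j k ≠ 0) : D.fz i j k * D.h (i + 1) (j + 1) (k + 1) =
      D.fx (i + 1) j k * D.fy i (j + 1) k + D.h (i + 1) (j + 1) k * D.gz i j (k + 1) :=
  H.rot.backy (i := j) (j := k) (k := i) (by omega) (by omega) hh

end Domain

/-- The quotient of `(fx fy fz + h₁ h₂ h₃) h₋₁ h₋₂ h₋₃` at the vertex `(1, 1, 1)` by the vertex
variable there, see `HexData.IsSol.psi_eq`. -/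
def psi (D : HexData R) : R :=
  D.gx 0 1 1 * (D.fy 1 1 1 * D.h 1 0 1) * (D.fz 1 1 1 * D.h 1 1 0) +
    D.fy 0 1 1 * D.fz 0 1 1 * D.gy 1 0 1 * (D.fz 1 1 1 * D.h 1 1 0) +
    D.fy 0 1 1 * D.fz 0 1 1 * (D.fz 1 0 1 * D.fx 1 0 1) * D.gz 1 1 0 -
  (D.gx 2 0 0 * (D.fz 0 1 1 * D.fx 1 1 0) * (D.fx 1 0 1 * D.fy 0 1 1) +
    D.fx 1 0 0 * D.h 2 1 1 * D.gy 0 2 0 * (D.fx 1 0 1 * D.fy 0 1 1) +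
    D.fx 1 0 0 * D.h 2 1 1 * (D.fy 0 1 0 * D.h 1 2 1) * D.gz 0 0 2) +
  D.h 2 1 1 * D.h 1 2 1 * D.h 1 1 2 *
    (D.fx 0 0 0 * D.fx 1 0 0 - D.h 0 1 1 * D.h 1 0 0)

theorem map_psi {S : Type*} [CommRing S] (D : HexData R) (φ : R →+* S) :
    φ D.psi = (D.map φ).psi := by
  simp only [psi, map, map_add, map_sub, map_mul]

theorem IsSol.psi_eq [IsDomain R] {D : HexData R} {N : ℤ} (H : D.IsSol N) (hN : 3 ≤ N)
    (h0 : D.h 0 0 0 ≠ 0) (hx : D.h 1 0 0 ≠ 0) (hy : D.h 0 1 0 ≠ 0) (hz : D.h 0 0 1 ≠ 0) :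
    (D.fx 1 1 1 * D.fy 1 1 1 * D.fz 1 1 1 + D.h 2 1 1 * D.h 1 2 1 * D.h 1 1 2) *
      (D.h 0 1 1 * D.h 1 0 1 * D.h 1 1 0) = D.h 1 1 1 * D.psi := by
  have q1 := H.stepfx 0 1 1 (by omega) (by omega)
  have q2 := H.stepfy 1 0 1 (by omega) (by omega)
  have q3 := H.stepfz 1 1 0 (by omega) (by omega)
  have b1 := H.backx (i := 1) (j := 0) (k := 0) (by omega) (by omega) hx
  have b2 := H.backy (i := 0) (j := 1) (k := 0) (by omega) (by omega) hy
  have b3 := H.backz (i := 0) (j := 0) (k := 1) (by omega) (by omega) hz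
  have b0 := H.backx (i := 0) (j := 0) (k := 0) (by omega) (by omega) h0
  have r := H.relx 1 0 0 (by omega) (by omega)
  norm_num only at q1 q2 q3 b1 b2 b3 b0 r
  rw [psi]
  linear_combination (D.fy 1 1 1 * D.h 1 0 1) * (D.fz 1 1 1 * D.h 1 1 0) * q1 +
    D.fy 0 1 1 * D.fz 0 1 1 * (D.fz 1 1 1 * D.h 1 1 0) * q2 +
    D.fy 0 1 1 * D.fz 0 1 1 * (D.fz 1 0 1 * D.fx 1 0 1) * q3 -
    (D.fz 0 1 1 * D.fx 1 1 0) * (D.fx 1 0 1 * D.fy 0 1 1) * b1 -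
    D.fx 1 0 0 * D.h 2 1 1 * (D.fx 1 0 1 * D.fy 0 1 1) * b2 -
    D.fx 1 0 0 * D.h 2 1 1 * (D.fy 0 1 0 * D.h 1 2 1) * b3 -
    D.h 2 1 1 * D.h 1 2 1 * D.h 1 1 2 * (D.fx 1 0 0 * b0 + D.h 0 1 1 * r)

end Theta

theorem Seed.psi_le {E : Type*} [Field E] {v : Valuation E ℤᵐ⁰} {D : HexData E} (S : Seed v D)
    (H : D.IsSol 3) : ValLE v D.psi 1200 := by
  have F1 := S.faces_one H (by omega)
  have F2 := S.faces_two H (by omega)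
  have F3 := S.faces_three H (by omega)
  have h2 := fun i j k e => (valIn_of_eq (S.h2 i j k e)).le
  have h4 := fun i j k e => (S.h4 H (by omega) i j k e).le
  refine ValLE.add (ValLE.sub (ValLE.add (ValLE.add (ValLE.mono (((F2.gx 0 1 1 rfl).mul
    ((F3.fy 1 1 1 rfl).le.mul (h2 1 0 1 rfl))).mul ((F3.fz 1 1 1 rfl).le.mul (h2 1 1 0 rfl))) ?_)
    (ValLE.mono ((((F2.fy 0 1 1 rfl).le.mul (F2.fz 0 1 1 rfl).le).mul (F2.gy 1 0 1 rfl)).mul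
    ((F3.fz 1 1 1 rfl).le.mul (h2 1 1 0 rfl))) ?_)) (ValLE.mono ((((F2.fy 0 1 1 rfl).le.mul
    (F2.fz 0 1 1 rfl).le).mul ((F2.fz 1 0 1 rfl).le.mul (F2.fx 1 0 1 rfl).le)).mul
    (F2.gz 1 1 0 rfl)) ?_)) (ValLE.add (ValLE.add (ValLE.mono (((F2.gx 2 0 0 rfl).mul
    ((F2.fz 0 1 1 rfl).le.mul (F2.fx 1 1 0 rfl).le)).mul ((F2.fx 1 0 1 rfl).le.mul
    (F2.fy 0 1 1 rfl).le)) ?_) (ValLE.mono ((((F1.fx 1 0 0 rfl).le.mul (h4 2 1 1 rfl)).mul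
    (F2.gy 0 2 0 rfl)).mul ((F2.fx 1 0 1 rfl).le.mul (F2.fy 0 1 1 rfl).le)) ?_))
    (ValLE.mono ((((F1.fx 1 0 0 rfl).le.mul (h4 2 1 1 rfl)).mul
    ((F1.fy 0 1 0 rfl).le.mul (h4 1 2 1 rfl))).mul (F2.gz 0 0 2 rfl)) ?_)))
    (ValLE.mono (((((h4 2 1 1 rfl).mul (h4 1 2 1 rfl)).mul (h4 1 1 2 rfl))).mul
    (ValLE.sub (n := 0) (ValLE.mono ((valIn_of_eq (S.fx 0 0 0 rfl)).le.mul
    (F1.fx 1 0 0 rfl).le) ?_) (ValLE.mono ((h2 0 1 1 rfl).mul (S.h1_valIn 1 0 0 rfl).le) ?_))) ?_)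
    <;> norm_num

/-- The cube at a vertex whose variable `ε` vanishes at a valued point `φ`. -/
theorem special_cube {K E : Type*} [Field K] [Field E] {L O : Subring K} (hLO : L ≤ O)
    {φ : L →+* E} (hφ : ∀ x : L, φ x ≠ 0 → (x : K)⁻¹ ∈ O) {v : Valuation E ℤᵐ⁰}
    {ε a b c A B C fx fy fz gx gy gz θ ϑ : L} {h' fx' fy' fz' gx' gy' gz' : K} (hε : ε ≠ 0)
    (zε : φ ε = 0) (va : ValIn v (φ a) 400 400) (vb : ValIn v (φ b) 400 400)
    (vc : ValIn v (φ c) 400 400) (vA : ValIn v (φ A) 803 803) (vB : ValIn v (φ B) 802 802)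
    (vC : ValIn v (φ C) 801 801) (vθ : ValLE v (φ θ) 1200)
    (rx : fx * gx = b * c + ε * A) (ry : fy * gy = c * a + ε * B) (rz : fz * gz = a * b + ε * C)
    (eθ : fx * fy * fz + a * b * c = ε * θ) (eϑ : gx * gy * gz + a * b * c = ε * ϑ)
    (sfx : fx' * ε = fy * fz + a * gx) (sfy : fy' * ε = fz * fx + b * gy)
    (sfz : fz' * ε = fx * fy + c * gz) (sgx : gx' * ε = gy * gz + a * fx)
    (sgy : gy' * ε = gz * gx + b * fy) (sgz : gz' * ε = gx * gy + c * fz)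
    (sh : h' * ε ^ 2 = fx * fy * fz + gx * gy * gz + 2 * (a * b * c) +
      ε * (a * A + b * B + c * C)) :
    (h' ∈ O ∧ fx' ∈ O ∧ fy' ∈ O ∧ fz' ∈ O ∧ gx' ∈ O ∧ gy' ∈ O ∧ gz' ∈ O) ∧
      h'⁻¹ ∈ O ∧ fx'⁻¹ ∈ O ∧ fy'⁻¹ ∈ O ∧ fz'⁻¹ ∈ O := by
  have na := va.ne_zero
  have nb := vb.ne_zero
  have nc := vc.ne_zero
  have kε : (ε : K) ≠ 0 := fun h => hε (Subtype.ext h)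
  have face : ∀ {f g p q r : L}, f * g = p * q + ε * r → φ p ≠ 0 → φ q ≠ 0 →
      φ f ≠ 0 ∧ φ g ≠ 0 := by
    intro f g p q r e hp hq
    refine mul_ne_zero_iff.1 ?_
    rw [← map_mul, e, map_add, map_mul, map_mul, zε, zero_mul, add_zero]
    exact mul_ne_zero hp hq
  have div : ∀ {y : K} {f x : L}, φ f ≠ 0 → y * f = x → y ∈ O := by
    intro y f x hf e
    have hf0 : (f : K) ≠ 0 := fun h => hf (by rw [show f = 0 from Subtype.ext h, map_zero])
    rw [eq_div_of_mul_eq hf0 e, div_eq_mul_inv]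
    exact O.mul_mem (hLO x.2) (hφ f hf)
  have divinv : ∀ {y : K} {f x : L}, φ x ≠ 0 → y * f = x → y⁻¹ ∈ O := by
    intro y f x hx e
    have hx0 : (x : K) ≠ 0 := fun h => hx (by rw [show x = 0 from Subtype.ext h, map_zero])
    have hf0 : (f : K) ≠ 0 := fun h => hx0 (by rw [← e, h, mul_zero])
    rw [eq_div_of_mul_eq hf0 e, inv_div, div_eq_mul_inv]
    exact O.mul_mem (hLO f.2) (hφ x hx)
  have k : ∀ {x y : L}, x = y → (x : K) = y := congrArg _
  have krx := k rx
  have kry := k ry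
  have krz := k rz
  have keθ := k eθ
  have keϑ := k eϑ
  push_cast at krx kry krz keθ keϑ
  have efx : fx' * fx = (θ + a * A : L) := by
    push_cast
    refine mul_left_cancel₀ kε ?_
    linear_combination fx * sfx + a * krx + keθ
  have efy : fy' * fy = (θ + b * B : L) := by
    push_cast
    refine mul_left_cancel₀ kε ?_
    linear_combination fy * sfy + b * kry + keθ
  have efz : fz' * fz = (θ + c * C : L) := by
    push_cast
    refine mul_left_cancel₀ kε ?_
    linear_combination fz * sfz + c * krz + keθ
  have egx : gx' * gx = (ϑ + a * A : L) := by
    push_cast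
    refine mul_left_cancel₀ kε ?_
    linear_combination gx * sgx + a * krx + keϑ
  have egy : gy' * gy = (ϑ + b * B : L) := by
    push_cast
    refine mul_left_cancel₀ kε ?_
    linear_combination gy * sgy + b * kry + keϑ
  have egz : gz' * gz = (ϑ + c * C : L) := by
    push_cast
    refine mul_left_cancel₀ kε ?_
    linear_combination gz * sgz + c * krz + keϑ
  have eX : a * b * c * (θ + ϑ + (a * A + b * B + c * C)) = ε * (θ * ϑ -
      (a * A * (b * B) + a * A * (c * C) + b * B * (c * C)) - ε * (A * B * C)) := by
    refine mul_left_cancel₀ hε ?_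
    linear_combination gx * gy * gz * eθ + (ε * θ - a * b * c) * eϑ - gy * gz * fy * fz * rx -
      gz * fz * (b * c + ε * A) * ry - (b * c + ε * A) * (c * a + ε * B) * rz
  have eh : h' * (a * b * c : L) = (θ * ϑ -
      (a * A * (b * B) + a * A * (c * C) + b * B * (c * C)) - ε * (A * B * C) : L) := by
    have keX := k eX
    push_cast at keX ⊢
    refine mul_left_cancel₀ (pow_ne_zero 2 kε) ?_
    linear_combination a * b * c * sh + ε * keX + a * b * c * (keθ + keϑ)
  have nabc : φ (a * b * c) ≠ 0 := by
    rw [map_mul, map_mul]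
    exact mul_ne_zero (mul_ne_zero na nb) nc
  have sum0 : φ θ + φ ϑ + (φ a * φ A + φ b * φ B + φ c * φ C) = 0 := by
    have := congrArg φ eX
    rw [map_mul, map_mul _ ε, zε, zero_mul, mul_eq_zero] at this
    simpa only [map_add, map_mul] using this.resolve_left nabc
  have vaA := va.mul vA
  have vbB := vb.mul vB
  have vcC := vc.mul vC
  have nX : φ (θ * ϑ - (a * A * (b * B) + a * A * (c * C) + b * B * (c * C)) -
      ε * (A * B * C)) ≠ 0 := by
    have e : φ (θ * ϑ - (a * A * (b * B) + a * A * (c * C) + b * B * (c * C)) -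
        ε * (A * B * C)) = - (φ a * φ A * (φ b * φ B) + (φ a * φ A * (φ c * φ C) +
        φ b * φ B * (φ c * φ C) + φ θ * (φ θ + (φ a * φ A + φ b * φ B + φ c * φ C)))) := by
      simp only [map_sub, map_add, map_mul, zε]
      linear_combination φ θ * sum0
    rw [e, neg_ne_zero]
    refine ((vaA.mul vbB).add (n := 2404) ?_ (by norm_num)).ne_zero
    refine (((vaA.mul vcC).le.mono (by norm_num)).add
      ((vbB.mul vcC).le.mono (by norm_num))).add ?_
    refine (vθ.mul (n := 1203) ((vθ.mono (by norm_num)).add (((vaA.le.mono (by norm_num)).add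
      (vbB.le.mono (by norm_num))).add (vcC.le.mono (by norm_num))))).mono (by norm_num)
  have sum : ∀ {x y : L} {l u : ℤ}, ValIn v (φ x * φ y) l u → 1200 < l → φ (θ + x * y) ≠ 0 := by
    intro x y l u h hl
    rw [add_comm, map_add, map_mul]
    exact (h.add vθ hl).ne_zero
  have nx := face rx nb nc
  have ny := face ry nc na
  have nz := face rz na nb
  exact ⟨⟨div nabc eh, div nx.1 efx, div ny.1 efy, div nz.1 efz, div nx.2 egx, div ny.2 egy,
    div nz.2 egz⟩, divinv nX eh, divinv (sum vaA (by norm_num)) efx,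
    divinv (sum vbB (by norm_num)) efy, divinv (sum vcC (by norm_num)) efz⟩

end HexData

universe u

namespace HexData

open scoped WithZero

open MvPolynomial

/-- A valued point at which all initial variables have prescribed valuations and at which a
face variable next to the origin vanishes. -/
structure FaceSeed {E : Type*} [Field E] (v : Valuation E ℤᵐ⁰) (D : HexData E) : Prop where
  fx : ∀ i j k, i + j + k = 0 → v (D.fx i j k) = WithZero.exp (if i = 0 ∧ j = 0 then 0 else 10)
  fy : ∀ i j k, i + j + k = 0 → v (D.fy i j k) = WithZero.exp (if i = 0 ∧ j = 0 then 0 else 10)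
  fz : ∀ i j k, i + j + k = 0 → v (D.fz i j k) = WithZero.exp (if i = 0 ∧ j = 0 then 0 else 10)
  h0 : ∀ i j k, i + j + k = 0 → v (D.h i j k) = WithZero.exp 0
  h1 : ∀ i j k, i + j + k = 1 → v (D.h i j k) = WithZero.exp 0
  h2 : ∀ i j k, i + j + k = 2 → v (D.h i j k) = WithZero.exp (if i = 1 ∧ (j = 0 ∨ j = 1) then 1
    else 0)
  gx0 : D.gx 0 0 0 = 0 ∨ v (D.gx 0 0 0) = WithZero.exp 0

section Evaluation

variable {E : Type*} [Field E] {v : Valuation E ℤᵐ⁰} {D : HexData E}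

theorem FaceSeed.g_level_one_ne_zero (S : FaceSeed v D) (H : D.IsSol 1) (i j k : ℤ)
    (e : i + j + k = 0) :
    D.gx (i + 1) j k ≠ 0 ∧ D.gy i (j + 1) k ≠ 0 ∧ D.gz i j (k + 1) ≠ 0 := by
  have h0 := fun i j k e => valIn_of_eq (S.h0 i j k e)
  have h1 := fun i j k e => (valIn_of_eq (S.h1 i j k e)).le
  have sx := H.stepgx i j k e.ge (by omega)
  have sy := H.stepgy i j k e.ge (by omega)
  have sz := H.stepgz i j k e.ge (by omega)
  have rx := H.relx i j k e.ge (by omega)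
  have ry := H.rely i j k e.ge (by omega)
  have rz := H.relz i j k e.ge (by omega)
  have ha := valIn_of_eq (S.h1 (i + 1) j k (by omega))
  have hb := valIn_of_eq (S.h1 i (j + 1) k (by omega))
  have hc := valIn_of_eq (S.h1 i j (k + 1) (by omega))
  by_cases hs : i = 0 ∧ j = 0
  · obtain ⟨rfl, rfl⟩ := hs
    obtain rfl : k = 0 := by omega
    have vx : ValIn v (D.fx 0 0 0) 0 0 := valIn_of_eq (S.fx 0 0 0 rfl)
    have vy : ValIn v (D.fy 0 0 0) 0 0 := valIn_of_eq (S.fy 0 0 0 rfl)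
    have vz : ValIn v (D.fz 0 0 0) 0 0 := valIn_of_eq (S.fz 0 0 0 rfl)
    have vh : ValIn v (D.h 0 0 0) 0 0 := valIn_of_eq (S.h0 0 0 0 rfl)
    have vB : ValIn v (D.h (0 + 1) 0 (0 + 1)) 1 1 := valIn_of_eq (S.h2 _ _ _ rfl)
    have vC : ValIn v (D.h (0 + 1) (0 + 1) 0) 1 1 := valIn_of_eq (S.h2 _ _ _ rfl)
    rw [mul_comm, add_comm] at ry rz
    have vgy : ValIn v (D.gy 0 0 0) 1 1 := ValIn.of_mul vy
      (ry ▸ (vh.mul vB).add (hc.mul ha).le (by norm_num)) (by norm_num) (by norm_num)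
    have vgz : ValIn v (D.gz 0 0 0) 1 1 := ValIn.of_mul vz
      (rz ▸ (vh.mul vC).add (ha.mul hb).le (by norm_num)) (by norm_num) (by norm_num)
    refine ⟨(ValIn.of_mul (m := 2) (n := 2) vh
      (sx ▸ (vgy.mul vgz).add (ha.mul vx).le (by norm_num)) (by norm_num) (by norm_num)).ne_zero,
      ?_, ?_⟩
    · refine left_ne_zero_of_mul (b := D.h 0 0 0) ?_
      rw [sy]
      obtain hg | hg := S.gx0
      · rw [hg, mul_zero, zero_add]
        exact (hb.mul vy).ne_zero
      · exact ((vgz.mul (valIn_of_eq hg)).add (hb.mul vy).le (by norm_num)).ne_zero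
    · refine left_ne_zero_of_mul (b := D.h 0 0 0) ?_
      rw [sz]
      obtain hg | hg := S.gx0
      · rw [hg, zero_mul, zero_add]
        exact (hc.mul vz).ne_zero
      · exact (((valIn_of_eq hg).mul vgy).add (hc.mul vz).le (by norm_num)).ne_zero
  · have vx : ValIn v (D.fx i j k) 10 10 := (valIn_of_eq (S.fx i j k e)).mono (by omega) (by omega)
    have vy : ValIn v (D.fy i j k) 10 10 := (valIn_of_eq (S.fy i j k e)).mono (by omega) (by omega)
    have vz : ValIn v (D.fz i j k) 10 10 := (valIn_of_eq (S.fz i j k e)).mono (by omega) (by omega)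
    have vh := h0 i j k e
    have h2 : ∀ i j k, i + j + k = 2 → ValLE v (D.h i j k) 1 := fun i j k e =>
      (valIn_of_eq (S.h2 i j k e)).le.mono (by omega)
    have g : ∀ {f g a b h A : E}, f * g = a * b + h * A → ValIn v f 10 10 → ValIn v a 0 0 →
        ValIn v b 0 0 → ValIn v h 0 0 → ValLE v A 1 → ValLE v g (-9) := by
      intro f g a b h A e vf va vb vh vA
      rw [mul_comm] at e
      exact ValLE.of_mul (n := 1) vf (e ▸ ((va.mul vb).le.mono (by norm_num)).add
        ((vh.le.mul vA).mono (by norm_num))) (by norm_num)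
    have g' : ∀ {g a f g' h p : E}, g' * h = p * g + a * f → ValLE v p (-9) → ValLE v g (-9) →
        ValIn v a 0 0 → ValIn v f 10 10 → g' ≠ 0 := by
      intro g a f g' h p e vp vg va vf
      refine left_ne_zero_of_mul (b := h) ?_
      rw [e, add_comm]
      exact ((va.mul vf).add (vp.mul vg) (by norm_num)).ne_zero
    have vgx := g rx vx hb hc vh (h2 _ _ _ (by omega))
    have vgy := g ry vy hc ha vh (h2 _ _ _ (by omega))
    have vgz := g rz vz ha hb vh (h2 _ _ _ (by omega))
    exact ⟨g' sx vgy vgz ha vx, g' sy vgz vgx hb vy, g' sz vgx vgy hc vz⟩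

end Evaluation

open Classical in
theorem coe_dite_mem {R : Type*} [CommRing R] {T : Subring R} {x : R} (hx : x ∈ T) :
    ((if H : x ∈ T then ⟨x, H⟩ else 0 : T) : R) = x := by
  rw [dif_pos hx]

section Generic

variable {ι : Type u} {K : Type*} [Field K] [Algebra (MvPolynomial ι ℤ) K]

/-- The initial data consist of independent variables, labelled by the given functions. -/
structure IsGeneric (D : HexData K) (ch cx cy cz : ℤ → ℤ → ℤ → ι) : Prop where
  h : ∀ i j k, 0 ≤ i + j + k → i + j + k ≤ 2 →
    D.h i j k = algebraMap (MvPolynomial ι ℤ) K (X (ch i j k))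
  fx : ∀ i j k, i + j + k = 0 → D.fx i j k = algebraMap (MvPolynomial ι ℤ) K (X (cx i j k))
  fy : ∀ i j k, i + j + k = 0 → D.fy i j k = algebraMap (MvPolynomial ι ℤ) K (X (cy i j k))
  fz : ∀ i j k, i + j + k = 0 → D.fz i j k = algebraMap (MvPolynomial ι ℤ) K (X (cz i j k))
  weight : ∀ wh wx wy wz : ℤ → ℤ → ℤ → ℤ, ∃ ω : ι → ℤ,
    (∀ i j k, 0 ≤ i + j + k → i + j + k ≤ 2 → ω (ch i j k) = wh i j k) ∧
    (∀ i j k, i + j + k = 0 → ω (cx i j k) = wx i j k) ∧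
    (∀ i j k, i + j + k = 0 → ω (cy i j k) = wy i j k) ∧
    ∀ i j k, i + j + k = 0 → ω (cz i j k) = wz i j k

variable {D : HexData K} {ch cx cy cz : ℤ → ℤ → ℤ → ι}

theorem IsGeneric.rot (G : D.IsGeneric ch cx cy cz) :
    D.rot.IsGeneric (fun i j k => ch k i j) (fun i j k => cy k i j) (fun i j k => cz k i j)
      (fun i j k => cx k i j) where
  h i j k h0 h1 := G.h k i j (by omega) (by omega)
  fx i j k e := G.fy k i j (by omega)
  fy i j k e := G.fz k i j (by omega)
  fz i j k e := G.fx k i j (by omega)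
  weight wh wx wy wz := by
    obtain ⟨ω, a, b, c, d⟩ := G.weight (fun i j k => wh j k i) (fun i j k => wz j k i)
      (fun i j k => wx j k i) (fun i j k => wy j k i)
    exact ⟨ω, fun i j k h0 h1 => a k i j (by omega) (by omega), fun i j k e => c k i j (by omega),
      fun i j k e => d k i j (by omega), fun i j k e => b k i j (by omega)⟩

theorem IsGeneric.shift (G : D.IsGeneric ch cx cy cz) {a b c : ℤ} (h0 : a + b + c = 0) :
    (D.shift a b c).IsGeneric (fun i j k => ch (i + a) (j + b) (k + c))
      (fun i j k => cx (i + a) (j + b) (k + c)) (fun i j k => cy (i + a) (j + b) (k + c))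
      (fun i j k => cz (i + a) (j + b) (k + c)) where
  h i j k l u := G.h _ _ _ (by omega) (by omega)
  fx i j k e := G.fx _ _ _ (by omega)
  fy i j k e := G.fy _ _ _ (by omega)
  fz i j k e := G.fz _ _ _ (by omega)
  weight wh wx wy wz := by
    obtain ⟨ω, H, Hx, Hy, Hz⟩ := G.weight (fun i j k => wh (i - a) (j - b) (k - c))
      (fun i j k => wx (i - a) (j - b) (k - c)) (fun i j k => wy (i - a) (j - b) (k - c))
      (fun i j k => wz (i - a) (j - b) (k - c))
    simp only [sub_eq_add_neg] at H Hx Hy Hz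
    refine ⟨ω, fun i j k l u => ?_, fun i j k e => ?_, fun i j k e => ?_, fun i j k e => ?_⟩
    · simp [H _ _ _ (by omega : 0 ≤ (i + a) + (j + b) + (k + c)) (by omega)]
    · simp [Hx _ _ _ (by omega : (i + a) + (j + b) + (k + c) = 0)]
    · simp [Hy _ _ _ (by omega : (i + a) + (j + b) + (k + c) = 0)]
    · simp [Hz _ _ _ (by omega : (i + a) + (j + b) + (k + c) = 0)]

variable [IsFractionRing (MvPolynomial ι ℤ) K] {p : MvPolynomial ι ℤ} {N : ℤ}

/-- The value of the data at a point. -/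
noncomputable abbrev eval {E : Type*} [Field E] (D : HexData K) (φ : laurentRing ι K →+* E) :
    HexData E :=
  (D.lift (laurentRing ι K)).map φ

theorem exists_point_of_inv_notMem (hp : Prime p) (hX : ∀ i, ¬ p ∣ X i) (ω : ι → ℤ)
    {x : K} (hx : x ∈ laurentRing ι K) (hbad : x⁻¹ ∉ localRing K hp) {m q : MvPolynomial ι ℤ}
    (hm : m ≠ 0) (hq : q ∈ supported ℤ {i | ω i = 0}) (e : x * algebraMap _ K m = algebraMap _ K q) :
    ∃ (E : Type u) (_ : Field E) (v : Valuation E ℤᵐ⁰) (φ : laurentRing ι K →+* E),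
      φ ⟨algebraMap _ K p, algebraMap_mem_laurentRing p⟩ = 0 ∧
      (∀ i, v (φ ⟨algebraMap _ K (X i), algebraMap_mem_laurentRing _⟩) = WithZero.exp (ω i)) ∧
      (∀ q ∈ supported ℤ {i | ω i = 0},
        φ ⟨algebraMap _ K q, algebraMap_mem_laurentRing q⟩ = 0 ∨
        v (φ ⟨algebraMap _ K q, algebraMap_mem_laurentRing q⟩) = 1) ∧ φ ⟨x, hx⟩ = 0 := by
  have inj := IsFractionRing.injective (MvPolynomial ι ℤ) K
  have hx0 : x ≠ 0 := by
    rintro rfl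
    exact hbad (by rw [inv_zero]; exact zero_mem _)
  have hq0 : q ≠ 0 := by
    rintro rfl
    rw [map_zero, mul_eq_zero, map_eq_zero_iff _ inj] at e
    exact e.elim hx0 hm
  obtain ⟨E, _, v, φ, h1, h2, h3⟩ := exists_valued_point K hp hX
    (mem_supported_of_dvd hq hq0 (dvd_of_inv_notMem hp hbad e)) ω (fun i hi => hi)
  exact ⟨E, _, v, φ, h1, h2, h3, hom_eq_zero_of_inv_notMem φ hp h1 ⟨x, hx⟩ hbad⟩

theorem IsGeneric.exists_faceSeed (G : D.IsGeneric ch cx cy cz) (H : D.IsSol 1)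
    (hT : D.UpTo 1 (· ∈ laurentRing ι K)) (hp : Prime p) (hX : ∀ i, ¬ p ∣ X i)
    (hbad : (D.fx 1 0 0)⁻¹ ∉ localRing K hp) :
    ∃ (E : Type u) (_ : Field E) (v : Valuation E ℤᵐ⁰) (φ : laurentRing ι K →+* E),
      φ ⟨algebraMap _ K p, algebraMap_mem_laurentRing p⟩ = 0 ∧ FaceSeed v (D.eval φ) := by
  let wf : ℤ → ℤ → ℤ → ℤ := fun i j _ => if i = 0 ∧ j = 0 then 0 else 10
  obtain ⟨ω, oh, ox, oy, oz⟩ := G.weight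
    (fun i j k => if i + j + k = 2 ∧ i = 1 ∧ (j = 0 ∨ j = 1) then 1 else 0) wf wf wf
  have sX : ∀ i, ω i = 0 → (X i : MvPolynomial ι ℤ) ∈ supported ℤ {i | ω i = 0} :=
    fun i hi => X_mem_supported.2 hi
  have mh := sX (ch 0 0 0) (oh 0 0 0 (by norm_num) (by norm_num))
  have ma := sX (ch 1 0 0) (oh 1 0 0 (by norm_num) (by norm_num))
  have mb := sX (ch 0 1 0) (oh 0 1 0 (by norm_num) (by norm_num))
  have mc := sX (ch 0 0 1) (oh 0 0 1 (by norm_num) (by norm_num))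
  have mA := sX (ch 0 1 1) (oh 0 1 1 (by norm_num) (by norm_num))
  have mx := sX (cx 0 0 0) (ox 0 0 0 rfl)
  have my := sX (cy 0 0 0) (oy 0 0 0 rfl)
  have mz := sX (cz 0 0 0) (oz 0 0 0 rfl)
  have mq := add_mem (mul_mem mb mc) (mul_mem mh mA)
  have rx := H.relx 0 0 0 le_rfl zero_le_one
  have sx := H.stepfx 0 0 0 le_rfl zero_lt_one
  norm_num only at rx sx
  have gh := G.h 0 0 0 (by norm_num) (by norm_num)
  have ga := G.h 1 0 0 (by norm_num) (by norm_num)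
  have gb := G.h 0 1 0 (by norm_num) (by norm_num)
  have gc := G.h 0 0 1 (by norm_num) (by norm_num)
  have gA := G.h 0 1 1 (by norm_num) (by norm_num)
  have gx := G.fx 0 0 0 rfl
  have gy := G.fy 0 0 0 rfl
  have gz := G.fz 0 0 0 rfl
  obtain ⟨E, _, v, φ, h1, h2, h3, h4⟩ := exists_point_of_inv_notMem hp hX ω
    (hT.fx 1 0 0 (by norm_num) (by norm_num)) hbad
    (m := X (ch 0 0 0) * X (cx 0 0 0))
    (q := X (cx 0 0 0) * X (cy 0 0 0) * X (cz 0 0 0) + X (ch 1 0 0) *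
      (X (ch 0 1 0) * X (ch 0 0 1) + X (ch 0 0 0) * X (ch 0 1 1)))
    (mul_ne_zero (X_ne_zero _) (X_ne_zero _))
    (add_mem (mul_mem (mul_mem mx my) mz) (mul_mem ma mq)) (by
      simp only [map_add, map_mul]
      rw [← gh, ← ga, ← gb, ← gc, ← gA, ← gx, ← gy, ← gz]
      linear_combination D.fx 0 0 0 * sx + D.h 1 0 0 * rx)
  have ev : ∀ {y : laurentRing ι K} {i : ι}, (y : K) = algebraMap (MvPolynomial ι ℤ) K (X i) →
      v (φ y) = WithZero.exp (ω i) := by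
    intro y i e
    rw [← h2 i]
    exact congrArg (fun z => v (φ z)) (Subtype.ext e)
  have lh : ∀ i j k, 0 ≤ i + j + k → i + j + k ≤ 2 →
      v ((D.eval φ).h i j k) = WithZero.exp (ω (ch i j k)) := by
    intro i j k l u
    refine ev ?_
    exact (coe_dite_mem (hT.h i j k l (by omega))).trans (G.h i j k l u)
  refine ⟨E, _, v, φ, h1, ⟨fun i j k e => ?_, fun i j k e => ?_, fun i j k e => ?_,
    fun i j k e => ?_, fun i j k e => ?_, fun i j k e => ?_, ?_⟩⟩
  · refine Eq.trans (ev ?_) (congrArg WithZero.exp (ox i j k e))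
    exact (coe_dite_mem (hT.fx i j k e.ge (by omega))).trans (G.fx i j k e)
  · refine Eq.trans (ev ?_) (congrArg WithZero.exp (oy i j k e))
    exact (coe_dite_mem (hT.fy i j k e.ge (by omega))).trans (G.fy i j k e)
  · refine Eq.trans (ev ?_) (congrArg WithZero.exp (oz i j k e))
    exact (coe_dite_mem (hT.fz i j k e.ge (by omega))).trans (G.fz i j k e)
  · rw [lh i j k (by omega) (by omega), oh i j k (by omega) (by omega)]
    congr 1
    exact if_neg (by omega)
  · rw [lh i j k (by omega) (by omega), oh i j k (by omega) (by omega)]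
    congr 1
    exact if_neg (by omega)
  · rw [lh i j k (by omega) (by omega), oh i j k (by omega) (by omega)]
    simp only [e, true_and]
  · have hx1 : v ((D.eval φ).fx 0 0 0) = 1 := by
      have : v ((D.eval φ).fx 0 0 0) = WithZero.exp (ω (cx 0 0 0)) := by
        refine ev ?_
        exact (coe_dite_mem (hT.fx 0 0 0 (by norm_num) (by norm_num))).trans (G.fx 0 0 0 rfl)
      rw [this, ox 0 0 0 rfl]
      rfl
    have key : (D.eval φ).fx 0 0 0 * (D.eval φ).gx 0 0 0 = φ ⟨algebraMap _ K
        (X (ch 0 1 0) * X (ch 0 0 1) + X (ch 0 0 0) * X (ch 0 1 1)),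
        algebraMap_mem_laurentRing _⟩ := by
      refine (map_mul φ _ _).symm.trans (congrArg φ (Subtype.ext ?_))
      refine (congrArg₂ (· * ·) (coe_dite_mem (hT.fx 0 0 0 (by norm_num) (by norm_num)))
        (coe_dite_mem (hT.gx 0 0 0 (by norm_num) (by norm_num)))).trans ?_
      simp only [map_add, map_mul]
      rw [← gh, ← gb, ← gc, ← gA]
      exact rx
    obtain h | h := h3 _ mq
    · rw [← key, mul_eq_zero] at h
      refine Or.inl (h.resolve_left fun h0 => ?_)
      rw [h0, map_zero] at hx1
      exact zero_ne_one hx1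
    · rw [← key, map_mul, hx1, one_mul] at h
      exact Or.inr h

theorem IsGeneric.exists_seed (G : D.IsGeneric ch cx cy cz) (H : D.IsSol N) (hN : 1 ≤ N)
    (hT : D.UpTo N (· ∈ laurentRing ι K)) (hp : Prime p) (hX : ∀ i, ¬ p ∣ X i)
    (hbad : (D.h 1 1 1)⁻¹ ∉ localRing K hp) :
    ∃ (E : Type u) (_ : Field E) (v : Valuation E ℤᵐ⁰) (φ : laurentRing ι K →+* E),
      φ ⟨algebraMap _ K p, algebraMap_mem_laurentRing p⟩ = 0 ∧ Seed v (D.eval φ) := by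
  let wf : ℤ → ℤ → ℤ → ℤ := fun i j _ => if i = 0 ∧ j = 0 then 0 else 100
  obtain ⟨ω, oh, ox, oy, oz⟩ := G.weight
    (fun i j k => if i + j + k = 1 then (if i = -1 ∧ j = 1 then -3 else
    if i = 1 ∧ j = -1 then -2 else if i = 1 ∧ j = 1 then -1 else 0) else 0) wf wf wf
  have sX : ∀ i, ω i = 0 → (X i : MvPolynomial ι ℤ) ∈ supported ℤ {i | ω i = 0} :=
    fun i hi => X_mem_supported.2 hi
  have mh := sX (ch 0 0 0) (oh 0 0 0 (by norm_num) (by norm_num))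
  have ma := sX (ch 1 0 0) (oh 1 0 0 (by norm_num) (by norm_num))
  have mb := sX (ch 0 1 0) (oh 0 1 0 (by norm_num) (by norm_num))
  have mc := sX (ch 0 0 1) (oh 0 0 1 (by norm_num) (by norm_num))
  have mA := sX (ch 0 1 1) (oh 0 1 1 (by norm_num) (by norm_num))
  have mB := sX (ch 1 0 1) (oh 1 0 1 (by norm_num) (by norm_num))
  have mC := sX (ch 1 1 0) (oh 1 1 0 (by norm_num) (by norm_num))
  have mx := sX (cx 0 0 0) (ox 0 0 0 rfl)
  have my := sX (cy 0 0 0) (oy 0 0 0 rfl)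
  have mz := sX (cz 0 0 0) (oz 0 0 0 rfl)
  have mF := mul_mem (mul_mem mx my) mz
  have mabc := mul_mem (mul_mem ma mb) mc
  have rx := H.relx 0 0 0 le_rfl (by omega)
  have ry := H.rely 0 0 0 le_rfl (by omega)
  have rz := H.relz 0 0 0 le_rfl (by omega)
  have s := H.steph 0 0 0 le_rfl (by omega)
  norm_num only at rx ry rz s
  have gh := G.h 0 0 0 (by norm_num) (by norm_num)
  have ga := G.h 1 0 0 (by norm_num) (by norm_num)
  have gb := G.h 0 1 0 (by norm_num) (by norm_num)
  have gc := G.h 0 0 1 (by norm_num) (by norm_num)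
  have gA := G.h 0 1 1 (by norm_num) (by norm_num)
  have gB := G.h 1 0 1 (by norm_num) (by norm_num)
  have gC := G.h 1 1 0 (by norm_num) (by norm_num)
  have gx := G.fx 0 0 0 rfl
  have gy := G.fy 0 0 0 rfl
  have gz := G.fz 0 0 0 rfl
  obtain ⟨E, _, v, φ, h1, h2, h3, h4⟩ := exists_point_of_inv_notMem hp hX ω
    (hT.h 1 1 1 (by norm_num) (by omega)) hbad
    (m := X (ch 0 0 0) * X (ch 0 0 0) * (X (cx 0 0 0) * X (cy 0 0 0) * X (cz 0 0 0)))
    (q := X (cx 0 0 0) * X (cy 0 0 0) * X (cz 0 0 0) *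
      (X (cx 0 0 0) * X (cy 0 0 0) * X (cz 0 0 0) +
      (X (ch 1 0 0) * X (ch 0 1 0) * X (ch 0 0 1) + X (ch 1 0 0) * X (ch 0 1 0) * X (ch 0 0 1)) +
      X (ch 0 0 0) * (X (ch 1 0 0) * X (ch 0 1 1) + X (ch 0 1 0) * X (ch 1 0 1) +
        X (ch 0 0 1) * X (ch 1 1 0))) +
      (X (ch 0 1 0) * X (ch 0 0 1) + X (ch 0 0 0) * X (ch 0 1 1)) *
      (X (ch 0 0 1) * X (ch 1 0 0) + X (ch 0 0 0) * X (ch 1 0 1)) *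
      (X (ch 1 0 0) * X (ch 0 1 0) + X (ch 0 0 0) * X (ch 1 1 0)))
    (mul_ne_zero (mul_ne_zero (X_ne_zero _) (X_ne_zero _))
      (mul_ne_zero (mul_ne_zero (X_ne_zero _) (X_ne_zero _)) (X_ne_zero _)))
    (add_mem (mul_mem mF (add_mem (add_mem mF (add_mem mabc mabc)) (mul_mem mh
      (add_mem (add_mem (mul_mem ma mA) (mul_mem mb mB)) (mul_mem mc mC)))))
      (mul_mem (mul_mem (add_mem (mul_mem mb mc) (mul_mem mh mA))
        (add_mem (mul_mem mc ma) (mul_mem mh mB))) (add_mem (mul_mem ma mb) (mul_mem mh mC)))) (by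
      simp only [map_add, map_mul]
      rw [← gh, ← ga, ← gb, ← gc, ← gA, ← gB, ← gC, ← gx, ← gy, ← gz, ← rx, ← ry, ← rz]
      linear_combination D.fx 0 0 0 * D.fy 0 0 0 * D.fz 0 0 0 * s)
  have ev : ∀ {y : laurentRing ι K} {i : ι}, (y : K) = algebraMap (MvPolynomial ι ℤ) K (X i) →
      v (φ y) = WithZero.exp (ω i) := by
    intro y i e
    rw [← h2 i]
    exact congrArg (fun z => v (φ z)) (Subtype.ext e)
  have lh : ∀ i j k, 0 ≤ i + j + k → i + j + k ≤ 2 →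
      v ((D.eval φ).h i j k) = WithZero.exp (ω (ch i j k)) := by
    intro i j k l u
    refine ev ?_
    exact (coe_dite_mem (hT.h i j k l (by omega))).trans (G.h i j k l u)
  refine ⟨E, _, v, φ, h1, ⟨fun i j k e => ?_, fun i j k e => ?_, fun i j k e => ?_,
    fun i j k e => ?_, fun i j k e => ?_, fun i j k e => ?_, ?_⟩⟩
  · refine Eq.trans (ev ?_) (congrArg WithZero.exp (ox i j k e))
    exact (coe_dite_mem (hT.fx i j k e.ge (by omega))).trans (G.fx i j k e)
  · refine Eq.trans (ev ?_) (congrArg WithZero.exp (oy i j k e))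
    exact (coe_dite_mem (hT.fy i j k e.ge (by omega))).trans (G.fy i j k e)
  · refine Eq.trans (ev ?_) (congrArg WithZero.exp (oz i j k e))
    exact (coe_dite_mem (hT.fz i j k e.ge (by omega))).trans (G.fz i j k e)
  · rw [lh i j k (by omega) (by omega), oh i j k (by omega) (by omega), if_neg (by omega)]
  · rw [lh i j k (by omega) (by omega), oh i j k (by omega) (by omega), if_pos e]
  · rw [lh i j k (by omega) (by omega), oh i j k (by omega) (by omega), if_neg (by omega)]
  · refine Eq.trans (congrArg φ ?_) h4
    exact dif_pos (hT.h 1 1 1 (by norm_num) (by omega))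

end Generic

end HexData

namespace HexData

open scoped WithZero

open MvPolynomial

theorem UpTo.shift {R : Type*} {D : HexData R} {N : ℤ} {P : R → Prop} (H : D.UpTo N P)
    {a b c : ℤ} (e : a + b + c = 0) : (D.shift a b c).UpTo N P where
  h i j k h0 h1 := H.h _ _ _ (by omega) (by omega)
  fx i j k h0 h1 := H.fx _ _ _ (by omega) (by omega)
  fy i j k h0 h1 := H.fy _ _ _ (by omega) (by omega)
  fz i j k h0 h1 := H.fz _ _ _ (by omega) (by omega)
  gx i j k h0 h1 := H.gx _ _ _ (by omega) (by omega)
  gy i j k h0 h1 := H.gy _ _ _ (by omega) (by omega)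
  gz i j k h0 h1 := H.gz _ _ _ (by omega) (by omega)

variable {ι : Type u} {K : Type*} [Field K] [Algebra (MvPolynomial ι ℤ) K]
  [IsFractionRing (MvPolynomial ι ℤ) K]

variable (K) in
theorem inv_algebraMap_mem_laurentRing {m : MvPolynomial ι ℤ} (hm : m ∈ varMonoid ι) :
    (algebraMap (MvPolynomial ι ℤ) K m)⁻¹ ∈ laurentRing ι K := by
  refine mem_laurentRing.2 ⟨1, m, hm, ?_⟩
  rw [map_one]
  refine inv_mul_cancel₀ ?_
  exact (map_ne_zero_iff _ (IsFractionRing.injective (MvPolynomial ι ℤ) K)).2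
    (nonZeroDivisors.ne_zero (varMonoid_le ι hm))

theorem X_mem_varMonoid (i : ι) : (X i : MvPolynomial ι ℤ) ∈ varMonoid ι :=
  Submonoid.subset_closure ⟨i, rfl⟩

theorem algebraMap_X_ne_zero (i : ι) : algebraMap (MvPolynomial ι ℤ) K (X i) ≠ 0 :=
  (map_ne_zero_iff _ (IsFractionRing.injective (MvPolynomial ι ℤ) K)).2 (X_ne_zero i)

variable {D : HexData K} {ch cx cy cz : ℤ → ℤ → ℤ → ι} {p : MvPolynomial ι ℤ}

theorem lift_ne_zero {T : Subring K} {x : T} (h : (x : K) ≠ 0) : x ≠ 0 :=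
  fun e => h (congrArg Subtype.val e)

theorem IsSol.exists_psi (H : D.IsSol 3) (hD : ∀ i j k, 0 ≤ i + j + k → i + j + k ≤ 2 →
      D.h i j k = algebraMap (MvPolynomial ι ℤ) K (X (ch i j k)))
    (hT : D.UpTo 3 (· ∈ laurentRing ι K)) {E : Type*} [Field E] (v : Valuation E ℤᵐ⁰)
    (φ : laurentRing ι K →+* E) :
    ∃ θ : laurentRing ι K, ((D.lift (laurentRing ι K)).fx 1 1 1 *
      (D.lift (laurentRing ι K)).fy 1 1 1 * (D.lift (laurentRing ι K)).fz 1 1 1 +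
      (D.lift (laurentRing ι K)).h 2 1 1 * (D.lift (laurentRing ι K)).h 1 2 1 *
      (D.lift (laurentRing ι K)).h 1 1 2 = (D.lift (laurentRing ι K)).h 1 1 1 * θ) ∧
      ((∀ i j k, i + j + k = 2 → v (φ ((D.lift (laurentRing ι K)).h i j k)) = 1) →
        ValLE v (φ (D.lift (laurentRing ι K)).psi) 1200 → ValLE v (φ θ) 1200) := by
  set D' := D.lift (laurentRing ι K) with hD'
  have cH : ∀ i j k, 0 ≤ i + j + k → i + j + k ≤ 2 → (D'.h i j k : K) = D.h i j k :=
    fun i j k l u => coe_dite_mem (hT.h i j k l (by omega))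
  have nz : ∀ i j k, 0 ≤ i + j + k → i + j + k ≤ 2 → D'.h i j k ≠ 0 := fun i j k l u =>
    lift_ne_zero (by rw [cH i j k l u, hD i j k l u]; exact algebraMap_X_ne_zero _)
  have e := (H.lift hT).psi_eq le_rfl (nz 0 0 0 (by norm_num) (by norm_num))
    (nz 1 0 0 (by norm_num) (by norm_num)) (nz 0 1 0 (by norm_num) (by norm_num))
    (nz 0 0 1 (by norm_num) (by norm_num))
  have unit : ∀ i j k, 0 ≤ i + j + k → i + j + k ≤ 2 → ∃ w, D'.h i j k * w = 1 := by
    intro i j k l u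
    refine ⟨⟨_, inv_algebraMap_mem_laurentRing K (X_mem_varMonoid (ch i j k))⟩,
      Subtype.ext ?_⟩
    rw [Subring.coe_mul, cH i j k l u, hD i j k l u]
    exact mul_inv_cancel₀ (algebraMap_X_ne_zero _)
  obtain ⟨w₁, e₁⟩ := unit 0 1 1 (by norm_num) (by norm_num)
  obtain ⟨w₂, e₂⟩ := unit 1 0 1 (by norm_num) (by norm_num)
  obtain ⟨w₃, e₃⟩ := unit 1 1 0 (by norm_num) (by norm_num)
  have e' : D'.h 0 1 1 * D'.h 1 0 1 * D'.h 1 1 0 * (w₁ * w₂ * w₃) = 1 := by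
    linear_combination e₁ * (D'.h 1 0 1 * w₂) * (D'.h 1 1 0 * w₃) + e₂ * (D'.h 1 1 0 * w₃) + e₃
  refine ⟨D'.psi * (w₁ * w₂ * w₃), ?_, fun hv hψ => ?_⟩
  · linear_combination (w₁ * w₂ * w₃) * e - (D'.fx 1 1 1 * D'.fy 1 1 1 * D'.fz 1 1 1 +
      D'.h 2 1 1 * D'.h 1 2 1 * D'.h 1 1 2) * e'
  · have := congrArg (fun z => v (φ z)) e'
    simp only [map_mul, map_one, hv _ _ _ (show (0:ℤ) + 1 + 1 = 2 from rfl),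
      hv _ _ _ (show (1:ℤ) + 0 + 1 = 2 from rfl), hv _ _ _ (show (1:ℤ) + 1 + 0 = 2 from rfl),
      one_mul] at this
    rw [ValLE]
    simp only [map_mul, this, mul_one]
    exact hψ

theorem IsGeneric.special (G : D.IsGeneric ch cx cy cz) (H : D.IsSol 4)
    (hT : D.UpTo 3 (· ∈ laurentRing ι K)) (hp : Prime p) (hX : ∀ i, ¬ p ∣ X i)
    (hbad : (D.h 1 1 1)⁻¹ ∉ localRing K hp) :
    (D.h 2 2 2 ∈ localRing K hp ∧ D.fx 2 1 1 ∈ localRing K hp ∧ D.fy 1 2 1 ∈ localRing K hp ∧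
      D.fz 1 1 2 ∈ localRing K hp ∧ D.gx 2 1 1 ∈ localRing K hp ∧ D.gy 1 2 1 ∈ localRing K hp ∧
      D.gz 1 1 2 ∈ localRing K hp) ∧ (D.h 2 2 2)⁻¹ ∈ localRing K hp ∧
      (D.fx 2 1 1)⁻¹ ∈ localRing K hp ∧ (D.fy 1 2 1)⁻¹ ∈ localRing K hp ∧
      (D.fz 1 1 2)⁻¹ ∈ localRing K hp := by
  have H3 : D.IsSol 3 := H.mono (by norm_num)
  obtain ⟨E, _, v, φ, hφ, S⟩ := G.exists_seed H3 (by norm_num) hT hp hX hbad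
  have HL := H3.lift hT
  have HE : (D.eval φ).IsSol 3 := HL.map φ
  obtain ⟨θ, eθ, vθ⟩ := H3.exists_psi G.h hT v φ
  obtain ⟨ϑ, eϑ, -⟩ := H3.swap.exists_psi (ch := ch) G.h hT.swap v φ
  have cH : ∀ i j k, 0 ≤ i + j + k → i + j + k ≤ 5 →
      ((D.lift (laurentRing ι K)).h i j k : K) = D.h i j k :=
    fun i j k l u => coe_dite_mem (hT.h i j k l u)
  have cx : (((D.lift (laurentRing ι K)).fx 1 1 1 : laurentRing ι K) : K) = D.fx 1 1 1 :=
    coe_dite_mem (hT.fx 1 1 1 (by norm_num) (by norm_num))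
  have cy : (((D.lift (laurentRing ι K)).fy 1 1 1 : laurentRing ι K) : K) = D.fy 1 1 1 :=
    coe_dite_mem (hT.fy 1 1 1 (by norm_num) (by norm_num))
  have cz : (((D.lift (laurentRing ι K)).fz 1 1 1 : laurentRing ι K) : K) = D.fz 1 1 1 :=
    coe_dite_mem (hT.fz 1 1 1 (by norm_num) (by norm_num))
  have dx : (((D.lift (laurentRing ι K)).gx 1 1 1 : laurentRing ι K) : K) = D.gx 1 1 1 :=
    coe_dite_mem (hT.gx 1 1 1 (by norm_num) (by norm_num))
  have dy : (((D.lift (laurentRing ι K)).gy 1 1 1 : laurentRing ι K) : K) = D.gy 1 1 1 :=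
    coe_dite_mem (hT.gy 1 1 1 (by norm_num) (by norm_num))
  have dz : (((D.lift (laurentRing ι K)).gz 1 1 1 : laurentRing ι K) : K) = D.gz 1 1 1 :=
    coe_dite_mem (hT.gz 1 1 1 (by norm_num) (by norm_num))
  have hu := cH 1 1 1 (by norm_num) (by norm_num)
  have ha := cH 2 1 1 (by norm_num) (by norm_num)
  have hb := cH 1 2 1 (by norm_num) (by norm_num)
  have hc := cH 1 1 2 (by norm_num) (by norm_num)
  have hA := cH 1 2 2 (by norm_num) (by norm_num)
  have hB := cH 2 1 2 (by norm_num) (by norm_num)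
  have hC := cH 2 2 1 (by norm_num) (by norm_num)
  have hε : (D.lift (laurentRing ι K)).h 1 1 1 ≠ 0 := by
    refine lift_ne_zero fun e => hbad ?_
    rw [← hu, e, inv_zero]
    exact zero_mem _
  refine special_cube (laurentRing_le_localRing hp hX) (φ := φ) (v := v)
    (fun x hx => by_contra fun hn => hx (hom_eq_zero_of_inv_notMem φ hp hφ x hn)) hε S.hu
    (S.h4 HE (by norm_num) 2 1 1 rfl) (S.h4 HE (by norm_num) 1 2 1 rfl)
    (S.h4 HE (by norm_num) 1 1 2 rfl) (S.h5 HE le_rfl 1 2 2 rfl) (S.h5 HE le_rfl 2 1 2 rfl)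
    (S.h5 HE le_rfl 2 2 1 rfl) (vθ (fun i j k e => S.h2 i j k e) ?_)
    (HL.relx 1 1 1 (by norm_num) (by norm_num)) (HL.rely 1 1 1 (by norm_num) (by norm_num))
    (HL.relz 1 1 1 (by norm_num) (by norm_num)) eθ eϑ ?_ ?_ ?_ ?_ ?_ ?_ ?_
  · rw [map_psi]
    exact S.psi_le HE
  · rw [hu, ha, cy, cz, dx]
    exact H.stepfx 1 1 1 (by norm_num) (by norm_num)
  · rw [hu, hb, cx, cz, dy]
    exact H.stepfy 1 1 1 (by norm_num) (by norm_num)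
  · rw [hu, hc, cx, cy, dz]
    exact H.stepfz 1 1 1 (by norm_num) (by norm_num)
  · rw [hu, ha, dy, dz, cx]
    exact H.stepgx 1 1 1 (by norm_num) (by norm_num)
  · rw [hu, hb, dx, dz, cy]
    exact H.stepgy 1 1 1 (by norm_num) (by norm_num)
  · rw [hu, hc, dx, dy, cz]
    exact H.stepgz 1 1 1 (by norm_num) (by norm_num)
  · rw [hu, ha, hb, hc, hA, hB, hC, cx, cy, cz, dx, dy, dz]
    exact H.steph 1 1 1 (by norm_num) (by norm_num)

end HexData

namespace HexData

open scoped WithZero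

open MvPolynomial

theorem UpTo.of_shift {R : Type*} {D : HexData R} {a M N : ℤ} {P : R → Prop}
    (hE : (D.shift a 0 0).UpTo (N - a) P) (hD : D.UpTo M P) (hM : a ≤ M + 1) : D.UpTo N P where
  h i j k l u := by
    rcases lt_or_ge (i + j + k) a with hl | hl
    · exact hD.h i j k l (by omega)
    · simpa [HexData.shift] using hE.h (i - a) j k (by omega) (by omega)
  fx i j k l u := by
    rcases lt_or_ge (i + j + k) a with hl | hl
    · exact hD.fx i j k l (by omega)
    · simpa [HexData.shift] using hE.fx (i - a) j k (by omega) (by omega)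
  fy i j k l u := by
    rcases lt_or_ge (i + j + k) a with hl | hl
    · exact hD.fy i j k l (by omega)
    · simpa [HexData.shift] using hE.fy (i - a) j k (by omega) (by omega)
  fz i j k l u := by
    rcases lt_or_ge (i + j + k) a with hl | hl
    · exact hD.fz i j k l (by omega)
    · simpa [HexData.shift] using hE.fz (i - a) j k (by omega) (by omega)
  gx i j k l u := by
    rcases lt_or_ge (i + j + k) a with hl | hl
    · exact hD.gx i j k l (by omega)
    · simpa [HexData.shift] using hE.gx (i - a) j k (by omega) (by omega)
  gy i j k l u := by
    rcases lt_or_ge (i + j + k) a with hl | hl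
    · exact hD.gy i j k l (by omega)
    · simpa [HexData.shift] using hE.gy (i - a) j k (by omega) (by omega)
  gz i j k l u := by
    rcases lt_or_ge (i + j + k) a with hl | hl
    · exact hD.gz i j k l (by omega)
    · simpa [HexData.shift] using hE.gz (i - a) j k (by omega) (by omega)

variable {ι : Type u} {K : Type*} [Field K] [Algebra (MvPolynomial ι ℤ) K]
  [IsFractionRing (MvPolynomial ι ℤ) K]
  {D : HexData K} {ch cx cy cz : ℤ → ℤ → ℤ → ι} {p : MvPolynomial ι ℤ}

theorem upTo_laurentRing_of_forall_prime {N : ℤ} (H : ∀ p : MvPolynomial ι ℤ, ∀ hp : Prime p,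
    (∀ i, ¬ p ∣ X i) → D.UpTo N (· ∈ localRing K hp)) : D.UpTo N (· ∈ laurentRing ι K) where
  h i j k l u := mem_laurentRing_of_forall_prime fun p hp hX => (H p hp hX).h i j k l u
  fx i j k l u := mem_laurentRing_of_forall_prime fun p hp hX => (H p hp hX).fx i j k l u
  fy i j k l u := mem_laurentRing_of_forall_prime fun p hp hX => (H p hp hX).fy i j k l u
  fz i j k l u := mem_laurentRing_of_forall_prime fun p hp hX => (H p hp hX).fz i j k l u
  gx i j k l u := mem_laurentRing_of_forall_prime fun p hp hX => (H p hp hX).gx i j k l u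
  gy i j k l u := mem_laurentRing_of_forall_prime fun p hp hX => (H p hp hX).gy i j k l u
  gz i j k l u := mem_laurentRing_of_forall_prime fun p hp hX => (H p hp hX).gz i j k l u

theorem IsGeneric.upTo_three (G : D.IsGeneric ch cx cy cz) (H : D.IsSol 3) :
    D.UpTo 3 (· ∈ laurentRing ι K) := by
  have mem : ∀ {x : K} {i : ι}, x = algebraMap (MvPolynomial ι ℤ) K (X i) →
      x ∈ laurentRing ι K := fun e => e ▸ algebraMap_mem_laurentRing _
  have div : ∀ {x : K} {i : ι}, x = algebraMap (MvPolynomial ι ℤ) K (X i) →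
      ∀ y, x * y ∈ laurentRing ι K → y ∈ laurentRing ι K := by
    rintro x i rfl y hy
    rw [← inv_mul_cancel_left₀ (algebraMap_X_ne_zero (K := K) i) y]
    exact mul_mem (inv_algebraMap_mem_laurentRing K (X_mem_varMonoid i)) hy
  exact IsSol.upTo_mem (N := 3) H (laurentRing ι K) (fun i j k l u => mem (G.h i j k l u))
    (fun i j k e => mem (G.fx i j k e)) (fun i j k e => mem (G.fy i j k e))
    (fun i j k e => mem (G.fz i j k e)) (fun i j k e => div (G.fx i j k e))
    (fun i j k e => div (G.fy i j k e)) (fun i j k e => div (G.fz i j k e))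
    fun i j k l u y hy => div (G.h i j k l (by push_cast at u; omega)) y (mul_comm y _ ▸ hy)

theorem IsGeneric.special_shift (G : D.IsGeneric ch cx cy cz) (H : D.IsSol 4)
    (hT : D.UpTo 3 (· ∈ laurentRing ι K)) (hp : Prime p) (hX : ∀ i, ¬ p ∣ X i) {i j k : ℤ}
    (e : i + j + k = 3) (hbad : (D.h i j k)⁻¹ ∉ localRing K hp) :
    (D.h (i + 1) (j + 1) (k + 1) ∈ localRing K hp ∧ D.fx (i + 1) j k ∈ localRing K hp ∧
      D.fy i (j + 1) k ∈ localRing K hp ∧ D.fz i j (k + 1) ∈ localRing K hp ∧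
      D.gx (i + 1) j k ∈ localRing K hp ∧ D.gy i (j + 1) k ∈ localRing K hp ∧
      D.gz i j (k + 1) ∈ localRing K hp) ∧ (D.h (i + 1) (j + 1) (k + 1))⁻¹ ∈ localRing K hp ∧
      (D.fx (i + 1) j k)⁻¹ ∈ localRing K hp ∧ (D.fy i (j + 1) k)⁻¹ ∈ localRing K hp ∧
      (D.fz i j (k + 1))⁻¹ ∈ localRing K hp := by
  have e0 : i - 1 + (j - 1) + (k - 1) = 0 := by omega
  have := (G.shift e0).special (H.shift e0.ge (by omega)) (hT.shift e0) hp hX (by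
    simpa only [HexData.shift, add_sub_cancel] using hbad)
  simpa only [HexData.shift, add_sub_cancel, show ∀ n : ℤ, 2 + (n - 1) = n + 1 by intro n; ring]
    using this

theorem IsGeneric.upTo_four (G : D.IsGeneric ch cx cy cz) (H : D.IsSol 4)
    (hne : ∀ i j k, 0 ≤ i + j + k → D.h i j k ≠ 0) : D.UpTo 4 (· ∈ laurentRing ι K) := by
  have hT := G.upTo_three (H.mono (by norm_num))
  refine upTo_laurentRing_of_forall_prime fun p hp hX => ?_
  have hO : D.UpTo 3 (· ∈ localRing K hp) := hT.imp fun x hx => laurentRing_le_localRing hp hX hx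
  have div : ∀ {x h y : K}, x * h = y → h ≠ 0 → h⁻¹ ∈ localRing K hp → y ∈ localRing K hp →
      x ∈ localRing K hp := by
    rintro x h _ rfl h0 hi hy
    rw [← mul_inv_cancel_right₀ h0 x]
    exact mul_mem hy hi
  have cube : ∀ i j k, i + j + k = 3 → (D.h (i + 1) (j + 1) (k + 1) ∈ localRing K hp ∧
      D.fx (i + 1) j k ∈ localRing K hp ∧ D.fy i (j + 1) k ∈ localRing K hp ∧
      D.fz i j (k + 1) ∈ localRing K hp ∧ D.gx (i + 1) j k ∈ localRing K hp ∧
      D.gy i (j + 1) k ∈ localRing K hp ∧ D.gz i j (k + 1) ∈ localRing K hp) := by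
    intro i j k e
    by_cases hb : (D.h i j k)⁻¹ ∈ localRing K hp
    · have h0 := hne i j k (by omega)
      have mx := hO.fx i j k (by omega) (by omega)
      have my := hO.fy i j k (by omega) (by omega)
      have mz := hO.fz i j k (by omega) (by omega)
      have nx := hO.gx i j k (by omega) (by omega)
      have ny := hO.gy i j k (by omega) (by omega)
      have nz := hO.gz i j k (by omega) (by omega)
      have hh := hO.h i j k (by omega) (by omega)
      have ha := hO.h (i + 1) j k (by omega) (by omega)
      have hb' := hO.h i (j + 1) k (by omega) (by omega)
      have hc := hO.h i j (k + 1) (by omega) (by omega)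
      have hA := hO.h i (j + 1) (k + 1) (by omega) (by omega)
      have hB := hO.h (i + 1) j (k + 1) (by omega) (by omega)
      have hC := hO.h (i + 1) (j + 1) k (by omega) (by omega)
      have habc := mul_mem (mul_mem ha hb') hc
      refine ⟨div (H.steph i j k (by omega) (by omega)) (pow_ne_zero 2 h0)
          (inv_pow (D.h i j k) 2 ▸ pow_mem hb 2) ?_,
        div (H.stepfx i j k (by omega) (by omega)) h0 hb (add_mem (mul_mem my mz) (mul_mem ha nx)),
        div (H.stepfy i j k (by omega) (by omega)) h0 hb (add_mem (mul_mem mz mx) (mul_mem hb' ny)),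
        div (H.stepfz i j k (by omega) (by omega)) h0 hb (add_mem (mul_mem mx my) (mul_mem hc nz)),
        div (H.stepgx i j k (by omega) (by omega)) h0 hb (add_mem (mul_mem ny nz) (mul_mem ha mx)),
        div (H.stepgy i j k (by omega) (by omega)) h0 hb (add_mem (mul_mem nz nx) (mul_mem hb' my)),
        div (H.stepgz i j k (by omega) (by omega)) h0 hb (add_mem (mul_mem nx ny) (mul_mem hc mz))⟩
      rw [two_mul]
      exact add_mem (add_mem (add_mem (mul_mem (mul_mem mx my) mz) (mul_mem (mul_mem nx ny) nz))
        (add_mem habc habc)) (mul_mem hh (add_mem (add_mem (mul_mem ha hA) (mul_mem hb' hB))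
        (mul_mem hc hC)))
    · exact (G.special_shift H hT hp hX e hb).1
  constructor <;> intro i j k l u
  · rcases lt_or_ge (i + j + k) 6 with hl | hl
    · exact hO.h i j k l (by omega)
    · simpa only [sub_add_cancel] using (cube (i - 1) (j - 1) (k - 1) (by omega)).1
  · rcases lt_or_ge (i + j + k) 4 with hl | hl
    · exact hO.fx i j k l (by omega)
    · simpa only [sub_add_cancel] using (cube (i - 1) j k (by omega)).2.1
  · rcases lt_or_ge (i + j + k) 4 with hl | hl
    · exact hO.fy i j k l (by omega)
    · simpa only [sub_add_cancel] using (cube i (j - 1) k (by omega)).2.2.1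
  · rcases lt_or_ge (i + j + k) 4 with hl | hl
    · exact hO.fz i j k l (by omega)
    · simpa only [sub_add_cancel] using (cube i j (k - 1) (by omega)).2.2.2.1
  · rcases lt_or_ge (i + j + k) 4 with hl | hl
    · exact hO.gx i j k l (by omega)
    · simpa only [sub_add_cancel] using (cube (i - 1) j k (by omega)).2.2.2.2.1
  · rcases lt_or_ge (i + j + k) 4 with hl | hl
    · exact hO.gy i j k l (by omega)
    · simpa only [sub_add_cancel] using (cube i (j - 1) k (by omega)).2.2.2.2.2.1
  · rcases lt_or_ge (i + j + k) 4 with hl | hl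
    · exact hO.gz i j k l (by omega)
    · simpa only [sub_add_cancel] using (cube i j (k - 1) (by omega)).2.2.2.2.2.2

end HexData

namespace HexData

open scoped WithZero

open MvPolynomial

variable {ι : Type u} {K : Type*} [Field K] [Algebra (MvPolynomial ι ℤ) K]
  [IsFractionRing (MvPolynomial ι ℤ) K]
  {D : HexData K} {ch cx cy cz : ℤ → ℤ → ℤ → ι} {p : MvPolynomial ι ℤ}

open Classical in
theorem inv_mem_of_hom_ne_zero {E : Type*} [Field E] {φ : laurentRing ι K →+* E} {hp : Prime p}
    (hφ : φ ⟨algebraMap _ K p, algebraMap_mem_laurentRing p⟩ = 0) {x : K}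
    (hx : x ∈ laurentRing ι K)
    (hn : φ (if H : x ∈ laurentRing ι K then ⟨x, H⟩ else 0) ≠ 0) : x⁻¹ ∈ localRing K hp := by
  rw [dif_pos hx] at hn
  exact by_contra fun h => hn (hom_eq_zero_of_inv_notMem φ hp hφ _ h)

open Classical in
theorem ne_zero_and_inv_mem_of_hom_ne_zero {E : Type*} [Field E] {φ : laurentRing ι K →+* E}
    {hp : Prime p} (hφ : φ ⟨algebraMap _ K p, algebraMap_mem_laurentRing p⟩ = 0) {x : K}
    (hx : x ∈ laurentRing ι K)
    (hn : φ (if H : x ∈ laurentRing ι K then ⟨x, H⟩ else 0) ≠ 0) :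
    x ≠ 0 ∧ x⁻¹ ∈ localRing K hp := by
  refine ⟨?_, inv_mem_of_hom_ne_zero hφ hx hn⟩
  rintro rfl
  rw [dif_pos hx] at hn
  exact hn (map_zero φ)

theorem IsGeneric.inv_mem_of_vertex (G : D.IsGeneric ch cx cy cz) (H : D.IsSol 4)
    (hT : D.UpTo 4 (· ∈ laurentRing ι K)) (hp : Prime p) (hX : ∀ i, ¬ p ∣ X i)
    (hbad : (D.h 1 1 1)⁻¹ ∉ localRing K hp) :
    (∀ i j k, 4 ≤ i + j + k → i + j + k ≤ 6 → (D.h i j k)⁻¹ ∈ localRing K hp) ∧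
    (∀ i j k, i + j + k = 4 → (D.fx i j k)⁻¹ ∈ localRing K hp) ∧
    (∀ i j k, i + j + k = 4 → (D.fy i j k)⁻¹ ∈ localRing K hp) ∧
    ∀ i j k, i + j + k = 4 → (D.fz i j k)⁻¹ ∈ localRing K hp := by
  obtain ⟨-, sh, sx, sy, sz⟩ := G.special H (hT.mono (by norm_num)) hp hX hbad
  obtain ⟨E, _, v, φ, hφ, S⟩ := G.exists_seed H (by norm_num) hT hp hX hbad
  have HE : (D.eval φ).IsSol 4 := (H.lift hT).map φ
  refine ⟨fun i j k l u => ?_, fun i j k e => ?_, fun i j k e => ?_, fun i j k e => ?_⟩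
  · by_cases hs : i = 2 ∧ j = 2 ∧ k = 2
    · obtain ⟨rfl, rfl, rfl⟩ := hs
      exact sh
    refine inv_mem_of_hom_ne_zero hφ (hT.h i j k (by omega) (by omega)) ?_
    obtain e | e | e : i + j + k = 4 ∨ i + j + k = 5 ∨ i + j + k = 6 := by omega
    · exact (S.h4 HE (by norm_num) i j k e).ne_zero
    · exact (S.h5 HE (by norm_num) i j k e).ne_zero
    · have := S.h6 HE le_rfl (i - 1) (j - 1) (k - 1) (by omega) (by omega)
      simp only [sub_add_cancel] at this
      exact this
  · by_cases hs : i = 2 ∧ j = 1 ∧ k = 1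
    · obtain ⟨rfl, rfl, rfl⟩ := hs
      exact sx
    have := S.fx4 HE le_rfl (i - 1) j k (by omega) (by omega)
    simp only [sub_add_cancel] at this
    exact inv_mem_of_hom_ne_zero hφ (hT.fx i j k (by omega) (by omega)) this
  · by_cases hs : i = 1 ∧ j = 2 ∧ k = 1
    · obtain ⟨rfl, rfl, rfl⟩ := hs
      exact sy
    have := S.fy4 HE le_rfl i (j - 1) k (by omega) (by omega)
    simp only [sub_add_cancel] at this
    exact inv_mem_of_hom_ne_zero hφ (hT.fy i j k (by omega) (by omega)) this
  · by_cases hs : i = 1 ∧ j = 1 ∧ k = 2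
    · obtain ⟨rfl, rfl, rfl⟩ := hs
      exact sz
    have := S.fz4 HE le_rfl i j (k - 1) (by omega) (by omega)
    simp only [sub_add_cancel] at this
    exact inv_mem_of_hom_ne_zero hφ (hT.fz i j k (by omega) (by omega)) this

theorem IsGeneric.inv_mem_of_vertex_shift (G : D.IsGeneric ch cx cy cz) (H : D.IsSol 4)
    (hT : D.UpTo 4 (· ∈ laurentRing ι K)) (hp : Prime p) (hX : ∀ i, ¬ p ∣ X i) {a b c : ℤ}
    (e : a + b + c = 3) (hbad : (D.h a b c)⁻¹ ∉ localRing K hp) :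
    (∀ i j k, 4 ≤ i + j + k → i + j + k ≤ 6 → (D.h i j k)⁻¹ ∈ localRing K hp) ∧
    (∀ i j k, i + j + k = 4 → (D.fx i j k)⁻¹ ∈ localRing K hp) ∧
    (∀ i j k, i + j + k = 4 → (D.fy i j k)⁻¹ ∈ localRing K hp) ∧
    ∀ i j k, i + j + k = 4 → (D.fz i j k)⁻¹ ∈ localRing K hp := by
  have e0 : a - 1 + (b - 1) + (c - 1) = 0 := by omega
  obtain ⟨ih, ix, iy, iz⟩ := (G.shift e0).inv_mem_of_vertex (H.shift e0.ge (by omega))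
    (hT.shift e0) hp hX (by simpa only [HexData.shift, add_sub_cancel] using hbad)
  refine ⟨fun i j k l u => ?_, fun i j k e => ?_, fun i j k e => ?_, fun i j k e => ?_⟩
  · simpa only [HexData.shift, sub_add_cancel] using
      ih (i - (a - 1)) (j - (b - 1)) (k - (c - 1)) (by omega) (by omega)
  · simpa only [HexData.shift, sub_add_cancel] using
      ix (i - (a - 1)) (j - (b - 1)) (k - (c - 1)) (by omega)
  · simpa only [HexData.shift, sub_add_cancel] using
      iy (i - (a - 1)) (j - (b - 1)) (k - (c - 1)) (by omega)
  · simpa only [HexData.shift, sub_add_cancel] using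
      iz (i - (a - 1)) (j - (b - 1)) (k - (c - 1)) (by omega)

theorem IsGeneric.inv_mem_of_face (G : D.IsGeneric ch cx cy cz) (H : D.IsSol 1)
    (hT : D.UpTo 1 (· ∈ laurentRing ι K)) (hp : Prime p) (hX : ∀ i, ¬ p ∣ X i) {a b c : ℤ}
    (e : a + b + c = 1) (hbad : (D.fx a b c)⁻¹ ∉ localRing K hp) :
    (∀ i j k, i + j + k = 1 → D.gx i j k ≠ 0 ∧ (D.gx i j k)⁻¹ ∈ localRing K hp) ∧
    (∀ i j k, i + j + k = 1 → D.gy i j k ≠ 0 ∧ (D.gy i j k)⁻¹ ∈ localRing K hp) ∧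
    ∀ i j k, i + j + k = 1 → D.gz i j k ≠ 0 ∧ (D.gz i j k)⁻¹ ∈ localRing K hp := by
  have e0 : a - 1 + b + c = 0 := by omega
  have H' := H.shift (M := 1) e0.ge (by omega)
  obtain ⟨E, _, v, φ, hφ, S⟩ := (G.shift e0).exists_faceSeed H' (hT.shift e0) hp hX (by
    simpa only [HexData.shift, add_sub_cancel, zero_add] using hbad)
  have HE : ((D.shift (a - 1) b c).eval φ).IsSol 1 := (H'.lift (hT.shift e0)).map φ
  have S' := S.g_level_one_ne_zero HE
  refine ⟨fun i j k e => ?_, fun i j k e => ?_, fun i j k e => ?_⟩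
  · have := (S' (i - (a - 1) - 1) (j - b) (k - c) (by omega)).1
    rw [sub_add_cancel] at this
    have := ne_zero_and_inv_mem_of_hom_ne_zero (hp := hp) hφ
      ((hT.shift e0).gx (i - (a - 1)) (j - b) (k - c) (by omega) (by omega)) this
    simpa only [HexData.shift, sub_add_cancel] using this
  · have := (S' (i - (a - 1)) (j - b - 1) (k - c) (by omega)).2.1
    rw [sub_add_cancel] at this
    have := ne_zero_and_inv_mem_of_hom_ne_zero (hp := hp) hφ
      ((hT.shift e0).gy (i - (a - 1)) (j - b) (k - c) (by omega) (by omega)) this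
    simpa only [HexData.shift, sub_add_cancel] using this
  · have := (S' (i - (a - 1)) (j - b) (k - c - 1) (by omega)).2.2
    rw [sub_add_cancel] at this
    have := ne_zero_and_inv_mem_of_hom_ne_zero (hp := hp) hφ
      ((hT.shift e0).gz (i - (a - 1)) (j - b) (k - c) (by omega) (by omega)) this
    simpa only [HexData.shift, sub_add_cancel] using this

/-- At a prime, one of the two families of face variables consists of units in level one. -/
theorem IsGeneric.inv_mem_or_inv_mem (G : D.IsGeneric ch cx cy cz) (H : D.IsSol 1)
    (hT : D.UpTo 1 (· ∈ laurentRing ι K)) (hp : Prime p) (hX : ∀ i, ¬ p ∣ X i) :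
    ((∀ i j k, i + j + k = 1 → (D.fx i j k)⁻¹ ∈ localRing K hp) ∧
      (∀ i j k, i + j + k = 1 → (D.fy i j k)⁻¹ ∈ localRing K hp) ∧
      ∀ i j k, i + j + k = 1 → (D.fz i j k)⁻¹ ∈ localRing K hp) ∨
    (∀ i j k, i + j + k = 1 → D.gx i j k ≠ 0 ∧ (D.gx i j k)⁻¹ ∈ localRing K hp) ∧
      (∀ i j k, i + j + k = 1 → D.gy i j k ≠ 0 ∧ (D.gy i j k)⁻¹ ∈ localRing K hp) ∧
      ∀ i j k, i + j + k = 1 → D.gz i j k ≠ 0 ∧ (D.gz i j k)⁻¹ ∈ localRing K hp := by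
  refine or_iff_not_imp_right.2 fun hg => ?_
  refine ⟨fun i j k e => ?_, fun i j k e => ?_, fun i j k e => ?_⟩ <;> by_contra hf <;> apply hg
  · exact G.inv_mem_of_face H hT hp hX e hf
  · obtain ⟨iy, iz, ix⟩ := G.rot.inv_mem_of_face H.rot hT.rot hp hX (a := j) (b := k) (c := i)
      (by omega) hf
    exact ⟨fun i j k e => ix j k i (by omega), fun i j k e => iy j k i (by omega),
      fun i j k e => iz j k i (by omega)⟩
  · obtain ⟨iz, ix, iy⟩ := G.rot.rot.inv_mem_of_face H.rot.rot hT.rot.rot hp hX (a := k) (b := i)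
      (c := j) (by omega) hf
    exact ⟨fun i j k e => ix k i j (by omega), fun i j k e => iy k i j (by omega),
      fun i j k e => iz k i j (by omega)⟩

/-- A solution whose initial data are independent variables, to which every solution
specializes. -/
structure IsUniversal (D : HexData K) (ch cx cy cz : ℤ → ℤ → ℤ → ι) : Prop extends
    D.IsGeneric ch cx cy cz where
  value : ∀ (P : K → Prop) (w : HexData K),
    (∀ i j k, 0 ≤ i + j + k → i + j + k ≤ 2 → P (w.h i j k)) →
    (∀ i j k, i + j + k = 0 → P (w.fx i j k)) → (∀ i j k, i + j + k = 0 → P (w.fy i j k)) →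
    (∀ i j k, i + j + k = 0 → P (w.fz i j k)) → ∃ y : ι → K, (∀ i, P (y i)) ∧
    (∀ i j k, 0 ≤ i + j + k → i + j + k ≤ 2 → y (ch i j k) = w.h i j k) ∧
    (∀ i j k, i + j + k = 0 → y (cx i j k) = w.fx i j k) ∧
    (∀ i j k, i + j + k = 0 → y (cy i j k) = w.fy i j k) ∧
    ∀ i j k, i + j + k = 0 → y (cz i j k) = w.fz i j k
  isSol : ∀ N, D.IsSol N
  h_ne_zero : ∀ i j k, 0 ≤ i + j + k → D.h i j k ≠ 0
  f_ne_zero : ∀ i j k, 0 ≤ i + j + k → D.fx i j k ≠ 0 ∧ D.fy i j k ≠ 0 ∧ D.fz i j k ≠ 0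

theorem IsUniversal.specialize (U : D.IsUniversal ch cx cy cz) {N : ℕ}
    (hT : D.UpTo N (· ∈ laurentRing ι K)) {D' : HexData K} (H' : D'.IsSol N) (T : Subring K)
    (hne : ∀ i j k, 0 ≤ i + j + k → D'.h i j k ≠ 0)
    (h0 : ∀ i j k, 0 ≤ i + j + k → i + j + k ≤ 2 → D'.h i j k ∈ T ∧ (D'.h i j k)⁻¹ ∈ T)
    (fx0 : ∀ i j k, i + j + k = 0 → D'.fx i j k ≠ 0 ∧ D'.fx i j k ∈ T ∧ (D'.fx i j k)⁻¹ ∈ T)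
    (fy0 : ∀ i j k, i + j + k = 0 → D'.fy i j k ≠ 0 ∧ D'.fy i j k ∈ T ∧ (D'.fy i j k)⁻¹ ∈ T)
    (fz0 : ∀ i j k, i + j + k = 0 → D'.fz i j k ≠ 0 ∧ D'.fz i j k ∈ T ∧ (D'.fz i j k)⁻¹ ∈ T) :
    D'.UpTo N (· ∈ T) := by
  obtain ⟨y, hy, yh, yx, yy, yz⟩ := U.value (fun x => x ≠ 0 ∧ x ∈ T ∧ x⁻¹ ∈ T) D'
    (fun i j k l u => ⟨hne i j k l, h0 i j k l u⟩) fx0 fy0 fz0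
  obtain ⟨φ, hφ⟩ := exists_laurentHom (K := K) y fun i => (hy i).1
  have hφX : ∀ i, φ ⟨algebraMap _ K (X i), algebraMap_mem_laurentRing _⟩ = y i := by
    intro i
    rw [hφ]
    exact eval₂_X _ _ _
  have hmem : ∀ x, φ x ∈ T := hom_mem φ T (fun i => (hφX i).symm ▸ (hy i).2.1)
    fun i => (hφX i).symm ▸ (hy i).2.2
  have ev : ∀ {x : laurentRing ι K} {i : ι} {z : K}, (x : K) =
      algebraMap (MvPolynomial ι ℤ) K (X i) → y i = z → φ x = z := by
    intro x i z e e'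
    rw [← e', ← hφX]
    exact congrArg φ (Subtype.ext e)
  have key : ((D.eval φ).pair D').UpTo N (fun z => z.1 = z.2) :=
    IsSol.eq_of_init (((U.isSol N).lift hT).map φ) H' (fun i j k l _ => hne i j k l)
      (fun i j k e => (fx0 i j k e).1) (fun i j k e => (fy0 i j k e).1)
      (fun i j k e => (fz0 i j k e).1)
      (fun i j k l u => ev ((coe_dite_mem (hT.h i j k l (by omega))).trans (U.h i j k l u))
        (yh i j k l u))
      (fun i j k e => ev ((coe_dite_mem (hT.fx i j k e.ge (by omega))).trans (U.fx i j k e))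
        (yx i j k e))
      (fun i j k e => ev ((coe_dite_mem (hT.fy i j k e.ge (by omega))).trans (U.fy i j k e))
        (yy i j k e))
      (fun i j k e => ev ((coe_dite_mem (hT.fz i j k e.ge (by omega))).trans (U.fz i j k e))
        (yz i j k e))
  have hz : ∀ {x : laurentRing ι K} {z : K}, φ x = z → z ∈ T := fun e => e ▸ hmem _
  exact ⟨fun i j k l u => hz (key.h i j k l u), fun i j k l u => hz (key.fx i j k l u),
    fun i j k l u => hz (key.fy i j k l u), fun i j k l u => hz (key.fz i j k l u),
    fun i j k l u => hz (key.gx i j k l u), fun i j k l u => hz (key.gy i j k l u),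
    fun i j k l u => hz (key.gz i j k l u)⟩

end HexData

namespace HexData

open MvPolynomial

variable {ι : Type u} {K : Type*} [Field K] [Algebra (MvPolynomial ι ℤ) K]
  [IsFractionRing (MvPolynomial ι ℤ) K]
  {D : HexData K} {ch cx cy cz : ℤ → ℤ → ℤ → ι} {p : MvPolynomial ι ℤ}

theorem IsUniversal.upTo_succ (U : D.IsUniversal ch cx cy cz) {n : ℕ} (hn : 4 ≤ n)
    (hT : D.UpTo n (· ∈ laurentRing ι K)) : D.UpTo (n + 1) (· ∈ laurentRing ι K) := by
  refine upTo_laurentRing_of_forall_prime fun p hp hX => ?_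
  have hL : laurentRing ι K ≤ localRing K hp := laurentRing_le_localRing hp hX
  have hO : D.UpTo n (· ∈ localRing K hp) := hT.imp fun x hx => hL hx
  by_cases hv : ∀ i j k, i + j + k = 3 → (D.h i j k)⁻¹ ∈ localRing K hp
  · have h0 : ∀ i j k, 0 ≤ i + j + k → i + j + k ≤ 2 →
        D.h (i + 1) (j + 0) (k + 0) ∈ localRing K hp ∧
          (D.h (i + 1) (j + 0) (k + 0))⁻¹ ∈ localRing K hp := by
      intro i j k l u
      refine ⟨hO.h _ _ _ (by omega) (by omega), ?_⟩
      rcases lt_or_ge (i + j + k) 2 with hl | hl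
      · rw [U.h _ _ _ (by omega) (by omega)]
        exact hL (inv_algebraMap_mem_laurentRing K (X_mem_varMonoid _))
      · exact hv _ _ _ (by omega)
    obtain ⟨ix, iy, iz⟩ | ⟨ix, iy, iz⟩ := U.inv_mem_or_inv_mem (U.isSol 1) (hT.mono (by omega)) hp hX
    · refine UpTo.of_shift (a := 1) (M := n) ?_ hO (by omega)
      rw [add_sub_cancel_right]
      refine U.specialize hT ((U.isSol (n + 1)).shift (by omega) (by omega)) _
        (fun i j k l => U.h_ne_zero _ _ _ (by omega)) h0 (fun i j k e => ?_) (fun i j k e => ?_)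
        fun i j k e => ?_
      · exact ⟨(U.f_ne_zero _ _ _ (by omega)).1, hO.fx _ _ _ (by omega) (by omega),
          ix _ _ _ (by omega)⟩
      · exact ⟨(U.f_ne_zero _ _ _ (by omega)).2.1, hO.fy _ _ _ (by omega) (by omega),
          iy _ _ _ (by omega)⟩
      · exact ⟨(U.f_ne_zero _ _ _ (by omega)).2.2, hO.fz _ _ _ (by omega) (by omega),
          iz _ _ _ (by omega)⟩
    · refine UpTo.swap (D := D.swap) (UpTo.of_shift (a := 1) (M := n) ?_ hO.swap (by omega))
      rw [add_sub_cancel_right]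
      refine U.specialize hT ((U.isSol (n + 1)).swap.shift (by omega) (by omega)) _
        (fun i j k l => U.h_ne_zero _ _ _ (by omega)) h0 (fun i j k e => ?_) (fun i j k e => ?_)
        fun i j k e => ?_
      · obtain ⟨h1, h2⟩ := ix (i + 1) (j + 0) (k + 0) (by omega)
        exact ⟨h1, hO.gx _ _ _ (by omega) (by omega), h2⟩
      · obtain ⟨h1, h2⟩ := iy (i + 1) (j + 0) (k + 0) (by omega)
        exact ⟨h1, hO.gy _ _ _ (by omega) (by omega), h2⟩
      · obtain ⟨h1, h2⟩ := iz (i + 1) (j + 0) (k + 0) (by omega)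
        exact ⟨h1, hO.gz _ _ _ (by omega) (by omega), h2⟩
  · push Not at hv
    obtain ⟨a, b, c, e, hbad⟩ := hv
    obtain ⟨ih, ix, iy, iz⟩ := U.inv_mem_of_vertex_shift (U.isSol 4) (hT.mono (by omega)) hp hX e hbad
    obtain ⟨m, rfl⟩ := Nat.exists_eq_add_of_le hn
    refine UpTo.of_shift (a := 4) (M := (4 + m : ℕ)) ?_ hO (by omega)
    refine UpTo.mono (N := (m + 1 : ℕ)) ?_ (by omega)
    refine U.specialize (hT.mono (by omega)) ((U.isSol (m + 5)).shift (by omega) (by omega)) _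
      (fun i j k l => U.h_ne_zero _ _ _ (by omega)) (fun i j k l u => ?_) (fun i j k e => ?_)
      (fun i j k e => ?_) fun i j k e => ?_
    · exact ⟨hO.h _ _ _ (by omega) (by omega), ih _ _ _ (by omega) (by omega)⟩
    · exact ⟨(U.f_ne_zero _ _ _ (by omega)).1, hO.fx _ _ _ (by omega) (by omega),
        ix _ _ _ (by omega)⟩
    · exact ⟨(U.f_ne_zero _ _ _ (by omega)).2.1, hO.fy _ _ _ (by omega) (by omega),
        iy _ _ _ (by omega)⟩
    · exact ⟨(U.f_ne_zero _ _ _ (by omega)).2.2, hO.fz _ _ _ (by omega) (by omega),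
        iz _ _ _ (by omega)⟩

/-- The Laurent phenomenon for the universal solution. -/
theorem IsUniversal.upTo (U : D.IsUniversal ch cx cy cz) (n : ℕ) :
    D.UpTo n (· ∈ laurentRing ι K) := by
  suffices ∀ m : ℕ, D.UpTo (m + 4 : ℕ) (· ∈ laurentRing ι K) from
    (this n).mono (by push_cast; omega)
  intro m
  induction m with
  | zero => exact U.upTo_four (U.isSol 4) U.h_ne_zero
  | succ m ih => exact (U.upTo_succ (by omega) ih).mono (by push_cast; omega)

end HexData

section Universal

open MvPolynomial HexData

attribute [local instance] MvPolynomial.algebraMvPolynomial in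
theorem exists_isFractionRing_int (σ K : Type*) [Field K] [Algebra (MvPolynomial σ ℚ) K]
    [IsFractionRing (MvPolynomial σ ℚ) K] :
    ∃ _ : Algebra (MvPolynomial σ ℤ) K, IsFractionRing (MvPolynomial σ ℤ) K ∧
      ∀ i, algebraMap (MvPolynomial σ ℤ) K (X i) = algebraMap (MvPolynomial σ ℚ) K (X i) := by
  let f : MvPolynomial σ ℤ →+* K :=
    (algebraMap (MvPolynomial σ ℚ) K).comp (MvPolynomial.map (Int.castRingHom ℚ))
  have hf : Function.Injective f := (IsFractionRing.injective (MvPolynomial σ ℚ) K).comp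
    (map_injective _ Int.cast_injective)
  let A : Algebra (MvPolynomial σ ℤ) K := f.toAlgebra
  refine ⟨A, ?_, fun i => ?_⟩
  · have : FaithfulSMul (MvPolynomial σ ℤ) K := (faithfulSMul_iff_algebraMap_injective _ _).2 hf
    have num : ∀ q : MvPolynomial σ ℚ, ∃ a m : MvPolynomial σ ℤ, m ≠ 0 ∧
        algebraMap (MvPolynomial σ ℚ) K q * f m = f a := by
      intro q
      obtain ⟨⟨a, m⟩, e⟩ := IsLocalization.surj ((nonZeroDivisors ℤ).map (C (σ := σ))) q
      obtain ⟨c, hc, hm⟩ := m.2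
      refine ⟨a, m, ?_, ?_⟩
      · rw [← hm]
        exact (map_ne_zero_iff _ (C_injective σ ℤ)).2 (nonZeroDivisors.ne_zero hc)
      · exact ((map_mul _ _ _).symm.trans (congrArg (algebraMap (MvPolynomial σ ℚ) K) e))
    refine IsFractionRing.of_field _ _ fun z => ?_
    obtain ⟨x, y, hy, rfl⟩ := IsFractionRing.div_surjective (A := MvPolynomial σ ℚ) z
    obtain ⟨a, m, hm, e⟩ := num x
    obtain ⟨b, n, hn, e'⟩ := num y
    refine ⟨a * n, b * m, ?_⟩
    have hm' : f m ≠ 0 := (map_ne_zero_iff _ hf).2 hm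
    have hn' : f n ≠ 0 := (map_ne_zero_iff _ hf).2 hn
    have hy' : algebraMap (MvPolynomial σ ℚ) K y ≠ 0 :=
      (map_ne_zero_iff _ (IsFractionRing.injective _ _)).2 (nonZeroDivisors.ne_zero hy)
    change _ = f (a * n) / f (b * m)
    rw [map_mul, map_mul, ← e, ← e']
    field_simp
  · change algebraMap (MvPolynomial σ ℚ) K (MvPolynomial.map _ (X i)) = _
    rw [map_X]

/-- The label of a vertex variable. -/
def vertexLabel (i j k : ℤ) : HexIdx :=
  if e : 0 ≤ i + j + k ∧ i + j + k ≤ 2 then ⟨Sum.inl (i, j, k), e⟩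
  else ⟨Sum.inl (0, 0, 0), le_rfl, by norm_num⟩

/-- The label of a face variable. -/
def faceLabel (d : Fin 3) (i j k : ℤ) : HexIdx :=
  if e : i + j + k = 0 then ⟨Sum.inr ((i, j, k), d), e⟩
  else ⟨Sum.inl (0, 0, 0), le_rfl, by norm_num⟩

theorem vertexLabel_eq {i j k : ℤ} (l : 0 ≤ i + j + k) (u : i + j + k ≤ 2) :
    vertexLabel i j k = ⟨Sum.inl (i, j, k), l, u⟩ := dif_pos ⟨l, u⟩

theorem faceLabel_eq {d : Fin 3} {i j k : ℤ} (e : i + j + k = 0) :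
    faceLabel d i j k = ⟨Sum.inr ((i, j, k), d), e⟩ := dif_pos e

theorem exists_value {E : Type*} (P : E → Prop) (wh wx wy wz : ℤ → ℤ → ℤ → E)
    (hh : ∀ i j k, 0 ≤ i + j + k → i + j + k ≤ 2 → P (wh i j k))
    (hx : ∀ i j k, i + j + k = 0 → P (wx i j k)) (hy : ∀ i j k, i + j + k = 0 → P (wy i j k))
    (hz : ∀ i j k, i + j + k = 0 → P (wz i j k)) : ∃ y : HexIdx → E, (∀ i, P (y i)) ∧
    (∀ i j k, 0 ≤ i + j + k → i + j + k ≤ 2 → y (vertexLabel i j k) = wh i j k) ∧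
    (∀ i j k, i + j + k = 0 → y (faceLabel 0 i j k) = wx i j k) ∧
    (∀ i j k, i + j + k = 0 → y (faceLabel 1 i j k) = wy i j k) ∧
    ∀ i j k, i + j + k = 0 → y (faceLabel 2 i j k) = wz i j k := by
  let y : (ℤ × ℤ × ℤ) ⊕ ((ℤ × ℤ × ℤ) × Fin 3) → E
    | Sum.inl (i, j, k) => wh i j k
    | Sum.inr ((i, j, k), d) => ![wx, wy, wz] d i j k
  refine ⟨fun q => y q.1, ?_, fun i j k l u => ?_, fun i j k e => ?_, fun i j k e => ?_,
    fun i j k e => ?_⟩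
  · rintro ⟨⟨i, j, k⟩ | ⟨⟨i, j, k⟩, d⟩, h⟩
    · exact hh i j k h.1 h.2
    · fin_cases d
      · exact hx i j k h
      · exact hy i j k h
      · exact hz i j k h
  · rw [vertexLabel_eq l u]
  all_goals rw [faceLabel_eq e]; rfl

end Universal

theorem hexahedron_laurent_phenomenon
    (h hx hy hz : ℤ × ℤ × ℤ → HexField)
    (hne : ∀ v : ℤ × ℤ × ℤ, h v ≠ 0 ∧ hx v ≠ 0 ∧ hy v ≠ 0 ∧ hz v ≠ 0)
    (hinit : ∀ v : ℤ × ℤ × ℤ, ∀ h0 : 0 ≤ v.1 + v.2.1 + v.2.2, ∀ h2 : v.1 + v.2.1 + v.2.2 ≤ 2,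
      h v = hexVar ⟨Sum.inl v, h0, h2⟩)
    (hinitx : ∀ v : ℤ × ℤ × ℤ, ∀ h0 : v.1 + v.2.1 + v.2.2 = 0,
      hx v = hexVar ⟨Sum.inr (v, 0), h0⟩)
    (hinity : ∀ v : ℤ × ℤ × ℤ, ∀ h0 : v.1 + v.2.1 + v.2.2 = 0,
      hy v = hexVar ⟨Sum.inr (v, 1), h0⟩)
    (hinitz : ∀ v : ℤ × ℤ × ℤ, ∀ h0 : v.1 + v.2.1 + v.2.2 = 0,
      hz v = hexVar ⟨Sum.inr (v, 2), h0⟩)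
    (hrec : ∀ v : ℤ × ℤ × ℤ, 0 ≤ v.1 + v.2.1 + v.2.2 → HexRec h hx hy hz v) :
    ∀ v : ℤ × ℤ × ℤ, 0 ≤ v.1 + v.2.1 + v.2.2 →
      h v ∈ Subring.closure (Set.range hexVar ∪ Set.range fun i => (hexVar i)⁻¹)
      ∧ hx v ∈ Subring.closure (Set.range hexVar ∪ Set.range fun i => (hexVar i)⁻¹)
      ∧ hy v ∈ Subring.closure (Set.range hexVar ∪ Set.range fun i => (hexVar i)⁻¹)
      ∧ hz v ∈ Subring.closure (Set.range hexVar ∪ Set.range fun i => (hexVar i)⁻¹) := by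
  obtain ⟨_, _, hX⟩ := exists_isFractionRing_int HexIdx HexField
  have U : (HexData.ofHex h hx hy hz).IsUniversal vertexLabel (faceLabel 0) (faceLabel 1)
      (faceLabel 2) :=
    { h := fun i j k l u => by
        rw [vertexLabel_eq l u, hX]
        exact hinit (i, j, k) l u
      fx := fun i j k e => by
        rw [faceLabel_eq e, hX]
        exact hinitx (i, j, k) e
      fy := fun i j k e => by
        rw [faceLabel_eq e, hX]
        exact hinity (i, j, k) e
      fz := fun i j k e => by
        rw [faceLabel_eq e, hX]
        exact hinitz (i, j, k) e
      weight := fun wh wx wy wz => by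
        obtain ⟨ω, -, hω⟩ := exists_value (fun _ => True) wh wx wy wz (fun _ _ _ _ _ => trivial)
          (fun _ _ _ _ => trivial) (fun _ _ _ _ => trivial) fun _ _ _ _ => trivial
        exact ⟨ω, hω⟩
      value := fun P w => exists_value P w.h w.fx w.fy w.fz
      isSol := HexData.isSol_ofHex hne hrec
      h_ne_zero := fun _ _ _ _ => (hne _).1
      f_ne_zero := fun _ _ _ _ => (hne _).2 }
  set T := Subring.closure (Set.range hexVar ∪ Set.range fun i => (hexVar i)⁻¹)
  have var : ∀ i, hexVar i ∈ T := fun i => Subring.subset_closure (Or.inl ⟨i, rfl⟩)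
  have inv : ∀ i, (hexVar i)⁻¹ ∈ T := fun i => Subring.subset_closure (Or.inr ⟨i, rfl⟩)
  have mem : ∀ x ∈ laurentRing HexIdx HexField, x ∈ T := fun x hx =>
    hom_mem (laurentRing HexIdx HexField).subtype T (fun i => (hX i).symm ▸ var i)
      (fun i => (hX i).symm ▸ inv i) ⟨x, hx⟩
  rintro ⟨i, j, k⟩ l
  have H := (U.upTo (i + j + k).toNat).imp mem
  have e : ((i + j + k).toNat : ℤ) = i + j + k := Int.toNat_of_nonneg l
  exact ⟨H.h i j k l (by omega), H.fx i j k l e.ge, H.fy i j k l e.ge, H.fz i j k l e.ge⟩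
end

section
/- Let a, b, c be positive real numbers. Then the triple (A, B, C) defined by A = √((abc+1)(a+bc)/((b+ac)(c+ab))), B = √((abc+1)(b+ac)/((a+bc)(c+ab))), C = √((abc+1)(c+ab)/((a+bc)(b+ac))) is the unique triple of positive real numbers satisfying the projective equation [abc+1 : a+bc : b+ac : c+ab] = [ABC : A : B : C], i.e., the unique positive triple for which there exists λ > 0 with abc+1 = λ·ABC, a+bc = λ·A, b+ac = λ·B, and c+ab = λ·C. -/
/-- The positive solutions of `[p : q : r : s] = [xyz : x : y : z]`. -/
theorem proportional_prod_iff_eq_sqrt {p q r s : ℝ} (hp : 0 < p) (hq : 0 < q) (hr : 0 < r)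
    (hs : 0 < s) (x y z : ℝ) :
    (0 < x ∧ 0 < y ∧ 0 < z ∧
      ∃ l : ℝ, 0 < l ∧ p = l * (x * y * z) ∧ q = l * x ∧ r = l * y ∧ s = l * z) ↔
    (x = √(p * q / (r * s)) ∧ y = √(p * r / (q * s)) ∧ z = √(p * s / (q * r))) := by
  constructor
  · rintro ⟨hx, hy, hz, l, hl, rfl, rfl, rfl, rfl⟩
    refine ⟨?_, ?_, ?_⟩ <;> symm <;> rw [Real.sqrt_eq_iff_mul_self_eq_of_pos (by assumption)] <;>
      field_simp
  · rintro ⟨rfl, rfl, rfl⟩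
    have hyz : √(p * r / (q * s)) * √(p * s / (q * r)) = p / q := by
      rw [← Real.sqrt_mul (by positivity), Real.sqrt_eq_iff_mul_self_eq_of_pos (by positivity)]
      field_simp
    have hx : q = √(q * r * s / p) * √(p * q / (r * s)) := by
      rw [← Real.sqrt_mul (by positivity), eq_comm, Real.sqrt_eq_iff_mul_self_eq_of_pos hq]
      field_simp
    refine ⟨by positivity, by positivity, by positivity, √(q * r * s / p), by positivity,
      ?_, hx, ?_, ?_⟩
    · rw [mul_assoc √(p * q / (r * s)), hyz, ← mul_assoc, ← hx]
      field_simp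
    · rw [← Real.sqrt_mul (by positivity), eq_comm, Real.sqrt_eq_iff_mul_self_eq_of_pos hr]
      field_simp
    · rw [← Real.sqrt_mul (by positivity), eq_comm, Real.sqrt_eq_iff_mul_self_eq_of_pos hs]
      field_simp

theorem ising_y_delta_unique (a b c : ℝ) (ha : 0 < a) (hb : 0 < b) (hc : 0 < c) :
    ∀ A B C : ℝ,
      (0 < A ∧ 0 < B ∧ 0 < C ∧
        ∃ lam : ℝ, 0 < lam ∧
          a * b * c + 1 = lam * (A * B * C) ∧
          a + b * c = lam * A ∧
          b + a * c = lam * B ∧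
          c + a * b = lam * C)
      ↔ (A = Real.sqrt ((a * b * c + 1) * (a + b * c) / ((b + a * c) * (c + a * b))) ∧
         B = Real.sqrt ((a * b * c + 1) * (b + a * c) / ((a + b * c) * (c + a * b))) ∧
         C = Real.sqrt ((a * b * c + 1) * (c + a * b) / ((a + b * c) * (b + a * c)))) := by
  exact proportional_prod_iff_eq_sqrt (by positivity) (by positivity) (by positivity) (by positivity)
end

section
/- Let R be a commutative ring, n ≥ 3, and let M be a symmetric n×n matrix over R. For S ⊆ {1,2,3}, let M_S denote the principal minor of M obtained as the determinant of the matrix obtained from M by removing the rows and columns indexed by S (so M_∅ = det M). Then Kashaev's relation holds with f₀ = M_∅, f₁ = M_{\{1\}}, f₂ = M_{\{2\}}, f₃ = M_{\{3\}}, f₄ = −M_{\{2,3\}}, f₅ = −M_{\{1,3\}}, f₆ = −M_{\{1,2\}}, f₇ = −M_{\{1,2,3\}}. -/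
/-- Kashaev's relation for eight quantities in a commutative ring. -/
def KashaevRel {R : Type*} [CommRing R] (f0 f1 f2 f3 f4 f5 f6 f7 : R) : Prop :=
  f0 ^ 2 * f7 ^ 2 + f1 ^ 2 * f4 ^ 2 + f2 ^ 2 * f5 ^ 2 + f3 ^ 2 * f6 ^ 2
    - 2 * (f1 * f2 * f4 * f5 + f1 * f3 * f4 * f6 + f2 * f3 * f5 * f6)
    - 2 * f0 * f7 * (f1 * f4 + f2 * f5 + f3 * f6)
    - 4 * (f0 * f4 * f5 * f6 + f7 * f1 * f2 * f3) = 0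

/-- The principal minor of `M` obtained by deleting the rows and columns indexed by `S`. -/
noncomputable def principalMinor {R : Type*} [CommRing R] {n : ℕ}
    (M : Matrix (Fin n) (Fin n) R) (S : Finset (Fin n)) : R :=
  Matrix.det (M.submatrix (fun i : {i : Fin n // i ∉ S} => (i : Fin n))
    (fun j : {j : Fin n // j ∉ S} => (j : Fin n)))

/-- The Schur complement of the principal submatrix of `M` avoiding `T`, with rows and columns
indexed by the full index set. -/
noncomputable def schurComplement {R : Type*} [CommRing R] {n : ℕ}
    (M : Matrix (Fin n) (Fin n) R) (T : Finset (Fin n)) : Matrix (Fin n) (Fin n) R :=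
  M - M.submatrix id (fun j : {j : Fin n // j ∉ T} => (j : Fin n)) *
    (M.submatrix (fun i : {i : Fin n // i ∉ T} => (i : Fin n))
      (fun j : {j : Fin n // j ∉ T} => (j : Fin n)))⁻¹ *
    M.submatrix (fun i : {i : Fin n // i ∉ T} => (i : Fin n)) id

theorem schurComplement_isSymm {R : Type*} [CommRing R] {n : ℕ}
    {M : Matrix (Fin n) (Fin n) R} (hM : M.IsSymm) (T : Finset (Fin n)) :
    (schurComplement M T).IsSymm := by
  unfold Matrix.IsSymm schurComplement
  simp only [Matrix.transpose_sub, Matrix.transpose_mul, Matrix.transpose_nonsing_inv,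
    Matrix.transpose_submatrix, hM.eq, Matrix.mul_assoc]

/-- Schur's determinant formula for principal minors. -/
theorem principalMinor_eq_mul_det_schurComplement {R : Type*} [CommRing R] {n k : ℕ}
    (M : Matrix (Fin n) (Fin n) R) (S T : Finset (Fin n)) (e : Fin k → Fin n)
    (he : Function.Injective e) (heT : ∀ j, e j ∈ T)
    (hS : ∀ i, i ∉ S ↔ (∃ j, e j = i) ∨ i ∉ T) (hD : IsUnit (principalMinor M T)) :
    principalMinor M S =
      principalMinor M T * ((schurComplement M T).submatrix e e).det := by
  let f : Fin k ⊕ {i : Fin n // i ∉ T} → {i : Fin n // i ∉ S} :=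
    Sum.elim (fun j => ⟨e j, (hS _).2 (Or.inl ⟨j, rfl⟩)⟩) (fun i => ⟨i, (hS _).2 (Or.inr i.2)⟩)
  have hf : Function.Bijective f := by
    constructor
    · rintro (a | a) (b | b) h
      · exact congrArg Sum.inl (he (congrArg Subtype.val h))
      · have h' : e a = b := congrArg Subtype.val h
        exact absurd (h' ▸ heT a) b.2
      · have h' : (a : Fin n) = e b := congrArg Subtype.val h
        exact absurd (h' ▸ heT b) a.2
      · exact congrArg Sum.inr (Subtype.ext (congrArg Subtype.val h :))
    · rintro ⟨i, hi⟩
      rcases (hS i).1 hi with ⟨j, rfl⟩ | h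
      · exact ⟨Sum.inl j, rfl⟩
      · exact ⟨Sum.inr ⟨i, h⟩, rfl⟩
  let D := M.submatrix (fun i : {i : Fin n // i ∉ T} => (i : Fin n))
    (fun j : {j : Fin n // j ∉ T} => (j : Fin n))
  have : Invertible D := Matrix.invertibleOfIsUnitDet D hD
  unfold principalMinor
  rw [← Matrix.det_submatrix_equiv_self (Equiv.ofBijective f hf)]
  have hblocks : (M.submatrix (fun i : {i : Fin n // i ∉ S} => (i : Fin n))
      (fun j : {j : Fin n // j ∉ S} => (j : Fin n))).submatrix (Equiv.ofBijective f hf)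
        (Equiv.ofBijective f hf) =
      Matrix.fromBlocks (M.submatrix e e) (M.submatrix e Subtype.val)
        (M.submatrix Subtype.val e) D := by
    ext (i | i) (j | j) <;> rfl
  rw [hblocks, Matrix.det_fromBlocks₂₂, Matrix.invOf_eq_nonsing_inv]
  rfl

theorem map_principalMinor {R A : Type*} [CommRing R] [CommRing A] (φ : R →+* A) {n : ℕ}
    (M : Matrix (Fin n) (Fin n) R) (S : Finset (Fin n)) :
    φ (principalMinor M S) = principalMinor (M.map φ) S := by
  unfold principalMinor
  rw [RingHom.map_det]
  rfl

theorem KashaevRel.map {R A : Type*} [CommRing R] [CommRing A] (φ : R →+* A)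
    {f0 f1 f2 f3 f4 f5 f6 f7 : R} (h : KashaevRel f0 f1 f2 f3 f4 f5 f6 f7) :
    KashaevRel (φ f0) (φ f1) (φ f2) (φ f3) (φ f4) (φ f5) (φ f6) (φ f7) := by
  unfold KashaevRel at h ⊢
  simpa [map_ofNat φ] using congrArg φ h

theorem KashaevRel.of_map {R A : Type*} [CommRing R] [CommRing A] (φ : R →+* A)
    (hφ : Function.Injective φ) {f0 f1 f2 f3 f4 f5 f6 f7 : R}
    (h : KashaevRel (φ f0) (φ f1) (φ f2) (φ f3) (φ f4) (φ f5) (φ f6) (φ f7)) :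
    KashaevRel f0 f1 f2 f3 f4 f5 f6 f7 := by
  unfold KashaevRel at h ⊢
  apply hφ
  simpa [map_ofNat φ] using h

/-- Kashaev's relation when the minor avoiding all three indices is invertible. -/
theorem kashaevRel_principalMinor_of_isUnit {R : Type*} [CommRing R] {n : ℕ}
    {M : Matrix (Fin n) (Fin n) R} (hM : M.IsSymm) {a b c : Fin n}
    (hab : a ≠ b) (hac : a ≠ c) (hbc : b ≠ c) (hD : IsUnit (principalMinor M {a, b, c})) :
    KashaevRel (principalMinor M ∅) (principalMinor M {a}) (principalMinor M {b})
      (principalMinor M {c}) (-principalMinor M {b, c}) (-principalMinor M {a, c})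
      (-principalMinor M {a, b}) (-principalMinor M {a, b, c}) := by
  have hs := schurComplement_isSymm hM {a, b, c}
  have h0 := principalMinor_eq_mul_det_schurComplement M ∅ {a, b, c} ![a, b, c]
    (by intro i j; fin_cases i <;> fin_cases j <;> simp [hab, hac, hbc, hab.symm, hac.symm, hbc.symm])
    (by intro i; fin_cases i <;> simp)
    (by intro i; simp [Fin.exists_fin_succ]; grind) hD
  have pair (S : Finset (Fin n)) (x y : Fin n) (hxy : x ≠ y) (hx : x ∈ ({a, b, c} : Finset _))
      (hy : y ∈ ({a, b, c} : Finset _))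
      (hS : ∀ i, i ∉ S ↔ (x = i ∨ y = i) ∨ i ∉ ({a, b, c} : Finset _)) :=
    principalMinor_eq_mul_det_schurComplement M S {a, b, c} ![x, y]
      (by intro i j; fin_cases i <;> fin_cases j <;> simp [hxy, hxy.symm])
      (by intro i; fin_cases i <;> assumption)
      (by intro i; rw [hS]; simp [Fin.exists_fin_succ]) hD
  have single (S : Finset (Fin n)) (x : Fin n) (hx : x ∈ ({a, b, c} : Finset _))
      (hS : ∀ i, i ∉ S ↔ x = i ∨ i ∉ ({a, b, c} : Finset _)) :=
    principalMinor_eq_mul_det_schurComplement M S {a, b, c} ![x]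
      (Function.injective_of_subsingleton _)
      (by intro i; fin_cases i; assumption)
      (by intro i; rw [hS]; simp) hD
  have h1 := pair {a} b c hbc (by simp) (by simp) (by intro i; simp; grind)
  have h2 := pair {b} a c hac (by simp) (by simp) (by intro i; simp; grind)
  have h3 := pair {c} a b hab (by simp) (by simp) (by intro i; simp; grind)
  have h4 := single {b, c} a (by simp) (by intro i; simp; grind)
  have h5 := single {a, c} b (by simp) (by intro i; simp; grind)
  have h6 := single {a, b} c (by simp) (by intro i; simp; grind)
  rw [h0, h1, h2, h3, h4, h5, h6]
  simp only [Matrix.det_fin_three, Matrix.det_fin_two, Matrix.det_fin_one, Matrix.submatrix_apply,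
    Matrix.cons_val, hs.apply a b, hs.apply a c, hs.apply b c]
  unfold KashaevRel
  ring

/-- Principal minors of `X + M` are monic polynomials. -/
theorem principalMinor_charmatrix_neg_monic {R : Type*} [CommRing R] {n : ℕ}
    (M : Matrix (Fin n) (Fin n) R) (S : Finset (Fin n)) :
    (principalMinor (Matrix.charmatrix (-M)) S).Monic := by
  have h : (Matrix.charmatrix (-M)).submatrix (fun i : {i : Fin n // i ∉ S} => (i : Fin n))
      (fun j : {j : Fin n // j ∉ S} => (j : Fin n)) =
      Matrix.charmatrix ((-M).submatrix (fun i : {i : Fin n // i ∉ S} => (i : Fin n))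
        (fun j : {j : Fin n // j ∉ S} => (j : Fin n))) := by
    ext1 i j
    simp [Matrix.charmatrix_apply, Matrix.diagonal_apply, Subtype.ext_iff]
  unfold principalMinor
  rw [h]
  exact Matrix.charpoly_monic _

theorem kashaev_principal_minors {R : Type*} [CommRing R] {n : ℕ} (hn : 3 ≤ n)
    (M : Matrix (Fin n) (Fin n) R) (hM : M.IsSymm) :
    KashaevRel
      (principalMinor M (∅ : Finset (Fin n)))
      (principalMinor M {⟨0, by omega⟩})
      (principalMinor M {⟨1, by omega⟩})
      (principalMinor M {⟨2, by omega⟩})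
      (-principalMinor M {⟨1, by omega⟩, ⟨2, by omega⟩})
      (-principalMinor M {⟨0, by omega⟩, ⟨2, by omega⟩})
      (-principalMinor M {⟨0, by omega⟩, ⟨1, by omega⟩})
      (-principalMinor M {⟨0, by omega⟩, ⟨1, by omega⟩, ⟨2, by omega⟩}) := by
  let φ := algebraMap (Polynomial R) (FractionRing (Polynomial R))
  have hφ : Function.Injective φ :=
    IsFractionRing.injective (Polynomial R) (FractionRing (Polynomial R))
  have hP : (Matrix.charmatrix (-M)).IsSymm := by
    rw [Matrix.IsSymm, ← Matrix.charmatrix_transpose, Matrix.transpose_neg, hM.eq]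
  have hev : (Matrix.charmatrix (-M)).map (Polynomial.evalRingHom (0 : R)) = M := by
    ext i j
    simp [Matrix.charmatrix_apply, Matrix.diagonal_apply, apply_ite]
  have key := kashaevRel_principalMinor_of_isUnit (hP.map φ)
    (a := ⟨0, by omega⟩) (b := ⟨1, by omega⟩) (c := ⟨2, by omega⟩)
    (by simp) (by simp) (by simp) (by
      rw [← map_principalMinor]
      exact IsLocalization.map_units (FractionRing (Polynomial R))
        (⟨_, (principalMinor_charmatrix_neg_monic M _).mem_nonZeroDivisors⟩ :
          nonZeroDivisors (Polynomial R)))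
  simp only [← map_principalMinor, ← map_neg φ] at key
  have h := (KashaevRel.of_map φ hφ key).map (Polynomial.evalRingHom (0 : R))
  simpa only [map_neg (Polynomial.evalRingHom (0 : R)), map_principalMinor, hev] using h
end

section
/- Let f, f₍₁₎, f₍₂₎, f₍₃₎, f₍₁₂₎, f₍₁₃₎, f₍₂₃₎ be positive real numbers. Set X = √(f·f₍₂₃₎ + f₍₂₎f₍₃₎), Y = √(f·f₍₁₃₎ + f₍₁₎f₍₃₎), Z = √(f·f₍₁₂₎ + f₍₁₎f₍₂₎), and define f₍₁₂₃₎ := (2f₍₁₎f₍₂₎f₍₃₎ + f·f₍₁₎f₍₂₃₎ + f·f₍₂₎f₍₁₃₎ + f·f₍₃₎f₍₁₂₎ + 2XYZ)/f². Then the eight quantities f, f₍₁₎, f₍₂₎, f₍₃₎, f₍₁₂₎, f₍₁₃₎, f₍₂₃₎, f₍₁₂₃₎ satisfy Kashaev's difference equation. -/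
/-- Kashaev's difference equation for eight quantities
`f, f₍₁₎, f₍₂₎, f₍₃₎, f₍₁₂₎, f₍₁₃₎, f₍₂₃₎, f₍₁₂₃₎`. -/
def KashaevEqn {R : Type*} [CommRing R]
    (f f1 f2 f3 f12 f13 f23 f123 : R) : Prop :=
  f ^ 2 * f123 ^ 2 + f1 ^ 2 * f23 ^ 2 + f2 ^ 2 * f13 ^ 2 + f3 ^ 2 * f12 ^ 2
    - 2 * f1 * f2 * f23 * f13 - 2 * f1 * f3 * f23 * f12 - 2 * f2 * f3 * f12 * f13
    - 2 * f * f123 * (f1 * f23 + f2 * f13 + f3 * f12)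
    - 4 * f * f23 * f13 * f12 - 4 * f123 * f1 * f2 * f3 = 0

theorem kashaev_canonical_root (f f1 f2 f3 f12 f13 f23 : ℝ)
    (hf : 0 < f) (hf1 : 0 < f1) (hf2 : 0 < f2) (hf3 : 0 < f3)
    (hf12 : 0 < f12) (hf13 : 0 < f13) (hf23 : 0 < f23) :
    KashaevEqn f f1 f2 f3 f12 f13 f23
      ((2 * f1 * f2 * f3 + f * f1 * f23 + f * f2 * f13 + f * f3 * f12 +
          2 * Real.sqrt (f * f23 + f2 * f3) * Real.sqrt (f * f13 + f1 * f3) *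
            Real.sqrt (f * f12 + f1 * f2)) / f ^ 2) := by
  have hX := Real.sq_sqrt (show 0 ≤ f * f23 + f2 * f3 by positivity)
  have hY := Real.sq_sqrt (show 0 ≤ f * f13 + f1 * f3 by positivity)
  have hZ := Real.sq_sqrt (show 0 ≤ f * f12 + f1 * f2 by positivity)
  generalize Real.sqrt (f * f23 + f2 * f3) = X at *
  generalize Real.sqrt (f * f13 + f1 * f3) = Y at *
  generalize Real.sqrt (f * f12 + f1 * f2) = Z at *
  have hP : (X * Y * Z) ^ 2 =
      (f * f23 + f2 * f3) * (f * f13 + f1 * f3) * (f * f12 + f1 * f2) := by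
    rw [mul_pow, mul_pow, hX, hY, hZ]
  obtain ⟨g, hg⟩ : ∃ g, g = (2 * f1 * f2 * f3 + f * f1 * f23 + f * f2 * f13 + f * f3 * f12 +
      2 * X * Y * Z) / f ^ 2 := ⟨_, rfl⟩
  rw [← hg]
  rw [eq_div_iff (by positivity)] at hg
  have hsq : (g * f ^ 2 - (2 * f1 * f2 * f3 + f * f1 * f23 + f * f2 * f13 + f * f3 * f12)) ^ 2 =
      4 * (X * Y * Z) ^ 2 := by
    rw [hg]; ring
  have hf' : f ^ 2 ≠ 0 := by positivity
  unfold KashaevEqn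
  apply mul_left_cancel₀ hf'
  linear_combination hsq + 4 * hP
end

section
/- Let a₀, a₄, a₅, a₆, a₇, a₈, a₉ be positive real numbers. Define a₁ := √(a₅a₆ + a₀a₇), a₂ := √(a₄a₆ + a₀a₈), a₃ := √(a₄a₅ + a₀a₉), and define a₀* := (a₁²a₂²a₃² + a₁a₂a₃(2a₄a₅a₆ + a₀a₄a₇ + a₀a₅a₈ + a₀a₆a₉) + (a₅a₆ + a₀a₇)(a₄a₅ + a₀a₉)(a₄a₆ + a₀a₈)) / (a₀²a₁a₂a₃) (the superurban renewal formula for the central variable). Then Kashaev's relation holds with f₀ = a₀, f₁ = a₄, f₂ = a₅, f₃ = a₆, f₄ = a₇, f₅ = a₈, f₆ = a₉, f₇ = a₀*. -/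
/-- `f0 ^ 2` times Kashaev's polynomial is a difference of squares, so the relation holds as soon as
`f7` is given by the quadratic formula. -/
theorem KashaevRel.of_quadratic_formula {R : Type*} [CommRing R] [NoZeroDivisors R]
    {f0 f1 f2 f3 f4 f5 f6 f7 p : R} (h0 : f0 ≠ 0)
    (hp : p ^ 2 = (f2 * f3 + f0 * f4) * (f1 * f3 + f0 * f5) * (f1 * f2 + f0 * f6))
    (h7 : f0 ^ 2 * f7 = 2 * f1 * f2 * f3 + f0 * f1 * f4 + f0 * f2 * f5 + f0 * f3 * f6 + 2 * p) :
    KashaevRel f0 f1 f2 f3 f4 f5 f6 f7 := by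
  unfold KashaevRel
  apply (mul_eq_zero.mp _).resolve_left (pow_ne_zero 2 h0)
  linear_combination
    (f0 ^ 2 * f7 - (2 * f1 * f2 * f3 + f0 * f1 * f4 + f0 * f2 * f5 + f0 * f3 * f6) + 2 * p) * h7
      + 4 * hp

theorem superurban_specializes_to_kashaev
    (a0 a4 a5 a6 a7 a8 a9 : ℝ)
    (h0 : 0 < a0) (h4 : 0 < a4) (h5 : 0 < a5) (h6 : 0 < a6)
    (h7 : 0 < a7) (h8 : 0 < a8) (h9 : 0 < a9)
    (a1 a2 a3 a0star : ℝ)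
    (ha1 : a1 = Real.sqrt (a5 * a6 + a0 * a7))
    (ha2 : a2 = Real.sqrt (a4 * a6 + a0 * a8))
    (ha3 : a3 = Real.sqrt (a4 * a5 + a0 * a9))
    (ha0star : a0star =
      (a1 ^ 2 * a2 ^ 2 * a3 ^ 2
        + a1 * a2 * a3 * (2 * a4 * a5 * a6 + a0 * a4 * a7 + a0 * a5 * a8 + a0 * a6 * a9)
        + (a5 * a6 + a0 * a7) * (a4 * a5 + a0 * a9) * (a4 * a6 + a0 * a8))
        / (a0 ^ 2 * a1 * a2 * a3)) :
    KashaevRel a0 a4 a5 a6 a7 a8 a9 a0star := by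
  have hp1 : 0 < a5 * a6 + a0 * a7 := by positivity
  have hp2 : 0 < a4 * a6 + a0 * a8 := by positivity
  have hp3 : 0 < a4 * a5 + a0 * a9 := by positivity
  have hs1 : a1 ^ 2 = a5 * a6 + a0 * a7 := ha1 ▸ Real.sq_sqrt hp1.le
  have hs2 : a2 ^ 2 = a4 * a6 + a0 * a8 := ha2 ▸ Real.sq_sqrt hp2.le
  have hs3 : a3 ^ 2 = a4 * a5 + a0 * a9 := ha3 ▸ Real.sq_sqrt hp3.le
  have hn1 : a1 ≠ 0 := ha1 ▸ (Real.sqrt_pos.mpr hp1).ne'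
  have hn2 : a2 ≠ 0 := ha2 ▸ (Real.sqrt_pos.mpr hp2).ne'
  have hn3 : a3 ≠ 0 := ha3 ▸ (Real.sqrt_pos.mpr hp3).ne'
  refine KashaevRel.of_quadratic_formula (p := a1 * a2 * a3) h0.ne' ?_ ?_
  · rw [mul_pow, mul_pow, hs1, hs2, hs3]
  · rw [ha0star, ← hs1, ← hs2, ← hs3]
    field_simp
    ring
end
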